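/- arXiv:2109.01600 — 2 statements merged into one kernel-verified Lean document; each statement's English description precedes it below -/
import Mathlib

section
/- Let G be a connected digraph with Δ_max(G) = k ≥ 2. Then G is a member of 𝓑_k, or G is a k-tree, or there exists a vertex v with max(d⁺(v), d⁻(v)) = k such that no connected component of G − v is a k-tree. -/
/-- A digraph: no loops, no parallel arcs (arcs given by a relation), digons allowed. -/
structure Digraph' (V : Type) where
  Adj : V → V → Prop
  irrefl : ∀ v, ¬ Adj v v

namespace Digraph'

variable {V : Type} (G : Digraph' V)

/-- Out-degree of a vertex. -/
noncomputable def outDeg (v : V) : ℕ := Nat.card {w : V // G.Adj v w}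

/-- In-degree of a vertex. -/
noncomputable def inDeg (v : V) : ℕ := Nat.card {w : V // G.Adj w v}

/-- `d_min(v) = min(d⁺(v), d⁻(v))`. -/
noncomputable def dmin (v : V) : ℕ := min (G.outDeg v) (G.inDeg v)

/-- `d_max(v) = max(d⁺(v), d⁻(v))`. -/
noncomputable def dmax (v : V) : ℕ := max (G.outDeg v) (G.inDeg v)

/-- `Δ_min(G) = max_v min(d⁺(v), d⁻(v))`. -/
noncomputable def DeltaMin : ℕ := sSup (Set.range G.dmin)

/-- `Δ_max(G) = max_v max(d⁺(v), d⁻(v))`. -/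
noncomputable def DeltaMax : ℕ := sSup (Set.range G.dmax)

/-- A set of vertices is acyclic if it carries no directed cycle. -/
def AcyclicSet (S : Set V) : Prop :=
  ∀ v : V, ¬ Relation.TransGen (fun x y => x ∈ S ∧ y ∈ S ∧ G.Adj x y) v v

/-- `G` is `k`-dicolourable: its vertex set partitions into `k` acyclic colour classes. -/
def Dicolourable (k : ℕ) : Prop :=
  ∃ f : V → Fin k, ∀ c : Fin k, G.AcyclicSet {v | f v = c}

/-- The dichromatic number. -/
noncomputable def dichromaticNumber : ℕ := sInf {k | G.Dicolourable k}

/-- `G` is connected (its underlying undirected graph is connected). -/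
def Connected : Prop :=
  Nonempty V ∧ ∀ x y : V, Relation.ReflTransGen (fun a b => G.Adj a b ∨ G.Adj b a) x y

/-- The subdigraph induced on a set of vertices. -/
def induce (S : Set V) : Digraph' S :=
  ⟨fun a b => G.Adj a b, fun a h => G.irrefl a h⟩

/-- The connected component (of the underlying graph) containing `v`. -/
def component (v : V) : Set V :=
  {u | Relation.ReflTransGen (fun a b => G.Adj a b ∨ G.Adj b a) v u}

/-- `G` is a directed cycle. -/
def IsDirectedCycle : Prop :=
  ∃ n : ℕ, 2 ≤ n ∧ ∃ e : V ≃ ZMod n, ∀ x y : V, G.Adj x y ↔ e y = e x + 1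

/-- `G` is a symmetric cycle of odd length. -/
def IsSymmetricOddCycle : Prop :=
  ∃ n : ℕ, 3 ≤ n ∧ Odd n ∧ ∃ e : V ≃ ZMod n,
    ∀ x y : V, G.Adj x y ↔ (e y = e x + 1 ∨ e x = e y + 1)

/-- `G` is a symmetric complete digraph (a digon between any two distinct vertices). -/
def IsSymmetricComplete : Prop := ∀ x y : V, G.Adj x y ↔ x ≠ y

/-- `G` is a member of `𝓑_k`: directed cycles for `k = 1`, symmetric odd cycles for
`k = 2`, and the symmetric complete digraph on `k+1` vertices for `k ≥ 3`. -/
def IsException (k : ℕ) : Prop :=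
  (k = 1 ∧ G.IsDirectedCycle) ∨ (k = 2 ∧ G.IsSymmetricOddCycle) ∨
  (3 ≤ k ∧ G.IsSymmetricComplete ∧ Nat.card V = k + 1)

end Digraph'

namespace Digraph'

/-- A digraph is buildable (as a `k`-tree) if it is a member of `𝓑_{k−1}`, or is
obtained from buildable digraphs by a direct composition (adding exactly one arc
between two chosen vertices) or a cyclic composition (joining `ℓ ≥ 2` buildable
digraphs cyclically through chosen vertices), up to isomorphism. -/
inductive Buildable (k : ℕ) : {V : Type} → Digraph' V → Prop
  | base {V : Type} (G : Digraph' V) : G.IsException (k - 1) → Buildable k G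
  | direct {V₁ V₂ : Type} (G₁ : Digraph' V₁) (G₂ : Digraph' V₂)
      (v₁ : V₁) (v₂ : V₂) (d : Bool) (G : Digraph' (V₁ ⊕ V₂)) :
      Buildable k G₁ → Buildable k G₂ →
      (∀ a b, G.Adj a b ↔
        ((∃ x y, a = Sum.inl x ∧ b = Sum.inl y ∧ G₁.Adj x y) ∨
         (∃ x y, a = Sum.inr x ∧ b = Sum.inr y ∧ G₂.Adj x y) ∨
         (d = true ∧ a = Sum.inl v₁ ∧ b = Sum.inr v₂) ∨
         (d = false ∧ a = Sum.inr v₂ ∧ b = Sum.inl v₁))) →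
      Buildable k G
  | cyclic {n : ℕ} (hn : 2 ≤ n) (Vf : Fin n → Type) (Gf : ∀ i, Digraph' (Vf i))
      (vf : ∀ i, Vf i) (G : Digraph' (Σ i, Vf i)) :
      (∀ i, Buildable k (Gf i)) →
      (∀ a b, G.Adj a b ↔
        ((∃ (i : Fin n) (x y : Vf i), a = ⟨i, x⟩ ∧ b = ⟨i, y⟩ ∧ (Gf i).Adj x y) ∨
         (∃ i : Fin n, a = ⟨i, vf i⟩ ∧ b = ⟨i + ⟨1, by omega⟩, vf (i + ⟨1, by omega⟩)⟩))) →
      Buildable k G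
  | iso {V W : Type} (e : V ≃ W) (G : Digraph' V) (H : Digraph' W) :
      (∀ x y, G.Adj x y ↔ H.Adj (e x) (e y)) → Buildable k G → Buildable k H

/-- A `k`-tree: a buildable digraph with `Δ_max ≤ k`. -/
def IsKTree (k : ℕ) {V : Type} (G : Digraph' V) : Prop :=
  G.DeltaMax ≤ k ∧ Buildable k G

/-- `G` is a symmetric path of odd length (an undirected path with an odd number of
edges, each edge replaced by a digon). -/
def IsSymmetricOddPath {V : Type} (G : Digraph' V) : Prop :=
  ∃ n : ℕ, 2 ≤ n ∧ Even n ∧ ∃ e : V ≃ Fin n,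
    ∀ x y : V, G.Adj x y ↔ ((e y).val = (e x).val + 1 ∨ (e x).val = (e y).val + 1)

end Digraph'

namespace KTP

open Set Digraph'

variable {V : Type}

/-- `S` induces a buildable digraph. -/
def KT (G : Digraph' V) (k : ℕ) (S : Set V) : Prop := Buildable k (G.induce S)

theorem KT.of_embed {W : Type} {G : Digraph' V} {k : ℕ} {H : Digraph' W} (f : W → V)
    (hf : Function.Injective f) (hadj : ∀ x y, H.Adj x y ↔ G.Adj (f x) (f y))
    (h : Buildable k H) : KT G k (range f) :=
  Buildable.iso (Equiv.ofInjective f hf) H _ (fun x y => hadj x y) h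

/-- A directed chain of buildable sets. -/
inductive Ch (G : Digraph' V) (k : ℕ) : V → V → Set V → Prop
  | single (A : Set V) (p : V) : KT G k A → p ∈ A → Ch G k p p A
  | cons (A C : Set V) (p p' q : V) : KT G k A → p ∈ A → Ch G k p' q C → Disjoint A C →
      (∀ x ∈ A, ∀ y ∈ C, (G.Adj x y ↔ x = p ∧ y = p') ∧ ¬ G.Adj y x) → Ch G k p q (A ∪ C)

theorem Ch.mem {G : Digraph' V} {k : ℕ} {p q : V} {S : Set V} (h : Ch G k p q S) :
    p ∈ S ∧ q ∈ S := by
  induction h with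
  | single A p hA hp => exact ⟨hp, hp⟩
  | cons A C p p' q hA hp hC hd har ih => exact ⟨Or.inl hp, Or.inr ih.2⟩

theorem KT.direct {G : Digraph' V} {k : ℕ} {A B : Set V} {a b : V} (hA : KT G k A)
    (hB : KT G k B) (hd : Disjoint A B) (ha : a ∈ A) (hb : b ∈ B)
    (h : ∀ x ∈ A, ∀ y ∈ B, (G.Adj x y ↔ x = a ∧ y = b) ∧ ¬ G.Adj y x) :
    KT G k (A ∪ B) := by
  let f : A ⊕ B → V := Sum.elim Subtype.val Subtype.val
  have hf : Function.Injective f := by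
    rintro (⟨x, hx⟩ | ⟨x, hx⟩) (⟨y, hy⟩ | ⟨y, hy⟩) hxy <;> simp only [f, Sum.elim_inl, Sum.elim_inr] at hxy
    · subst hxy; rfl
    · subst hxy; exact absurd hy (Set.disjoint_left.1 hd hx)
    · subst hxy; exact absurd hx (Set.disjoint_left.1 hd hy)
    · subst hxy; rfl
  let H : Digraph' (A ⊕ B) := ⟨fun x y => G.Adj (f x) (f y), fun x => G.irrefl _⟩
  have hr : range f = A ∪ B := by simp [f]
  rw [← hr]
  refine KT.of_embed f hf (H := H) (fun x y => Iff.rfl) ?_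
  refine Buildable.direct (G.induce A) (G.induce B) ⟨a, ha⟩ ⟨b, hb⟩ true H hA hB ?_
  rintro (⟨x, hx⟩ | ⟨x, hx⟩) (⟨y, hy⟩ | ⟨y, hy⟩)
  · simp [H, f, Digraph'.induce]
  · simpa [H, f, Digraph'.induce] using (h x hx y hy).1
  · simpa [H, f, Digraph'.induce] using (h y hy x hx).2
  · simp [H, f, Digraph'.induce]

theorem Ch.kt {G : Digraph' V} {k : ℕ} {p q : V} {S : Set V} (h : Ch G k p q S) :
    KT G k S := by
  induction h with
  | single A p hA hp => exact hA
  | cons A C p p' q hA hp hC hd har ih => exact hA.direct ih hd hp hC.mem.1 har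

theorem Ch.family {G : Digraph' V} {k : ℕ} {p q : V} {S : Set V} (h : Ch G k p q S) :
    ∃ (m : ℕ) (P : ℕ → Set V) (r : ℕ → V), (∀ i ≤ m, KT G k (P i) ∧ r i ∈ P i) ∧
      (∀ x, x ∈ S ↔ ∃ i ≤ m, x ∈ P i) ∧ r 0 = p ∧ r m = q ∧
      (∀ i ≤ m, ∀ j ≤ m, ∀ x, x ∈ P i → x ∈ P j → i = j) ∧
      (∀ i ≤ m, ∀ j ≤ m, i ≠ j → ∀ x ∈ P i, ∀ y ∈ P j,
        (G.Adj x y ↔ j = i + 1 ∧ x = r i ∧ y = r j)) := by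
  induction h with
  | single A p hA hp =>
    refine ⟨0, fun _ => A, fun _ => p, fun i _ => ⟨hA, hp⟩, fun x => by simp, rfl, rfl, ?_, ?_⟩
    · intro i hi j hj; omega
    · intro i hi j hj; omega
  | cons A C p p' q hA hp hC hd har ih =>
    obtain ⟨m, P, r, h1, h2, h3, h4, h5, h6⟩ := ih
    refine ⟨m + 1, fun i => Nat.casesOn i A P, fun i => Nat.casesOn i p r, ?_, ?_, rfl, h4, ?_, ?_⟩
    · rintro (_ | i) hi
      · exact ⟨hA, hp⟩
      · exact h1 i (by omega)
    · intro x
      constructor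
      · rintro (hx | hx)
        · exact ⟨0, by omega, hx⟩
        · obtain ⟨i, hi, hx⟩ := (h2 x).1 hx
          exact ⟨i + 1, by omega, hx⟩
      · rintro ⟨_ | i, hi, hx⟩
        · exact Or.inl hx
        · exact Or.inr ((h2 x).2 ⟨i, by omega, hx⟩)
    · rintro (_ | i) hi (_ | j) hj x hxi hxj
      · rfl
      · exact absurd ((h2 x).2 ⟨j, by omega, hxj⟩) (Set.disjoint_left.1 hd hxi)
      · exact absurd ((h2 x).2 ⟨i, by omega, hxi⟩) (Set.disjoint_left.1 hd hxj)
      · rw [h5 i (by omega) j (by omega) x hxi hxj]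
    · rintro (_ | i) hi (_ | j) hj hij x hx y hy
      · exact absurd rfl hij
      · have hyC : y ∈ C := (h2 y).2 ⟨j, by omega, hy⟩
        rw [(har x hx y hyC).1]
        constructor
        · rintro ⟨rfl, rfl⟩
          have : j = 0 := by
            refine h5 j (by omega) 0 (by omega) _ hy ?_
            rw [← h3]; exact (h1 0 (by omega)).2
          subst this
          exact ⟨rfl, rfl, h3.symm⟩
        · rintro ⟨hj, rfl, h⟩
          have : j = 0 := by omega
          subst this
          exact ⟨rfl, h.trans h3⟩
      · have hxC : x ∈ C := (h2 x).2 ⟨i, by omega, hx⟩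
        have := (har y hy x hxC).2
        simp only [this, false_iff]
        rintro ⟨h, -⟩
        omega
      · have := h6 i (by omega) j (by omega) (by omega) x hx y hy
        rw [this]
        simp

theorem KT.cyc {G : Digraph' V} {k : ℕ} {A C : Set V} {v p q : V} (hA : KT G k A) (hv : v ∈ A)
    (hC : Ch G k p q C) (hd : Disjoint A C)
    (h : ∀ x ∈ A, ∀ y ∈ C, (G.Adj x y ↔ x = v ∧ y = p) ∧ (G.Adj y x ↔ y = q ∧ x = v)) :
    KT G k (A ∪ C) := by
  obtain ⟨m, P, r, h1, h2, h3, h4, h5, h6⟩ := hC.family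
  let P' : ℕ → Set V := fun i => Nat.casesOn i A P
  let r' : ℕ → V := fun i => Nat.casesOn i v r
  have k1 : ∀ i < m + 2, KT G k (P' i) ∧ r' i ∈ P' i := by
    rintro (_ | i) hi
    · exact ⟨hA, hv⟩
    · exact h1 i (by omega)
  have k5 : ∀ i < m + 2, ∀ j < m + 2, ∀ x, x ∈ P' i → x ∈ P' j → i = j := by
    rintro (_ | i) hi (_ | j) hj x hxi hxj
    · rfl
    · exact absurd ((h2 x).2 ⟨j, by omega, hxj⟩) (Set.disjoint_left.1 hd hxi)
    · exact absurd ((h2 x).2 ⟨i, by omega, hxi⟩) (Set.disjoint_left.1 hd hxj)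
    · rw [h5 i (by omega) j (by omega) x hxi hxj]
  have k6 : ∀ i < m + 2, ∀ j < m + 2, i ≠ j → ∀ x ∈ P' i, ∀ y ∈ P' j,
      (G.Adj x y ↔ j = (i + 1) % (m + 2) ∧ x = r' i ∧ y = r' j) := by
    rintro (_ | i) hi (_ | j) hj hij x hx y hy
    · exact absurd rfl hij
    · have hyC : y ∈ C := (h2 y).2 ⟨j, by omega, hy⟩
      rw [(h x hx y hyC).1, Nat.mod_eq_of_lt (by omega)]
      constructor
      · rintro ⟨rfl, rfl⟩
        have : j = 0 := by
          refine h5 j (by omega) 0 (by omega) _ hy ?_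
          rw [← h3]; exact (h1 0 (by omega)).2
        subst this
        exact ⟨rfl, rfl, h3.symm⟩
      · rintro ⟨hj, rfl, h⟩
        have : j = 0 := by omega
        subst this
        exact ⟨rfl, h.trans h3⟩
    · have hxC : x ∈ C := (h2 x).2 ⟨i, by omega, hx⟩
      rw [(h y hy x hxC).2]
      constructor
      · rintro ⟨rfl, rfl⟩
        have : i = m := by
          refine h5 i (by omega) m (by omega) _ hx ?_
          rw [← h4]; exact (h1 m (by omega)).2
        subst this
        refine ⟨by simp, h4.symm, rfl⟩
      · rintro ⟨hj, hx', h⟩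
        have : i = m := by
          by_contra hne
          rw [Nat.mod_eq_of_lt (by omega)] at hj
          omega
        subst this
        exact ⟨hx'.trans h4, h⟩
    · rw [h6 i (by omega) j (by omega) (by omega) x hx y hy]
      have : (j = i + 1) ↔ (j + 1 = (i + 1 + 1) % (m + 2)) := by
        by_cases him : i = m
        · subst him; simp; omega
        · rw [Nat.mod_eq_of_lt (by omega)]; omega
      rw [this]
  let Vf : Fin (m + 2) → Type := fun i => ↥(P' i.val)
  let f : (Σ i, Vf i) → V := fun a => a.2.val
  have hf : Function.Injective f := by
    rintro ⟨i, x, hx⟩ ⟨j, y, hy⟩ hxy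
    simp only [f] at hxy
    subst hxy
    have : i = j := Fin.ext (k5 i i.2 j j.2 x hx hy)
    subst this
    rfl
  let H : Digraph' (Σ i, Vf i) := ⟨fun x y => G.Adj (f x) (f y), fun x => G.irrefl _⟩
  have hr : range f = A ∪ C := by
    ext x
    constructor
    · rintro ⟨⟨⟨_ | i, hi⟩, y, hy⟩, rfl⟩
      · exact Or.inl hy
      · exact Or.inr ((h2 y).2 ⟨i, by omega, hy⟩)
    · rintro (hx | hx)
      · exact ⟨⟨⟨0, by omega⟩, x, hx⟩, rfl⟩
      · obtain ⟨i, hi, hx⟩ := (h2 x).1 hx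
        exact ⟨⟨⟨i + 1, by omega⟩, x, hx⟩, rfl⟩
  rw [← hr]
  refine KT.of_embed f hf (H := H) (fun x y => Iff.rfl) ?_
  refine Buildable.cyclic (n := m + 2) (by omega) Vf (fun i => G.induce (P' i))
    (fun i => ⟨r' i, (k1 i i.2).2⟩) H (fun i => (k1 i i.2).1) ?_
  have hfin : ∀ (i j : Fin (m + 2)), j = i + ⟨1, by omega⟩ ↔ j.val = (i.val + 1) % (m + 2) := by
    intro i j
    rw [Fin.ext_iff, Fin.val_add]
  rintro ⟨i, x, hx⟩ ⟨j, y, hy⟩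
  by_cases hij : i = j
  · subst hij
    constructor
    · intro hadj
      exact Or.inl ⟨i, ⟨x, hx⟩, ⟨y, hy⟩, rfl, rfl, hadj⟩
    · rintro (⟨i', x', y', hx', hy', hadj⟩ | ⟨i', hx', hy'⟩)
      · cases hx'
        obtain ⟨-, h⟩ := Sigma.mk.inj_iff.1 hy'
        rw [heq_eq_eq] at h
        subst h
        exact hadj
      · exfalso
        have e1 : i = i' := congrArg Sigma.fst hx'
        have e2 : i = i' + ⟨1, by omega⟩ := congrArg Sigma.fst hy'
        rw [← e1, hfin] at e2
        by_cases him : i.val = m + 1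
        · rw [him] at e2; simp at e2
        · rw [Nat.mod_eq_of_lt (by omega)] at e2; omega
  · have := k6 i i.2 j j.2 (fun h => hij (Fin.ext h)) x hx y hy
    constructor
    · intro hadj
      obtain ⟨a, b, c⟩ := this.1 hadj
      right
      refine ⟨i, ?_, ?_⟩
      · congr 1; exact Subtype.ext b
      · have hj : j = i + ⟨1, by omega⟩ := (hfin i j).2 a
        apply hf
        change y = r' (i + ⟨1, by omega⟩ : Fin (m + 2)).val
        rw [← hj]; exact c
    · rintro (⟨i', x', y', hx', hy', hadj⟩ | ⟨i', hx', hy'⟩)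
      · exact absurd ((congrArg Sigma.fst hx').trans (congrArg Sigma.fst hy').symm) hij
      · refine this.2 ⟨?_, ?_, ?_⟩
        · have e1 : i = i' := congrArg Sigma.fst hx'
          rw [← hfin, e1]
          exact congrArg Sigma.fst hy'
        · cases hx'; rfl
        · cases hy'; rfl

/-- `S` decomposes as a composition with `c` in the distinguished part. -/
def Comp (G : Digraph' V) (k : ℕ) (S : Set V) (c : V) : Prop :=
  ∃ (A B : Set V) (a : V), S = A ∪ B ∧ Disjoint A B ∧ c ∈ A ∧ a ∈ A ∧ KT G k A ∧ KT G k B ∧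
    (∀ x ∈ A, ∀ y ∈ B, G.Adj x y ∨ G.Adj y x → x = a) ∧
    (∃ b ∈ B, G.Adj a b ∨ G.Adj b a) ∧
    (∀ A' ⊆ A, a ∈ A' → KT G k A' → KT G k (A' ∪ B)) ∧
    (∃ (B1 : Set V) (b1 : V), B1 ⊆ B ∧ KT G k B1 ∧ b1 ∈ B1 ∧
      ∀ x ∈ B1, x ≠ b1 → ∀ y ∈ S, y ∉ B1 → ¬ G.Adj x y ∧ ¬ G.Adj y x)

theorem comp_of_direct {G : Digraph' V} {k : ℕ} {A B : Set V} {a b c : V} (hA : KT G k A)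
    (hB : KT G k B) (hd : Disjoint A B) (ha : a ∈ A) (hb : b ∈ B)
    (h : ∀ x ∈ A, ∀ y ∈ B, (G.Adj x y ↔ x = a ∧ y = b) ∧ ¬ G.Adj y x) (hc : c ∈ A ∪ B) :
    Comp G k (A ∪ B) c := by
  have hab : G.Adj a b := ((h a ha b hb).1).2 ⟨rfl, rfl⟩
  rcases hc with hc | hc
  · refine ⟨A, B, a, rfl, hd, hc, ha, hA, hB, ?_, ⟨b, hb, Or.inl hab⟩, ?_, ⟨B, b, subset_rfl, hB, hb, ?_⟩⟩
    · intro x hx y hy hxy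
      have := h x hx y hy
      tauto
    · intro A' hA' ha' hk
      exact hk.direct hB (hd.mono_left hA') ha' hb (fun x hx y hy => h x (hA' hx) y hy)
    · rintro x hx hxb y (hy | hy) hyB
      · have := h y hy x hx
        tauto
      · exact absurd hy hyB
  · refine ⟨B, A, b, Set.union_comm _ _, hd.symm, hc, hb, hB, hA, ?_, ⟨a, ha, Or.inr hab⟩, ?_,
      ⟨A, a, subset_rfl, hA, ha, ?_⟩⟩
    · intro x hx y hy hxy
      have := h y hy x hx
      tauto
    · intro A' hA' ha' hk
      rw [Set.union_comm]
      exact hA.direct hk (hd.mono_right hA') ha ha' (fun x hx y hy => h x hx y (hA' hy))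
    · rintro x hx hxb y (hy | hy) hyB
      · exact absurd hy hyB
      · have := h x hx y hy
        tauto

theorem comp_of_cyc {G : Digraph' V} {k : ℕ} {A C : Set V} {v p q c : V} (hA : KT G k A)
    (hv : v ∈ A) (hC : Ch G k p q C) (hd : Disjoint A C)
    (h : ∀ x ∈ A, ∀ y ∈ C, (G.Adj x y ↔ x = v ∧ y = p) ∧ (G.Adj y x ↔ y = q ∧ x = v))
    (hc : c ∈ A) : Comp G k (A ∪ C) c := by
  refine ⟨A, C, v, rfl, hd, hc, hv, hA, hC.kt, ?_,
    ⟨p, hC.mem.1, Or.inl ((h v hv p hC.mem.1).1.2 ⟨rfl, rfl⟩)⟩, ?_, ?_⟩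
  · intro x hx y hy hxy
    have := h x hx y hy
    tauto
  · intro A' hA' ha' hk
    exact hk.cyc ha' hC (hd.mono_left hA') (fun x hx y hy => h x (hA' hx) y hy)
  · cases hC with
    | single _ _ hC hp =>
      refine ⟨C, p, subset_rfl, hC, hp, ?_⟩
      rintro x hx hxb y (hy | hy) hyB
      · have := h y hy x hx
        tauto
      · exact absurd hy hyB
    | cons A1 C1 _ p' _ hA1 hp hC1 hd1 har =>
      refine ⟨A1, p, Set.subset_union_left, hA1, hp, ?_⟩
      rintro x hx hxb y (hy | hy | hy) hyB
      · have h1 := h y hy x (Or.inl hx)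
        have h2 : x ≠ q := fun e => Set.disjoint_left.1 hd1 hx (e ▸ hC1.mem.2)
        tauto
      · exact absurd hy hyB
      · have := har x hx y hy
        tauto

theorem comp_of_family {G : Digraph' V} {k n : ℕ} (hn : 2 ≤ n) (P : ℕ → Set V) (r : ℕ → V)
    (h1 : ∀ i < n, KT G k (P i) ∧ r i ∈ P i)
    (h5 : ∀ i < n, ∀ j < n, ∀ x, x ∈ P i → x ∈ P j → i = j)
    (h6 : ∀ i < n, ∀ j < n, i ≠ j → ∀ x ∈ P i, ∀ y ∈ P j,
        (G.Adj x y ↔ j = (i + 1) % n ∧ x = r i ∧ y = r j)) {c : V} (hc : c ∈ P 0) :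
    Comp G k {x | ∃ i < n, x ∈ P i} c := by
  have key : ∀ d t, t + d + 1 = n → 1 ≤ t → Ch G k (r t) (r (n - 1)) {x | ∃ i, t ≤ i ∧ i < n ∧ x ∈ P i} := by
    intro d
    induction d with
    | zero =>
      intro t ht h1t
      have e : t = n - 1 := by omega
      have : {x | ∃ i, t ≤ i ∧ i < n ∧ x ∈ P i} = P t := by
        ext x
        constructor
        · rintro ⟨i, hi, hin, hx⟩
          have : i = t := by omega
          exact this ▸ hx
        · intro hx; exact ⟨t, le_rfl, by omega, hx⟩
      rw [this, ← e]
      exact Ch.single _ _ (h1 t (by omega)).1 (h1 t (by omega)).2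
    | succ d ih =>
      intro t ht h1t
      have : {x | ∃ i, t ≤ i ∧ i < n ∧ x ∈ P i} = P t ∪ {x | ∃ i, t + 1 ≤ i ∧ i < n ∧ x ∈ P i} := by
        ext x
        constructor
        · rintro ⟨i, hi, hin, hx⟩
          by_cases hit : i = t
          · left; exact hit ▸ hx
          · right; exact ⟨i, by omega, hin, hx⟩
        · rintro (hx | ⟨i, hi, hin, hx⟩)
          · exact ⟨t, le_rfl, by omega, hx⟩
          · exact ⟨i, by omega, hin, hx⟩
      rw [this]
      refine Ch.cons _ _ _ (r (t + 1)) _ (h1 t (by omega)).1 (h1 t (by omega)).2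
        (ih (t + 1) (by omega) (by omega)) ?_ ?_
      · rw [Set.disjoint_left]
        rintro x hx ⟨i, hi, hin, hx'⟩
        have := h5 t (by omega) i hin x hx hx'
        omega
      · rintro x hx y ⟨i, hi, hin, hy⟩
        constructor
        · rw [h6 t (by omega) i hin (by omega) x hx y hy, Nat.mod_eq_of_lt (by omega)]
          constructor
          · rintro ⟨rfl, h, h'⟩; exact ⟨h, h'⟩
          · rintro ⟨h, h'⟩
            have : i = t + 1 := h5 i hin (t + 1) (by omega) y hy (h' ▸ (h1 (t + 1) (by omega)).2)
            subst this
            exact ⟨rfl, h, h'⟩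
        · rw [h6 i hin t (by omega) (by omega) y hy x hx]
          rintro ⟨h, -⟩
          by_cases hin' : i + 1 = n
          · rw [hin', Nat.mod_self] at h; omega
          · rw [Nat.mod_eq_of_lt (by omega)] at h; omega
  have hC := key (n - 2) 1 (by omega) le_rfl
  have e : {x | ∃ i < n, x ∈ P i} = P 0 ∪ {x | ∃ i, 1 ≤ i ∧ i < n ∧ x ∈ P i} := by
    ext x
    constructor
    · rintro ⟨i, hin, hx⟩
      by_cases hit : i = 0
      · left; exact hit ▸ hx
      · right; exact ⟨i, by omega, hin, hx⟩
    · rintro (hx | ⟨i, hi, hin, hx⟩)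
      · exact ⟨0, by omega, hx⟩
      · exact ⟨i, by omega, hx⟩
  rw [e]
  refine comp_of_cyc (h1 0 (by omega)).1 (h1 0 (by omega)).2 hC ?_ ?_ hc
  · rw [Set.disjoint_left]
    rintro x hx ⟨i, hi, hin, hx'⟩
    have := h5 0 (by omega) i hin x hx hx'
    omega
  · rintro x hx y ⟨i, hi, hin, hy⟩
    constructor
    · rw [h6 0 (by omega) i hin (by omega) x hx y hy, Nat.mod_eq_of_lt (by omega)]
      constructor
      · rintro ⟨rfl, h, h'⟩; exact ⟨h, h'⟩
      · rintro ⟨h, h'⟩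
        have : i = 1 := h5 i hin 1 (by omega) y hy (h' ▸ (h1 1 (by omega)).2)
        subst this
        exact ⟨rfl, h, h'⟩
    · rw [h6 i hin 0 (by omega) (by omega) y hy x hx]
      constructor
      · rintro ⟨h, h', h''⟩
        by_cases hin' : i + 1 = n
        · have : i = n - 1 := by omega
          subst this
          exact ⟨h', h''⟩
        · rw [Nat.mod_eq_of_lt (by omega)] at h; omega
      · rintro ⟨h', h''⟩
        have : i = n - 1 := h5 i hin (n - 1) (by omega) y hy (h' ▸ (h1 (n - 1) (by omega)).2)
        subst this
        refine ⟨?_, h', h''⟩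
        rw [Nat.sub_add_cancel (by omega), Nat.mod_self]

theorem comp_of_family' {G : Digraph' V} {k n : ℕ} (hn : 2 ≤ n) (P : ℕ → Set V) (r : ℕ → V)
    (h1 : ∀ i < n, KT G k (P i) ∧ r i ∈ P i)
    (h5 : ∀ i < n, ∀ j < n, ∀ x, x ∈ P i → x ∈ P j → i = j)
    (h6 : ∀ i < n, ∀ j < n, i ≠ j → ∀ x ∈ P i, ∀ y ∈ P j,
        (G.Adj x y ↔ j = (i + 1) % n ∧ x = r i ∧ y = r j)) {c : V} {i₀ : ℕ} (hi₀ : i₀ < n)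
    (hc : c ∈ P i₀) :
    Comp G k {x | ∃ i < n, x ∈ P i} c := by
  have hlt : ∀ j, (i₀ + j) % n < n := fun j => Nat.mod_lt _ (by omega)
  have hinj : ∀ i < n, ∀ j < n, (i₀ + i) % n = (i₀ + j) % n → i = j := by
    intro i hi j hj h
    have : i ≡ j [MOD n] := Nat.ModEq.add_left_cancel' i₀ h
    exact Nat.ModEq.eq_of_lt_of_lt this hi hj
  have := comp_of_family (G := G) (k := k) hn (fun j => P ((i₀ + j) % n)) (fun j => r ((i₀ + j) % n))
    (fun i hi => h1 _ (hlt i))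
    (fun i hi j hj x hx hy => hinj i hi j hj (h5 _ (hlt i) _ (hlt j) x hx hy))
    (by
      intro i hi j hj hij x hx y hy
      rw [h6 _ (hlt i) _ (hlt j) (fun h => hij (hinj i hi j hj h)) x hx y hy]
      have : (i₀ + j) % n = ((i₀ + i) % n + 1) % n ↔ j = (i + 1) % n := by
        rw [Nat.mod_add_mod, Nat.add_assoc]
        constructor
        · intro h
          have h' : j ≡ i + 1 [MOD n] := Nat.ModEq.add_left_cancel' i₀ h
          rw [← Nat.mod_eq_of_lt hj]; exact h'
        · intro h
          rw [h, Nat.add_mod_mod]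
      rw [this]) (c := c) (by simpa [Nat.mod_eq_of_lt hi₀] using hc)
  convert this using 1
  ext x
  constructor
  · rintro ⟨i, hi, hx⟩
    refine ⟨(i + (n - i₀)) % n, Nat.mod_lt _ (by omega), ?_⟩
    have : (i₀ + (i + (n - i₀)) % n) % n = i := by
      rw [Nat.add_mod_mod, show i₀ + (i + (n - i₀)) = i + n by omega, Nat.add_mod_right,
        Nat.mod_eq_of_lt hi]
    simp only [this]; exact hx
  · rintro ⟨i, hi, hx⟩
    exact ⟨_, hlt i, hx⟩

theorem exc_iso {V W : Type} {k : ℕ} {G : Digraph' V} {H : Digraph' W} (e : W ≃ V)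
    (hadj : ∀ x y, H.Adj x y ↔ G.Adj (e x) (e y)) (h : H.IsException k) : G.IsException k := by
  have hadj' : ∀ x y, G.Adj x y ↔ H.Adj (e.symm x) (e.symm y) := by
    intro x y; rw [hadj]; simp
  rcases h with ⟨hk, n, hn, f, hf⟩ | ⟨hk, n, hn, ho, f, hf⟩ | ⟨hk, hs, hcard⟩
  · exact Or.inl ⟨hk, n, hn, e.symm.trans f, fun x y => by rw [hadj', hf]; rfl⟩
  · exact Or.inr (Or.inl ⟨hk, n, hn, ho, e.symm.trans f, fun x y => by rw [hadj', hf]; rfl⟩)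
  · refine Or.inr (Or.inr ⟨hk, fun x y => by rw [hadj', hs]; simp, ?_⟩)
    rw [← hcard, Nat.card_congr e]

theorem inv_aux {W : Type} {k : ℕ} {H : Digraph' W} (h : Buildable k H) :
    ∀ {V : Type} (G : Digraph' V) (f : W → V) (_ : Function.Injective f)
      (_ : ∀ x y, H.Adj x y ↔ G.Adj (f x) (f y)) (c : V) (_ : c ∈ range f),
      (G.induce (range f)).IsException (k - 1) ∨ Comp G k (range f) c := by
  induction h with
  | base H hH =>
    intro V G f hf hadj c hc
    left
    exact exc_iso (Equiv.ofInjective f hf) (fun x y => hadj x y) hH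
  | @direct V₁ V₂ G₁ G₂ v₁ v₂ d H h1 h2 hH ih1 ih2 =>
    intro V G f hf hadj c hc
    right
    have e : range f = range (f ∘ Sum.inl) ∪ range (f ∘ Sum.inr) := by
      ext x; simp [Sum.exists]
    have hA : KT G k (range (f ∘ Sum.inl)) := KT.of_embed (H := G₁) _ (hf.comp Sum.inl_injective)
      (fun x y => by
        simp only [Function.comp]
        rw [← hadj, hH]; simp) h1
    have hB : KT G k (range (f ∘ Sum.inr)) := KT.of_embed (H := G₂) _ (hf.comp Sum.inr_injective)
      (fun x y => by
        simp only [Function.comp]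
        rw [← hadj, hH]; simp) h2
    have hd : Disjoint (range (f ∘ Sum.inl)) (range (f ∘ Sum.inr)) := by
      rw [Set.disjoint_left]
      rintro _ ⟨x, rfl⟩ ⟨y, hy⟩
      have := hf hy
      simp at this
    rw [e] at hc ⊢
    cases d with
    | true =>
      refine comp_of_direct (a := f (Sum.inl v₁)) (b := f (Sum.inr v₂)) hA hB hd ⟨_, rfl⟩ ⟨_, rfl⟩ ?_ hc
      rintro _ ⟨x, rfl⟩ _ ⟨y, rfl⟩
      simp only [Function.comp]
      rw [← hadj, ← hadj, hH, hH]
      simp [hf.eq_iff]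
    | false =>
      rw [Set.union_comm] at hc ⊢
      refine comp_of_direct (b := f (Sum.inl v₁)) (a := f (Sum.inr v₂)) hB hA hd.symm ⟨_, rfl⟩ ⟨_, rfl⟩ ?_ hc
      rintro _ ⟨x, rfl⟩ _ ⟨y, rfl⟩
      simp only [Function.comp]
      rw [← hadj, ← hadj, hH, hH]
      simp [hf.eq_iff]
  | @cyclic n hn Vf Gf vf H hb hH ih =>
    intro V G f hf hadj c hc
    right
    let P : ℕ → Set V := fun i => {x | ∃ (hi : i < n) (y : Vf ⟨i, hi⟩), x = f ⟨⟨i, hi⟩, y⟩}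
    have : Nonempty V := ⟨c⟩
    let r : ℕ → V := fun i => if hi : i < n then f ⟨⟨i, hi⟩, vf ⟨i, hi⟩⟩ else c
    have e : range f = {x | ∃ i < n, x ∈ P i} := by
      ext x
      constructor
      · rintro ⟨⟨i, y⟩, rfl⟩
        exact ⟨i.1, i.2, i.2, y, rfl⟩
      · rintro ⟨i, hi, hi', y, rfl⟩
        exact ⟨_, rfl⟩
    have hfin : ∀ (i j : Fin n), j = i + ⟨1, by omega⟩ ↔ j.val = (i.val + 1) % n := by
      intro i j
      rw [Fin.ext_iff, Fin.val_add]
    have hne : ∀ i : Fin n, i ≠ i + ⟨1, by omega⟩ := by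
      intro i hi
      rw [hfin] at hi
      by_cases him : i.val + 1 = n
      · rw [him, Nat.mod_self] at hi; omega
      · rw [Nat.mod_eq_of_lt (by omega)] at hi; omega
    have hin : ∀ (i : Fin n) (x y : Vf i), H.Adj ⟨i, x⟩ ⟨i, y⟩ ↔ (Gf i).Adj x y := by
      intro i x y
      rw [hH]
      constructor
      · rintro (⟨i', x', y', hx', hy', hadj⟩ | ⟨i', hx', hy'⟩)
        · cases hx'
          obtain ⟨-, h⟩ := Sigma.mk.inj_iff.1 hy'
          rw [heq_eq_eq] at h
          subst h
          exact hadj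
        · exfalso
          have e1 : i = i' := congrArg Sigma.fst hx'
          have e2 : i = i' + ⟨1, by omega⟩ := congrArg Sigma.fst hy'
          exact hne i' (e1.symm.trans e2)
      · intro h
        exact Or.inl ⟨i, x, y, rfl, rfl, h⟩
    have h1 : ∀ i < n, KT G k (P i) ∧ r i ∈ P i := by
      intro i hi
      constructor
      · have : P i = range (fun y : Vf ⟨i, hi⟩ => f ⟨⟨i, hi⟩, y⟩) := by
          ext x
          constructor
          · rintro ⟨hi', y, rfl⟩; exact ⟨y, rfl⟩
          · rintro ⟨y, rfl⟩; exact ⟨hi, y, rfl⟩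
        rw [this]
        refine KT.of_embed (H := Gf ⟨i, hi⟩) _ ?_ ?_ (hb _)
        · intro x y hxy
          have := hf hxy
          simpa using this
        · intro x y
          rw [← hadj, hin]
      · simp only [r, hi, dif_pos]
        exact ⟨hi, _, rfl⟩
    have h5 : ∀ i < n, ∀ j < n, ∀ x, x ∈ P i → x ∈ P j → i = j := by
      rintro i hi j hj x ⟨_, y, hy⟩ ⟨_, z, hz⟩
      have := hf (hy.symm.trans hz)
      have := congrArg Sigma.fst this
      simpa using this
    obtain ⟨i₀, hi₀, hc⟩ : c ∈ {x | ∃ i < n, x ∈ P i} := e ▸ hc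
    rw [e]
    refine comp_of_family' hn P r h1 h5 ?_ hi₀ hc
    rintro i hi j hj hij _ ⟨_, x, rfl⟩ _ ⟨_, y, rfl⟩
    rw [← hadj, hH]
    simp only [r, hi, hj, dif_pos, hf.eq_iff]
    rw [← hfin ⟨i, hi⟩ ⟨j, hj⟩]
    constructor
    · rintro (⟨i', x', y', hx', hy', hadj⟩ | ⟨i', hx', hy'⟩)
      · have e1 : (⟨i, hi⟩ : Fin n) = i' := congrArg Sigma.fst hx'
        have e2 : (⟨j, hj⟩ : Fin n) = i' := congrArg Sigma.fst hy'
        exact absurd (Fin.ext_iff.1 (e1.trans e2.symm)) hij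
      · have e1 : (⟨i, hi⟩ : Fin n) = i' := congrArg Sigma.fst hx'
        have e2 : (⟨j, hj⟩ : Fin n) = i' + ⟨1, by omega⟩ := congrArg Sigma.fst hy'
        refine ⟨e1 ▸ e2, ?_, ?_⟩
        · rw [hx', e1]
        · rw [hy', e2]
    · rintro ⟨e1, hx, hy⟩
      right
      refine ⟨⟨i, hi⟩, hx, ?_⟩
      rw [hy, e1]
  | iso e H H' hHH' hb ih =>
    intro V G f hf hadj c hc
    have hr : range (f ∘ e) = range f := e.surjective.range_comp f
    have := ih G (f ∘ e) (hf.comp e.injective) (fun x y => by rw [hHH', hadj]; rfl) c (hr ▸ hc)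
    rwa [hr] at this

theorem KT.inv {G : Digraph' V} {k : ℕ} {S : Set V} (h : KT G k S) {c : V} (hc : c ∈ S) :
    (G.induce S).IsException (k - 1) ∨ Comp G k S c := by
  have hr : range (Subtype.val : S → V) = S := Subtype.range_coe
  have := inv_aux h G (Subtype.val : S → V) Subtype.val_injective (fun x y => Iff.rfl) c (by simpa using hc)
  rwa [hr] at this

/-- out-degree inside `S` -/
noncomputable def od (G : Digraph' V) (S : Set V) (x : V) : ℕ := {y | y ∈ S ∧ G.Adj x y}.ncard
/-- in-degree inside `S` -/
noncomputable def ind (G : Digraph' V) (S : Set V) (x : V) : ℕ := {y | y ∈ S ∧ G.Adj y x}.ncard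

/-- connectivity of the induced digraph -/
def Conn (G : Digraph' V) (S : Set V) : Prop :=
  ∀ X ⊆ S, X.Nonempty → (∀ x ∈ X, ∀ y ∈ S, G.Adj x y ∨ G.Adj y x → y ∈ X) → S ⊆ X

theorem exc_cases {G : Digraph' V} {k : ℕ} (hk : 2 ≤ k) {S : Set V}
    (h : (G.induce S).IsException (k - 1)) :
    (k = 2 ∧ ∃ (n : ℕ) (g : ZMod n → V), 2 ≤ n ∧ Function.Injective g ∧ range g = S ∧
      ∀ i j, G.Adj (g i) (g j) ↔ j = i + 1) ∨
    (k = 3 ∧ ∃ (n : ℕ) (g : ZMod n → V), 3 ≤ n ∧ Function.Injective g ∧ range g = S ∧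
      ∀ i j, G.Adj (g i) (g j) ↔ j = i + 1 ∨ i = j + 1) ∨
    (4 ≤ k ∧ (∀ x ∈ S, ∀ y ∈ S, (G.Adj x y ↔ x ≠ y)) ∧ S.ncard = k) := by
  rcases h with ⟨hk, n, hn, f, hf⟩ | ⟨hk, n, hn, ho, f, hf⟩ | ⟨hk, hs, hcard⟩
  · refine Or.inl ⟨by omega, n, fun i => (f.symm i).val, hn,
      Subtype.val_injective.comp f.symm.injective, ?_, ?_⟩
    · ext x
      constructor
      · rintro ⟨i, rfl⟩; exact (f.symm i).2
      · intro hx; exact ⟨f ⟨x, hx⟩, by simp⟩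
    · intro i j
      have := hf (f.symm i) (f.symm j)
      simpa [Digraph'.induce] using this
  · refine Or.inr (Or.inl ⟨by omega, n, fun i => (f.symm i).val, hn,
      Subtype.val_injective.comp f.symm.injective, ?_, ?_⟩)
    · ext x
      constructor
      · rintro ⟨i, rfl⟩; exact (f.symm i).2
      · intro hx; exact ⟨f ⟨x, hx⟩, by simp⟩
    · intro i j
      have := hf (f.symm i) (f.symm j)
      simpa [Digraph'.induce] using this
  · refine Or.inr (Or.inr ⟨by omega, ?_, ?_⟩)
    · intro x hx y hy
      have := hs ⟨x, hx⟩ ⟨y, hy⟩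
      simpa [Digraph'.induce] using this
    · have h : S.ncard = k - 1 + 1 := hcard
      omega

theorem exc_deg [Finite V] {G : Digraph' V} {k : ℕ} (hk : 2 ≤ k) {S : Set V}
    (h : (G.induce S).IsException (k - 1)) {x : V} (hx : x ∈ S) :
    od G S x = k - 1 ∧ ind G S x = k - 1 := by
  rcases exc_cases hk h with ⟨rfl, n, g, hn, hg, rfl, hadj⟩ | ⟨rfl, n, g, hn, hg, rfl, hadj⟩ | ⟨hk4, hadj, hcard⟩
  · obtain ⟨i, rfl⟩ := hx
    have e1 : {y | y ∈ range g ∧ G.Adj (g i) y} = {g (i + 1)} := by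
      ext y
      simp only [mem_ofPred_eq, mem_singleton_iff]
      constructor
      · rintro ⟨⟨j, rfl⟩, h⟩; rw [(hadj i j).1 h]
      · rintro rfl; exact ⟨⟨_, rfl⟩, (hadj _ _).2 rfl⟩
    have e2 : {y | y ∈ range g ∧ G.Adj y (g i)} = {g (i - 1)} := by
      ext y
      simp only [mem_ofPred_eq, mem_singleton_iff]
      constructor
      · rintro ⟨⟨j, rfl⟩, h⟩; rw [(hadj j i).1 h]; simp
      · rintro rfl; exact ⟨⟨_, rfl⟩, (hadj _ _).2 (by simp)⟩
    rw [od, ind, e1, e2]; simp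
  · obtain ⟨i, rfl⟩ := hx
    have e1 : {y | y ∈ range g ∧ G.Adj (g i) y} = {g (i + 1), g (i - 1)} := by
      ext y
      simp only [mem_ofPred_eq, mem_singleton_iff, mem_insert_iff]
      constructor
      · rintro ⟨⟨j, rfl⟩, h⟩
        rcases (hadj i j).1 h with h | h
        · left; rw [h]
        · right; rw [h]; simp
      · rintro (rfl | rfl)
        · exact ⟨⟨_, rfl⟩, (hadj _ _).2 (Or.inl rfl)⟩
        · exact ⟨⟨_, rfl⟩, (hadj _ _).2 (Or.inr (by simp))⟩
    have e2 : {y | y ∈ range g ∧ G.Adj y (g i)} = {g (i + 1), g (i - 1)} := by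
      rw [← e1]
      ext y
      simp only [mem_ofPred_eq]
      refine and_congr_right ?_
      rintro ⟨j, rfl⟩
      rw [hadj, hadj, or_comm]
    have hne : g (i + 1) ≠ g (i - 1) := by
      intro h
      have h2 : i + 1 = i - 1 := hg h
      have h3 : ((2 : ℕ) : ZMod n) = 0 := by
        have h4 : i + 1 - (i - 1) = 0 := sub_eq_zero.2 h2
        push_cast
        linear_combination h4
      rw [ZMod.natCast_eq_zero_iff] at h3
      have := Nat.le_of_dvd (by omega) h3
      omega
    rw [od, ind, e1, e2]; simp [Set.ncard_pair hne]
  · have e1 : {y | y ∈ S ∧ G.Adj x y} = S \ {x} := by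
      ext y
      simp only [mem_ofPred_eq, mem_sdiff, mem_singleton_iff]
      refine and_congr_right fun hy => ?_
      rw [hadj x hx y hy, ne_comm]
    have e2 : {y | y ∈ S ∧ G.Adj y x} = S \ {x} := by
      ext y
      simp only [mem_ofPred_eq, mem_sdiff, mem_singleton_iff]
      refine and_congr_right fun hy => ?_
      rw [hadj y hy x hx]
    simp only [od, ind, e1, e2]
    rw [Set.ncard_sdiff_singleton_of_mem hx, hcard]
    exact ⟨rfl, rfl⟩

theorem conn_path {G : Digraph' V} (s : ℕ → V) (a b : ℕ)
    (h : ∀ t, a ≤ t → t < b → G.Adj (s t) (s (t + 1))) : Conn G (s '' Icc a b) := by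
  rintro X hX ⟨x, hx⟩ hcl
  have step : ∀ t, a ≤ t → t < b → (s t ∈ X ↔ s (t + 1) ∈ X) := by
    intro t hat htb
    constructor
    · intro hs
      exact hcl _ hs _ ⟨t + 1, ⟨by omega, by omega⟩, rfl⟩ (Or.inl (h t hat htb))
    · intro hs
      exact hcl _ hs _ ⟨t, ⟨by omega, by omega⟩, rfl⟩ (Or.inr (h t hat htb))
  have all : ∀ d, a + d ≤ b → (s (a + d) ∈ X ↔ s a ∈ X) := by
    intro d
    induction d with
    | zero => intro _; rfl
    | succ d ih =>
      intro hd
      rw [← ih (by omega), step (a + d) (by omega) (by omega)]; rfl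
  obtain ⟨t, ht, rfl⟩ := hX hx
  rintro _ ⟨t', ht', rfl⟩
  simp only [mem_Icc] at ht ht'
  have h1 := all (t - a) (by omega)
  have h2 := all (t' - a) (by omega)
  rw [show a + (t - a) = t by omega] at h1
  rw [show a + (t' - a) = t' by omega] at h2
  exact h2.2 (h1.1 hx)

theorem cycle_conn {G : Digraph' V} {n : ℕ} (hn : 2 ≤ n) {g : ZMod n → V}
    (hadj : ∀ i, G.Adj (g i) (g (i + 1))) (hg : Function.Injective g) (i : ZMod n) :
    Conn G (range g) ∧ Conn G (range g \ {g i}) := by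
  have : NeZero n := ⟨by omega⟩
  have hs : ∀ t : ℕ, G.Adj (g (i + t)) (g (i + (t + 1 : ℕ))) := by
    intro t
    have := hadj (i + t)
    push_cast
    rwa [← add_assoc]
  have hrep : ∀ j : ZMod n, j = i + ((j - i).val : ℕ) := by
    intro j; simp
  constructor
  · have := conn_path (G := G) (fun t : ℕ => g (i + t)) 0 (n - 1) (fun t _ _ => hs t)
    convert this using 1
    ext y
    constructor
    · rintro ⟨j, rfl⟩
      have := ZMod.val_lt (j - i)
      exact ⟨(j - i).val, ⟨by omega, by omega⟩, by simp⟩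
    · rintro ⟨t, -, rfl⟩; exact ⟨_, rfl⟩
  · have := conn_path (G := G) (fun t : ℕ => g (i + t)) 1 (n - 1) (fun t _ _ => hs t)
    convert this using 1
    ext y
    constructor
    · rintro ⟨⟨j, rfl⟩, hne⟩
      have h1 := ZMod.val_lt (j - i)
      have h2 : (j - i).val ≠ 0 := by
        rw [Ne, ZMod.val_eq_zero, sub_eq_zero]
        rintro rfl; exact hne rfl
      exact ⟨(j - i).val, ⟨by omega, by omega⟩, by simp⟩
    · rintro ⟨t, ht, rfl⟩
      refine ⟨⟨_, rfl⟩, ?_⟩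
      intro h
      have h1 : i + (t : ZMod n) = i := hg h
      have h2 : (t : ZMod n) = 0 := by simpa using h1
      rw [ZMod.natCast_eq_zero_iff] at h2
      simp only [mem_Icc] at ht
      have := Nat.le_of_dvd (by omega) h2
      omega

theorem exc_conn {G : Digraph' V} {k : ℕ} (hk : 2 ≤ k) {S : Set V}
    (h : (G.induce S).IsException (k - 1)) {x : V} (hx : x ∈ S) :
    Conn G S ∧ Conn G (S \ {x}) := by
  rcases exc_cases hk h with ⟨rfl, n, g, hn, hg, rfl, hadj⟩ | ⟨rfl, n, g, hn, hg, rfl, hadj⟩ | ⟨hk4, hadj, hcard⟩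
  · obtain ⟨i, rfl⟩ := hx
    exact cycle_conn hn (fun i => (hadj _ _).2 rfl) hg i
  · obtain ⟨i, rfl⟩ := hx
    exact cycle_conn (by omega) (fun i => (hadj _ _).2 (Or.inl rfl)) hg i
  · have : ∀ S' ⊆ S, Conn G S' := by
      rintro S' hS' X hX ⟨z, hz⟩ hcl y hy
      by_cases hzy : z = y
      · exact hzy ▸ hz
      · exact hcl z hz y hy (Or.inl ((hadj z (hS' (hX hz)) y (hS' hy)).2 hzy))
    exact ⟨this S subset_rfl, this _ sdiff_subset⟩

theorem exc_parity {G : Digraph' V} {S : Set V} (f : V → ZMod 2)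
    (hf : ∀ x ∈ S, ∀ y ∈ S, G.Adj x y → f y = f x + 1)
    (h : (G.induce S).IsException (2 - 1)) : (S.ncard : ZMod 2) = 0 := by
  rcases exc_cases le_rfl h with ⟨-, n, g, hn, hg, rfl, hadj⟩ | ⟨h, -⟩ | ⟨h, -⟩
  · have : NeZero n := ⟨by omega⟩
    have h1 : ∑ i : ZMod n, f (g (i + 1)) = ∑ i : ZMod n, f (g i) :=
      Equiv.sum_comp (Equiv.addRight (1 : ZMod n)) (fun i => f (g i))
    have h2 : ∀ i : ZMod n, f (g (i + 1)) = f (g i) + 1 := fun i =>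
      hf _ ⟨_, rfl⟩ _ ⟨_, rfl⟩ ((hadj _ _).2 rfl)
    simp only [h2, Finset.sum_add_distrib] at h1
    have h3 : (range g).ncard = n := by
      rw [← Set.image_univ, Set.ncard_image_of_injective _ hg, Set.ncard_univ, Nat.card_zmod]
    rw [h3]
    simpa using h1
  · omega
  · omega

theorem od_mono [Finite V] {G : Digraph' V} {S T : Set V} (h : S ⊆ T) (x : V) :
    od G S x ≤ od G T x :=
  ncard_le_ncard (fun _ hy => ⟨h hy.1, hy.2⟩) (toFinite _)

theorem ind_mono [Finite V] {G : Digraph' V} {S T : Set V} (h : S ⊆ T) (x : V) :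
    ind G S x ≤ ind G T x :=
  ncard_le_ncard (fun _ hy => ⟨h hy.1, hy.2⟩) (toFinite _)

theorem od_lt [Finite V] {G : Digraph' V} {S T : Set V} (h : S ⊆ T) {x y : V}
    (hy : y ∈ T) (hyS : y ∉ S) (ha : G.Adj x y) : od G S x + 1 ≤ od G T x :=
  ncard_lt_ncard ⟨fun _ hy => ⟨h hy.1, hy.2⟩, fun hs => hyS (hs (show y ∈ {y | y ∈ T ∧ G.Adj x y} from ⟨hy, ha⟩)).1⟩
    (toFinite _)

theorem ind_lt [Finite V] {G : Digraph' V} {S T : Set V} (h : S ⊆ T) {x y : V}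
    (hy : y ∈ T) (hyS : y ∉ S) (ha : G.Adj y x) : ind G S x + 1 ≤ ind G T x :=
  ncard_lt_ncard ⟨fun _ hy => ⟨h hy.1, hy.2⟩, fun hs => hyS (hs (show y ∈ {y | y ∈ T ∧ G.Adj y x} from ⟨hy, ha⟩)).1⟩
    (toFinite _)

theorem od_pos [Finite V] {G : Digraph' V} {S : Set V} {x : V} (h : 1 ≤ od G S x) :
    ∃ y ∈ S, G.Adj x y := by
  have : {y | y ∈ S ∧ G.Adj x y}.Nonempty := by
    rw [← ncard_pos (toFinite _)]; exact h
  obtain ⟨y, hy⟩ := this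
  exact ⟨y, hy.1, hy.2⟩

theorem ind_pos [Finite V] {G : Digraph' V} {S : Set V} {x : V} (h : 1 ≤ ind G S x) :
    ∃ y ∈ S, G.Adj y x := by
  have : {y | y ∈ S ∧ G.Adj y x}.Nonempty := by
    rw [← ncard_pos (toFinite _)]; exact h
  obtain ⟨y, hy⟩ := this
  exact ⟨y, hy.1, hy.2⟩

theorem lt_left [Finite V] {A B : Set V} {b : V} (hd : Disjoint A B) (hb : b ∈ B) :
    A.ncard < (A ∪ B).ncard :=
  ncard_lt_ncard ⟨subset_union_left, fun h => disjoint_left.1 hd (h (Or.inr hb)) hb⟩ (toFinite _)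

theorem lt_right [Finite V] {A B : Set V} {a : V} (hd : Disjoint A B) (ha : a ∈ A) :
    B.ncard < (A ∪ B).ncard :=
  ncard_lt_ncard ⟨subset_union_right, fun h => disjoint_left.1 hd ha (h (Or.inl ha))⟩ (toFinite _)

theorem KT.deg [Finite V] {G : Digraph' V} {k : ℕ} (hk : 2 ≤ k) {S : Set V} (h : KT G k S) {x : V}
    (hx : x ∈ S) : k - 1 ≤ od G S x ∧ k - 1 ≤ ind G S x := by
  induction hn : S.ncard using Nat.strong_induction_on generalizing S with
  | _ n ih =>
    subst hn
    rcases h.inv hx with he | ⟨A, B, a, rfl, hd, hcA, ha, hA, hB, h1, ⟨b, hb, hab⟩, h2, h3⟩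
    · have := exc_deg hk he hx; omega
    · have := ih _ (lt_left hd hb) hA hcA rfl
      exact ⟨this.1.trans (od_mono subset_union_left _), this.2.trans (ind_mono subset_union_left _)⟩

theorem KT.conn [Finite V] {G : Digraph' V} {k : ℕ} (hk : 2 ≤ k) {S : Set V} (h : KT G k S) :
    Conn G S := by
  induction hn : S.ncard using Nat.strong_induction_on generalizing S with
  | _ n ih =>
    subst hn
    intro X hX hXn hcl
    obtain ⟨c, hc⟩ := hXn
    rcases h.inv (hX hc) with he | ⟨A, B, a, rfl, hd, hcA, ha, hA, hB, h1, ⟨b, hb, hab⟩, h2, h3⟩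
    · exact (exc_conn hk he (hX hc)).1 X hX ⟨c, hc⟩ hcl
    · have hAX : A ⊆ X := by
        have := ih _ (lt_left hd hb) hA rfl (X ∩ A) inter_subset_right ⟨c, hc, hcA⟩
          (fun x hx y hy hxy => ⟨hcl x hx.1 y (Or.inl hy) hxy, hy⟩)
        exact this.trans inter_subset_left
      have hbX : b ∈ X := hcl a (hAX ha) b (Or.inr hb) hab
      have hBX : B ⊆ X := by
        have := ih _ (lt_right hd ha) hB rfl (X ∩ B) inter_subset_right ⟨b, hbX, hb⟩
          (fun x hx y hy hxy => ⟨hcl x hx.1 y (Or.inr hy) hxy, hy⟩)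
        exact this.trans inter_subset_left
      exact union_subset hAX hBX

/-- a connected set inside a separated union lies in one side -/
theorem Conn.side {G : Digraph' V} {B M W : Set V} (hB : Conn G B) (hsub : B ⊆ M ∪ W)
    (hMW : ∀ x ∈ M, ∀ y ∈ W, ¬ G.Adj x y ∧ ¬ G.Adj y x) : B ⊆ M ∨ B ⊆ W := by
  by_cases hne : (B ∩ M).Nonempty
  · left
    have := hB (B ∩ M) inter_subset_left hne (by
      intro x hx y hy hxy
      rcases hsub hy with hyM | hyW
      · exact ⟨hy, hyM⟩
      · have := hMW x hx.2 y hyW; tauto)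
    exact this.trans inter_subset_right
  · right
    intro x hx
    rcases hsub hx with hyM | hyW
    · exact absurd ⟨x, hx, hyM⟩ hne
    · exact hyW

theorem cut_aux [Finite V] {G : Digraph' V} {k : ℕ} {A B M W : Set V} {v a : V}
    (hd : Disjoint A B) (hvA : v ∈ A) (ha : a ∈ A)
    (h1 : ∀ x ∈ A, ∀ y ∈ B, G.Adj x y ∨ G.Adj y x → x = a)
    (hab : ∃ b ∈ B, G.Adj a b ∨ G.Adj b a)
    (h2 : ∀ A' ⊆ A, a ∈ A' → KT G k A' → KT G k (A' ∪ B))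
    (hS : (A ∪ B) \ {v} = M ∪ W) (hdMW : Disjoint M W)
    (hMW : ∀ x ∈ M, ∀ y ∈ W, ¬ G.Adj x y ∧ ¬ G.Adj y x) (hBM : B ⊆ M)
    (ih : ∀ M' W' : Set V, A \ {v} = M' ∪ W' → Disjoint M' W' →
      (∀ x ∈ M', ∀ y ∈ W', ¬ G.Adj x y ∧ ¬ G.Adj y x) → KT G k (insert v M') ∨ KT G k (insert v W')) :
    KT G k (insert v M) ∨ KT G k (insert v W) := by
  obtain ⟨b, hb, hab⟩ := hab
  have hmem : ∀ x, ((x ∈ A ∨ x ∈ B) ∧ x ≠ v) ↔ (x ∈ M ∨ x ∈ W) := fun x => by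
    have := Set.ext_iff.1 hS x
    simpa using this
  have hWA : W ⊆ A := by
    intro x hx
    rcases ((hmem x).2 (Or.inr hx)).1 with h | h
    · exact h
    · exact absurd hx (disjoint_left.1 hdMW (hBM h))
  rcases ih (M ∩ A) W (by
      ext x
      have h3 := hmem x
      have h4 := @hWA x
      have h5 : x ∈ A → x ∉ B := fun h => disjoint_left.1 hd h
      have h6 := @hBM x
      simp only [mem_sdiff, mem_singleton_iff, mem_union, mem_inter_iff]
      tauto) (hdMW.mono_left inter_subset_left) (fun x hx y hy => hMW x hx.1 y hy) with h | h
  · left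
    have e : insert v M = insert v (M ∩ A) ∪ B := by
      ext x
      have h3 := hmem x
      have h6 := @hBM x
      simp only [mem_insert_iff, mem_union, mem_inter_iff]
      tauto
    rw [e]
    apply h2 _ _ _ h
    · rintro x (rfl | hx)
      · exact hvA
      · exact hx.2
    · by_cases hav : a = v
      · exact Or.inl hav
      · right
        refine ⟨?_, ha⟩
        rcases (hmem a).1 ⟨Or.inl ha, hav⟩ with h | h
        · exact h
        · have := hMW b (hBM hb) a h; tauto
  · exact Or.inr h

theorem KT.cut [Finite V] {G : Digraph' V} {k : ℕ} (hk : 2 ≤ k) {S M W : Set V} {v : V}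
    (h : KT G k S) (hv : v ∈ S) (hS : S \ {v} = M ∪ W) (hdMW : Disjoint M W)
    (hMW : ∀ x ∈ M, ∀ y ∈ W, ¬ G.Adj x y ∧ ¬ G.Adj y x) :
    KT G k (insert v M) ∨ KT G k (insert v W) := by
  induction hn : S.ncard using Nat.strong_induction_on generalizing S M W with
  | _ n ih =>
    subst hn
    rcases h.inv hv with he | ⟨A, B, a, rfl, hd, hvA, ha, hA, hB, h1, hab, h2, h3⟩
    · have hS' : insert v (S \ {v}) = S := by rw [insert_sdiff_singleton, insert_eq_of_mem hv]
      rcases (exc_conn hk he hv).2.side (hS.subset) hMW with h' | h'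
      · left
        have : W ⊆ ∅ := fun x hx => disjoint_left.1 hdMW (h' (hS.symm.subset (Or.inr hx))) hx
        have : M = S \ {v} := by rw [hS, subset_empty_iff.1 this, union_empty]
        rw [this, hS']; exact h
      · right
        have : M ⊆ ∅ := fun x hx => disjoint_left.1 hdMW hx (h' (hS.symm.subset (Or.inl hx)))
        have : W = S \ {v} := by rw [hS, subset_empty_iff.1 this, empty_union]
        rw [this, hS']; exact h
    · have hlt : A.ncard < (A ∪ B).ncard := by
        obtain ⟨b, hb, _⟩ := hab
        exact lt_left hd hb
      have hBsub : B ⊆ M ∪ W := by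
        intro x hx
        rw [← hS]
        exact ⟨Or.inr hx, fun e => disjoint_left.1 hd hvA (by
          have e : x = v := e
          exact e ▸ hx)⟩
      rcases (hB.conn hk).side hBsub hMW with h' | h'
      · exact cut_aux hd hvA ha h1 hab h2 hS hdMW hMW h'
          (fun M' W' e d m => ih _ hlt hA hvA e d m rfl)
      · exact (cut_aux hd hvA ha h1 hab h2 (hS.trans (union_comm _ _)) hdMW.symm
          (fun x hx y hy => (hMW y hy x hx).symm) h'
          (fun M' W' e d m => ih _ hlt hA hvA e d m rfl)).symm

theorem KT.U0 [Finite V] {G : Digraph' V} {k : ℕ} (hk : 2 ≤ k) {S : Set V} {c : V}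
    (h : KT G k S) (hc : c ∈ S) : ¬ KT G k (S \ {c}) := by
  induction hn : S.ncard using Nat.strong_induction_on generalizing S c with
  | _ n ih =>
    subst hn
    intro h'
    rcases h.inv hc with he | ⟨A, B, a, rfl, hd, hcA, ha, hA, hB, h1, ⟨b, hb, hab⟩, h2, h3⟩
    · have h0 := (exc_deg hk he hc).1
      obtain ⟨y, hy, hcy⟩ := od_pos (by omega : 1 ≤ od G S c)
      have hyc : y ≠ c := fun e => G.irrefl c (e ▸ hcy)
      have h3 := (h'.deg hk (x := y) ⟨hy, hyc⟩).2
      have h4 := ind_lt (S := S \ {c}) sdiff_subset hc (fun h => h.2 rfl) hcy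
      have h5 := (exc_deg hk he hy).2
      omega
    · have hlt := lt_left hd hb
      have hBc : ∀ x ∈ B, x ≠ c := fun x hx e => disjoint_left.1 hd hcA (e ▸ hx)
      by_cases hca : c = a
      · subst hca
        obtain ⟨y, hy, hcy⟩ := od_pos (by have := (hA.deg hk hcA).1; omega : 1 ≤ od G A c)
        have hyc : y ≠ c := fun e => G.irrefl c (e ▸ hcy)
        have := h'.conn hk B (fun x hx => ⟨Or.inr hx, hBc x hx⟩) ⟨b, hb⟩ (by
          rintro x hx z ⟨hz | hz, hzc⟩ hxz
          · exact absurd (h1 z hz x hx (by tauto)) hzc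
          · exact hz)
        exact disjoint_left.1 hd hy (this ⟨Or.inl hy, hyc⟩)
      · have hac : a ≠ c := fun e => hca e.symm
        rcases h'.cut hk (v := a) (M := (A \ {c}) \ {a}) (W := B) ⟨Or.inl ha, hac⟩ (by
            ext x
            have h5 : x ∈ B → x ≠ c := hBc x
            have h6 : x ∈ B → x ≠ a := fun h e => disjoint_left.1 hd ha (e ▸ h)
            simp only [mem_sdiff, mem_singleton_iff, mem_union]
            tauto) (hd.mono_left (sdiff_subset.trans sdiff_subset)) (by
            intro x hx y hy
            have := h1 x hx.1.1 y hy
            have : x ≠ a := hx.2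
            tauto) with h4 | h4
        · apply ih _ hlt hA hcA rfl
          rwa [insert_sdiff_singleton, insert_eq_of_mem (show a ∈ A \ {c} from ⟨ha, hac⟩)] at h4
        · have haB : a ∉ B := fun h => disjoint_left.1 hd ha h
          apply ih (insert a B).ncard ?_ h4 (c := a) (mem_insert _ _) rfl
          · rw [insert_sdiff_of_mem _ (mem_singleton a), sdiff_singleton_eq_self haB]
            exact hB
          · apply ncard_lt_ncard _ (toFinite _)
            refine ⟨?_, fun h => ?_⟩
            · rintro x (rfl | hx)
              · exact Or.inl ha
              · exact Or.inr hx
            · rcases h (Or.inl hcA) with e | e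
              · exact hca e
              · exact hBc c e rfl

theorem KT.U [Finite V] {G : Digraph' V} {k : ℕ} (hk : 2 ≤ k) {S K L : Set V} {c : V}
    (h : KT G k S) (hc : c ∈ S) (hS : S \ {c} = K ∪ L) (hdKL : Disjoint K L)
    (hKL : ∀ x ∈ K, ∀ y ∈ L, ¬ G.Adj x y ∧ ¬ G.Adj y x) (hK : KT G k K) : KT G k (insert c L) := by
  rcases h.cut hk hc hS hdKL hKL with h1 | h1
  · exfalso
    have hcK : c ∉ K := fun h => (hS.symm.subset (Or.inl h)).2 rfl
    apply h1.U0 hk (mem_insert _ _)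
    rw [insert_sdiff_of_mem _ (mem_singleton c), sdiff_singleton_eq_self hcK]
    exact hK
  · exact h1

theorem od_eq {G : Digraph' V} {S T : Set V} (h : S ⊆ T) {x : V}
    (hn : ∀ y ∈ T, y ∉ S → ¬ G.Adj x y) : od G T x = od G S x := by
  unfold od
  congr 1
  ext y
  constructor
  · rintro ⟨h1, h2⟩
    by_contra h3
    exact hn y h1 (fun h4 => h3 ⟨h4, h2⟩) h2
  · rintro ⟨h1, h2⟩; exact ⟨h h1, h2⟩

theorem ind_eq {G : Digraph' V} {S T : Set V} (h : S ⊆ T) {x : V}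
    (hn : ∀ y ∈ T, y ∉ S → ¬ G.Adj y x) : ind G T x = ind G S x := by
  unfold ind
  congr 1
  ext y
  constructor
  · rintro ⟨h1, h2⟩
    by_contra h3
    exact hn y h1 (fun h4 => h3 ⟨h4, h2⟩) h2
  · rintro ⟨h1, h2⟩; exact ⟨h h1, h2⟩

/-- vertices whose degrees inside `S` are exactly `k-1` -/
def Z (G : Digraph' V) (k : ℕ) (S : Set V) : Set V :=
  {x | x ∈ S ∧ od G S x = k - 1 ∧ ind G S x = k - 1}

theorem exc_card [Finite V] {G : Digraph' V} {k : ℕ} (hk : 2 ≤ k) {S : Set V} {x : V} (hx : x ∈ S)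
    (h : (G.induce S).IsException (k - 1)) : Z G k S = S ∧ k ≤ S.ncard := by
  constructor
  · ext y
    exact ⟨fun h => h.1, fun hy => ⟨hy, exc_deg hk h hy⟩⟩
  · have h1 := (exc_deg hk h hx).1
    have : {y | y ∈ S ∧ G.Adj x y}.ncard < S.ncard :=
      ncard_lt_ncard ⟨fun y hy => hy.1, fun hs => G.irrefl x (hs hx).2⟩ (toFinite _)
    unfold od at h1
    omega

theorem KT.Zlem [Finite V] {G : Digraph' V} {k : ℕ} (hk : 2 ≤ k) {S : Set V} {c : V}
    (h : KT G k S) (hc : c ∈ S) :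
    (G.induce S).IsException (k - 1) ∨ 2 * (k - 1) ≤ (Z G k S).ncard := by
  induction hn : S.ncard using Nat.strong_induction_on generalizing S c with
  | _ n ih =>
    subst hn
    rcases h.inv hc with he | ⟨A, B, a, rfl, hd, hcA, ha, hA, hB, h1, ⟨b, hb, hab⟩, h2, B1, b1, hB1, hkB, hb1, h3⟩
    · exact Or.inl he
    · right
      have key : ∀ P : Set V, ∀ p ∈ P, KT G k P → P.ncard < (A ∪ B).ncard →
          k - 1 ≤ (Z G k P \ {p}).ncard := by
        intro P p hp hP hlt
        have h5 := le_ncard_sdiff {p} (Z G k P)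
        rw [ncard_singleton] at h5
        rcases ih _ hlt hP hp rfl with h4 | h4
        · obtain ⟨h6, h7⟩ := exc_card hk hp h4
          rw [h6] at h5 ⊢
          omega
        · omega
      have k1 := key A a ha hA (lt_left hd hb)
      have k2 := key B1 b1 hb1 hkB ((ncard_le_ncard hB1 (toFinite _)).trans_lt (lt_right hd ha))
      have hdis : Disjoint (Z G k A \ {a}) (Z G k B1 \ {b1}) :=
        disjoint_left.2 fun x hx hx' => disjoint_left.1 hd hx.1.1 (hB1 hx'.1.1)
      have hu := ncard_union_eq hdis (toFinite _) (toFinite _)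
      have hsub : (Z G k A \ {a}) ∪ (Z G k B1 \ {b1}) ⊆ Z G k (A ∪ B) := by
        rintro x (⟨⟨hx, hx1, hx2⟩, hxa⟩ | ⟨⟨hx, hx1, hx2⟩, hxa⟩)
        · have hxa : x ≠ a := hxa
          refine ⟨Or.inl hx, ?_, ?_⟩
          · rw [od_eq subset_union_left, hx1]
            rintro y (hy | hy) hyA
            · exact absurd hy hyA
            · have := h1 x hx y hy; tauto
          · rw [ind_eq subset_union_left, hx2]
            rintro y (hy | hy) hyA
            · exact absurd hy hyA
            · have := h1 x hx y hy; tauto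
        · refine ⟨Or.inr (hB1 hx), ?_, ?_⟩
          · rw [od_eq (hB1.trans subset_union_right), hx1]
            exact fun y hy hyB => (h3 x hx hxa y hy hyB).1
          · rw [ind_eq (hB1.trans subset_union_right), hx2]
            exact fun y hy hyB => (h3 x hx hxa y hy hyB).2
      have := ncard_le_ncard hsub (toFinite _)
      omega

theorem KT.parity [Finite V] {G : Digraph' V} {S : Set V} (h : KT G 2 S) (f : V → ZMod 2)
    (hf : ∀ x ∈ S, ∀ y ∈ S, G.Adj x y → f y = f x + 1) : (S.ncard : ZMod 2) = 0 := by
  induction hn : S.ncard using Nat.strong_induction_on generalizing S with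
  | _ n ih =>
    subst hn
    rcases S.eq_empty_or_nonempty with rfl | ⟨c, hc⟩
    · simp
    rcases h.inv hc with he | ⟨A, B, a, rfl, hd, hcA, ha, hA, hB, h1, ⟨b, hb, hab⟩, h2, h3⟩
    · exact exc_parity f hf he
    · rw [ncard_union_eq hd (toFinite _) (toFinite _)]
      push_cast
      rw [ih _ (lt_left hd hb) hA (fun x hx y hy => hf x (Or.inl hx) y (Or.inl hy)) rfl,
        ih _ (lt_right hd ha) hB (fun x hx y hy => hf x (Or.inr hx) y (Or.inr hy)) rfl, add_zero]

theorem Conn.union {G : Digraph' V} {A B : Set V} (hA : Conn G A) (hB : Conn G B) {a b : V}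
    (ha : a ∈ A) (hb : b ∈ B) (hab : G.Adj a b ∨ G.Adj b a) : Conn G (A ∪ B) := by
  intro X hX hXn hcl
  have sA : (X ∩ A).Nonempty → A ⊆ X := fun hne =>
    (hA (X ∩ A) inter_subset_right hne
      (fun x hx y hy hxy => ⟨hcl x hx.1 y (Or.inl hy) hxy, hy⟩)).trans inter_subset_left
  have sB : (X ∩ B).Nonempty → B ⊆ X := fun hne =>
    (hB (X ∩ B) inter_subset_right hne
      (fun x hx y hy hxy => ⟨hcl x hx.1 y (Or.inr hy) hxy, hy⟩)).trans inter_subset_left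
  obtain ⟨x, hx⟩ := hXn
  rcases hX hx with h | h
  · have h1 := sA ⟨x, hx, h⟩
    exact union_subset h1 (sB ⟨b, hcl a (h1 ha) b (Or.inr hb) hab, hb⟩)
  · have h1 := sB ⟨x, hx, h⟩
    exact union_subset (sA ⟨a, hcl b (h1 hb) a (Or.inl ha) hab.symm, ha⟩) h1

theorem od_lt2 [Finite V] {G : Digraph' V} {S : Set V} {x y z : V} (hy : y ∉ S) (hz : z ∉ S)
    (hyz : y ≠ z) (hxy : G.Adj x y) (hxz : G.Adj x z) : od G S x + 2 ≤ od G univ x := by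
  have h1 := od_lt (subset_insert y S) (mem_insert y S) hy hxy
  have h2 := od_lt (subset_univ (insert y S)) (mem_univ z) (by
    rintro (h | h)
    · exact hyz h.symm
    · exact hz h) hxz
  omega

theorem ind_lt2 [Finite V] {G : Digraph' V} {S : Set V} {x y z : V} (hy : y ∉ S) (hz : z ∉ S)
    (hyz : y ≠ z) (hxy : G.Adj y x) (hxz : G.Adj z x) : ind G S x + 2 ≤ ind G univ x := by
  have h1 := ind_lt (subset_insert y S) (mem_insert y S) hy hxy
  have h2 := ind_lt (subset_univ (insert y S)) (mem_univ z) (by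
    rintro (h | h)
    · exact hyz h.symm
    · exact hz h) hxz
  omega

theorem lemC [Finite V] {G : Digraph' V} {k : ℕ} (hk : 2 ≤ k)
    (hdeg : ∀ x, od G univ x ≤ k ∧ ind G univ x ≤ k) {T : Set V} {v : V}
    (Hmin : ∀ c ∈ T, (k ≤ od G univ c ∨ k ≤ ind G univ c) → ∃ Q : Set V, KT G k Q ∧ c ∉ Q ∧ v ∈ Q ∧
      ∀ x ∈ Q, ∀ y, y ∉ Q → y ≠ c → ¬ G.Adj x y ∧ ¬ G.Adj y x)
    {R : Set V} {z c y : V} (hRT : R ⊆ T) (hR : KT G k R) (hz : z ∉ R) (hv : v ∉ R)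
    (hc : c ∈ R) (hy : y ∈ R) (hconn : Conn G Rᶜ)
    (hin : ∀ x ∈ R, ∀ w, w ∉ R → (G.Adj w x ↔ w = z ∧ x = c))
    (hout : ∀ x ∈ R, ∀ w, w ∉ R → (G.Adj x w ↔ x = y ∧ w = v)) : Ch G k c y R := by
  induction hn : R.ncard using Nat.strong_induction_on generalizing R z c with
  | _ n ih =>
    subst hn
    by_cases hcy : c = y
    · subst hcy; exact Ch.single _ _ hR hc
    have hzc : G.Adj z c := (hin c hc z hz).2 ⟨rfl, rfl⟩
    have hyv : G.Adj y v := (hout y hy v hv).2 ⟨rfl, rfl⟩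
    obtain ⟨Q, hQ, hcQ, hvQ, hcl⟩ := Hmin c (hRT hc) (by
      right
      have h1 := (hR.deg hk hc).2
      have h2 := ind_lt (subset_univ R) (mem_univ z) hz hzc
      omega)
    have hRQ : Rᶜ ⊆ Q := by
      have := hconn (Q ∩ Rᶜ) inter_subset_right ⟨v, hvQ, hv⟩ (by
        intro x hx w hw hxw
        refine ⟨?_, hw⟩
        by_contra hwQ
        have := hcl x hx.1 w hwQ (fun e => hw (e ▸ hc))
        tauto)
      exact this.trans inter_subset_left
    have hyQ : y ∈ Q := by
      by_contra h
      exact (hcl v hvQ y h (fun e => hcy e.symm)).2 hyv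
    set R2 : Set V := Q ∩ R with hR2
    have hKR2 : KT G k R2 := by
      rcases hQ.cut hk (v := y) (M := R2 \ {y}) (W := Rᶜ) hyQ (by
          ext x
          have h1 := @hRQ x
          have h2 : x = y → x ∈ R := fun e => e ▸ hy
          simp only [mem_sdiff, mem_singleton_iff, mem_union, mem_compl_iff, hR2, mem_inter_iff] at h1 ⊢
          tauto) (disjoint_left.2 fun x hx hx' => hx' hx.1.2) (by
          intro x hx w hw
          have h1 := hin x hx.1.2 w hw
          have h2 := hout x hx.1.2 w hw
          have h3 : x ≠ y := hx.2
          have h4 : x ≠ c := fun e => hcQ (e ▸ hx.1.1)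
          tauto) with h | h
      · rwa [insert_sdiff_singleton, insert_eq_of_mem (show y ∈ R2 from ⟨hyQ, hy⟩)] at h
      · exfalso
        obtain ⟨w, hw, hwy⟩ := ind_pos (by have := (h.deg hk (mem_insert y Rᶜ)).2; omega : 1 ≤ ind G (insert y Rᶜ) y)
        rcases hw with rfl | hw
        · exact G.irrefl _ hwy
        · exact hcy ((hin y hy w hw).1 hwy).2.symm
    have hKA : KT G k (R \ R2) := by
      have := hR.U hk hc (K := R2) (L := (R \ R2) \ {c}) (by
        ext x
        have h1 : x ∈ R2 → x ≠ c := fun h e => hcQ (e ▸ h.1)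
        have h2 : x ∈ R2 → x ∈ R := fun h => h.2
        simp only [mem_sdiff, mem_singleton_iff, mem_union]
        tauto) (disjoint_left.2 fun x hx hx' => hx'.1.2 hx)
        (fun x hx w hw => hcl x hx.1 w (fun h => hw.1.2 ⟨h, hw.1.1⟩) hw.2) hKR2
      rwa [insert_sdiff_singleton, insert_eq_of_mem (show c ∈ R \ R2 from ⟨hc, fun h => hcQ h.1⟩)] at this
    have hcA : c ∈ R \ R2 := ⟨hc, fun h => hcQ h.1⟩
    have hdA := hKA.deg hk hcA
    have hdc := hdeg c
    have hnoin : ∀ x ∈ R2, ¬ G.Adj x c := by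
      intro x hx hxc
      have := ind_lt2 (S := R \ R2) (fun h => h.2 hx) (fun h => hz h.1)
        (fun e => hz (e ▸ hx.2)) hxc hzc
      omega
    have hex : ∃ c2 ∈ R2, G.Adj c c2 := by
      by_contra hno
      push Not at hno
      have := hR.conn hk R2 inter_subset_right ⟨y, hyQ, hy⟩ (by
        intro x hx w hw hxw
        by_contra hw2
        by_cases hwc : w = c
        · subst hwc
          have h1 := hnoin x hx
          have h2 := hno x hx
          tauto
        · have := hcl x hx.1 w (fun h => hw2 ⟨h, hw⟩) hwc
          tauto)
      exact hcA.2 (this hc)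
    obtain ⟨c2, hc2, hcc2⟩ := hex
    have huniq : ∀ x ∈ R2, G.Adj c x → x = c2 := by
      intro x hx hcx
      by_contra hne
      have := od_lt2 (S := R \ R2) (fun h => h.2 hx) (fun h => h.2 hc2) hne hcx hcc2
      omega
    have hmid : ∀ x ∈ R2, ∀ w ∈ R, w ∉ R2 → (G.Adj w x ↔ w = c ∧ x = c2) ∧ ¬ G.Adj x w := by
      intro x hx w hw hw2
      by_cases hwc : w = c
      · subst hwc
        refine ⟨⟨fun h => ⟨rfl, huniq x hx h⟩, ?_⟩, hnoin x hx⟩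
        rintro ⟨-, rfl⟩; exact hcc2
      · have := hcl x hx.1 w (fun h => hw2 ⟨h, hw⟩) hwc
        tauto
    have hxc : ∀ x ∈ R2, x ≠ c := fun x hx e => hcQ (e ▸ hx.1)
    have hch : Ch G k c2 y R2 := by
      apply ih R2.ncard ?_ (inter_subset_right.trans hRT) hKR2 (z := c) hcA.2 (fun h => hv h.2)
        hc2 ⟨hyQ, hy⟩ ?_ ?_ ?_ rfl
      · exact ncard_lt_ncard ⟨inter_subset_right, fun h => hcA.2 (h hc)⟩ (toFinite _)
      · have e : R2ᶜ = Rᶜ ∪ (R \ R2) := by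
          ext x
          have h2 : x ∈ R2 → x ∈ R := fun h => h.2
          simp only [mem_sdiff, mem_union, mem_compl_iff]
          tauto
        rw [e]
        exact hconn.union (hKA.conn hk) hz hcA (Or.inl hzc)
      · intro x hx w hw
        by_cases hwR : w ∈ R
        · exact (hmid x hx w hwR hw).1
        · have h1 := hin x hx.2 w hwR
          have h2 := hxc x hx
          have h3 : w ≠ c := fun e => hwR (e ▸ hc)
          tauto
      · intro x hx w hw
        by_cases hwR : w ∈ R
        · have h1 := (hmid x hx w hwR hw).2
          have h3 : w ≠ v := fun e => hv (e ▸ hwR)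
          tauto
        · exact hout x hx.2 w hwR
    have e : R = (R \ R2) ∪ R2 := by
      rw [sdiff_union_of_subset inter_subset_right]
    rw [e]
    exact Ch.cons _ _ _ _ _ hKA hcA hch disjoint_sdiff_left
      (fun x hx w hw => hmid w hw x hx.1 hx.2)

set_option maxHeartbeats 2000000 in
theorem main_dich [Finite V] {G : Digraph' V} {k : ℕ} (hk : 2 ≤ k)
    (hdeg : ∀ x, od G univ x ≤ k ∧ ind G univ x ≤ k) (hconn : Conn G univ)
    (hbad : ∀ v, (k ≤ od G univ v ∨ k ≤ ind G univ v) → ∃ T : Set V, KT G k T ∧ v ∉ T ∧ T.Nonempty ∧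
      ∀ x ∈ T, ∀ y, y ∉ T → y ≠ v → ¬ G.Adj x y ∧ ¬ G.Adj y x)
    (hex : ∃ v, (k ≤ od G univ v ∨ k ≤ ind G univ v)) :
    KT G k univ ∨ ∀ u, KT G k {u}ᶜ := by
  obtain ⟨⟨v, T⟩, ⟨hfv, hT, hvT, hTn, hcl⟩, hmin⟩ := Set.exists_min_image
    {p : V × Set V | (k ≤ od G univ p.1 ∨ k ≤ ind G univ p.1) ∧ KT G k p.2 ∧ p.1 ∉ p.2 ∧
      p.2.Nonempty ∧ ∀ x ∈ p.2, ∀ y, y ∉ p.2 → y ≠ p.1 → ¬ G.Adj x y ∧ ¬ G.Adj y x}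
    (fun p => p.2.ncard) (toFinite _) (by
      obtain ⟨v, hv⟩ := hex
      obtain ⟨T, hT⟩ := hbad v hv
      exact ⟨(v, T), hv, hT⟩)
  simp only at hfv hT hvT hTn hcl
  have hmin' : ∀ c Q, (k ≤ od G univ c ∨ k ≤ ind G univ c) → KT G k Q → c ∉ Q → Q.Nonempty →
      (∀ x ∈ Q, ∀ y, y ∉ Q → y ≠ c → ¬ G.Adj x y ∧ ¬ G.Adj y x) → T.ncard ≤ Q.ncard :=
    fun c Q h1 h2 h3 h4 h5 => hmin (c, Q) ⟨h1, h2, h3, h4, h5⟩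
  clear hmin
  have hH : Conn G Tᶜ := by
    intro X hX hXn hXcl
    by_cases hvX : v ∈ X
    · have := hconn (X ∪ T) (subset_univ _) (hXn.mono subset_union_left) (by
        rintro x (hx | hx) y - hxy
        · by_cases hy : y ∈ T
          · exact Or.inr hy
          · exact Or.inl (hXcl x hx y hy hxy)
        · by_cases hy : y ∈ T
          · exact Or.inr hy
          · by_cases hyv : y = v
            · exact Or.inl (hyv ▸ hvX)
            · have := hcl x hx y hy hyv; tauto)
      intro x hx
      rcases this (mem_univ x) with h | h
      · exact h
      · exact absurd h hx
    · have := hconn X (subset_univ _) hXn (by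
        intro x hx y _ hxy
        by_cases hy : y ∈ T
        · have := hcl y hy x (hX hx) (fun e => hvX (e ▸ hx)); tauto
        · exact hXcl x hx y hy hxy)
      exact absurd (this (mem_univ v)) hvX
  have Hmin : ∀ c ∈ T, (k ≤ od G univ c ∨ k ≤ ind G univ c) → ∃ Q : Set V, KT G k Q ∧ c ∉ Q ∧ v ∈ Q ∧
      ∀ x ∈ Q, ∀ y, y ∉ Q → y ≠ c → ¬ G.Adj x y ∧ ¬ G.Adj y x := by
    intro c hc hfc
    obtain ⟨Q, hQ, hcQ, hQn, hQcl⟩ := hbad c hfc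
    refine ⟨Q, hQ, hcQ, ?_, hQcl⟩
    by_contra hvQ
    by_cases hne : (Q ∩ Tᶜ).Nonempty
    · have := hH (Q ∩ Tᶜ) inter_subset_right hne (by
        intro x hx w hw hxw
        refine ⟨?_, hw⟩
        by_contra hwQ
        have := hQcl x hx.1 w hwQ (fun e => hw (e ▸ hc))
        tauto)
      exact hvQ (this hvT).1
    · have hsub : Q ⊆ T := fun x hx => by
        by_contra h
        exact hne ⟨x, hx, h⟩
      have h1 := ncard_lt_ncard ⟨hsub, fun h => hcQ (h hc)⟩ (toFinite _)
      have h2 := hmin' c Q hfc hQ hcQ hQn hQcl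
      omega
  by_cases hHv : Tᶜ ⊆ {v}
  · right
    have hTe : T = {v}ᶜ := by
      ext x
      constructor
      · intro hx e
        have e : x = v := e
        exact hvT (e ▸ hx)
      · intro hx
        by_contra h
        exact hx (hHv h)
    have hfull : ∀ u, (k ≤ od G univ u ∨ k ≤ ind G univ u) → KT G k {u}ᶜ := by
      intro u hu
      obtain ⟨Q, hQ, hcQ, hQn, hQcl⟩ := hbad u hu
      have h2 := hmin' u Q hu hQ hcQ hQn hQcl
      have hsub : Q ⊆ {u}ᶜ := fun x hx e => hcQ (by
        have e : x = u := e
        exact e ▸ hx)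
      have : Q = {u}ᶜ := by
        apply eq_of_subset_of_ncard_le hsub _ (toFinite _)
        have h3 := ncard_add_ncard_compl ({u} : Set V)
        have h4 := ncard_add_ncard_compl ({v} : Set V)
        rw [ncard_singleton] at h3 h4
        rw [hTe] at h2
        omega
      exact this ▸ hQ
    have := hconn {u | KT G k {u}ᶜ} (subset_univ _) ⟨v, hfull v hfv⟩ (by
      intro x hx y _ hxy
      have hx : KT G k {x}ᶜ := hx
      apply hfull
      have hyx : y ∈ ({x}ᶜ : Set V) := fun e => by
        have e : y = x := e
        subst e
        have := G.irrefl y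
        tauto
      have hdy := hx.deg hk hyx
      rcases hxy with h | h
      · right
        have := ind_lt (subset_univ ({x}ᶜ)) (mem_univ x) (fun h => h rfl) h
        omega
      · left
        have := od_lt (subset_univ ({x}ᶜ)) (mem_univ x) (fun h => h rfl) h
        omega)
    exact fun u => this (mem_univ u)
  · left
    have hfullnb : ∀ u ∈ T, G.Adj v u ∨ G.Adj u v → (k ≤ od G univ u ∨ k ≤ ind G univ u) := by
      intro u hu huv
      have hdu := hT.deg hk hu
      rcases huv with h | h
      · right
        have := ind_lt (subset_univ T) (mem_univ v) hvT h
        omega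
      · left
        have := od_lt (subset_univ T) (mem_univ v) hvT h
        omega
    have hnb : ∃ u ∈ T, G.Adj v u ∨ G.Adj u v := by
      by_contra hno
      push Not at hno
      have := hconn T (subset_univ _) hTn (by
        intro x hx y _ hxy
        by_contra hy
        by_cases hyv : y = v
        · subst hyv
          have := hno x hx; tauto
        · have := hcl x hx y hy hyv; tauto)
      exact hvT (this (mem_univ v))
    have hW : ∃ w, w ∉ T ∧ (G.Adj v w ∨ G.Adj w v) := by
      by_contra hno
      push Not at hno
      apply hHv
      apply hH {v} (by simpa using hvT) (singleton_nonempty v)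
      rintro x rfl y hy hxy
      have := hno y hy; tauto
    have hKH : KT G k Tᶜ := by
      by_contra hnKH
      have key : ∀ u ∈ T, G.Adj v u ∨ G.Adj u v → ∃ M ⊆ insert v T, KT G k M ∧ v ∈ M ∧ u ∉ M := by
        intro u hu huv
        obtain ⟨Q, hQ, huQ, hvQ, hQcl⟩ := Hmin u hu (hfullnb u hu huv)
        have hHQ : Tᶜ ⊆ Q := by
          have := hH (Q ∩ Tᶜ) inter_subset_right ⟨v, hvQ, hvT⟩ (by
            intro x hx w hw hxw
            refine ⟨?_, hw⟩
            by_contra hwQ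
            have := hQcl x hx.1 w hwQ (fun e => hw (e ▸ hu))
            tauto)
          exact this.trans inter_subset_left
        rcases hQ.cut hk (v := v) (M := Q ∩ T) (W := Tᶜ \ {v}) hvQ (by
            ext x
            have h1 := @hHQ x
            have h2 : x = v → x ∉ T := fun e => e ▸ hvT
            simp only [mem_sdiff, mem_singleton_iff, mem_union, mem_compl_iff, mem_inter_iff] at h1 ⊢
            tauto) (disjoint_left.2 fun x hx hx' => hx'.1 hx.2)
            (fun x hx w hw => hcl x hx.2 w hw.1 hw.2) with h | h
        · refine ⟨_, insert_subset_insert inter_subset_right, h, mem_insert _ _, ?_⟩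
          rintro (e | e)
          · exact hvT (e ▸ hu)
          · exact huQ e.1
        · exfalso
          apply hnKH
          rwa [insert_sdiff_singleton, insert_eq_of_mem (show v ∈ Tᶜ from hvT)] at h
      have hOut : ∀ u ∈ T, G.Adj v u → k ≤ od G (insert v T) v := by
        intro u hu huv
        obtain ⟨M, hMs, hM, hvM, huM⟩ := key u hu (Or.inl huv)
        have h1 := (hM.deg hk hvM).1
        have h2 := od_lt hMs (Or.inr hu) huM huv
        omega
      have hIn : ∀ u ∈ T, G.Adj u v → k ≤ ind G (insert v T) v := by
        intro u hu huv
        obtain ⟨M, hMs, hM, hvM, huM⟩ := key u hu (Or.inr huv)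
        have h1 := (hM.deg hk hvM).2
        have h2 := ind_lt hMs (Or.inr hu) huM huv
        omega
      obtain ⟨u, hu, huv⟩ := hnb
      obtain ⟨M, hMs, hM, hvM, huM⟩ := key u hu huv
      obtain ⟨h1, h2⟩ := hM.deg hk hvM
      obtain ⟨x, hx, hvx⟩ := od_pos (by omega : 1 ≤ od G M v)
      obtain ⟨y, hy, hyv⟩ := ind_pos (by omega : 1 ≤ ind G M v)
      have hxT : x ∈ T := by
        rcases hMs hx with e | e
        · exact absurd (e ▸ hvx) (G.irrefl v)
        · exact e
      have hyT : y ∈ T := by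
        rcases hMs hy with e | e
        · exact absurd (e ▸ hyv) (G.irrefl v)
        · exact e
      obtain ⟨w, hwT, hw⟩ := hW
      have hwi : w ∉ insert v T := by
        rintro (e | e)
        · subst e
          have := G.irrefl w; tauto
        · exact hwT e
      rcases hw with hw | hw
      · have h3 := od_lt (subset_univ _) (mem_univ w) hwi hw
        have h4 := hOut x hxT hvx
        have := (hdeg v).1
        omega
      · have h3 := ind_lt (subset_univ _) (mem_univ w) hwi hw
        have h4 := hIn y hyT hyv
        have := (hdeg v).2
        omega
    obtain ⟨hd1, hd2⟩ := hKH.deg hk (x := v) hvT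
    have hu1 : ∀ x ∈ T, ∀ y ∈ T, G.Adj v x → G.Adj v y → x = y := by
      intro x hx y hy h1 h2
      by_contra hne
      have := od_lt2 (S := Tᶜ) (fun h => h hx) (fun h => h hy) hne h1 h2
      have := (hdeg v).1
      omega
    have hu2 : ∀ x ∈ T, ∀ y ∈ T, G.Adj x v → G.Adj y v → x = y := by
      intro x hx y hy h1 h2
      by_contra hne
      have := ind_lt2 (S := Tᶜ) (fun h => h hx) (fun h => h hy) hne h1 h2
      have := (hdeg v).2
      omega
    have hdisj : Disjoint Tᶜ T := disjoint_compl_left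
    by_cases hA : ∃ x ∈ T, G.Adj v x
    · obtain ⟨x, hx, hvx⟩ := hA
      have e1 : ∀ w ∈ Tᶜ, ∀ z ∈ T, (G.Adj w z ↔ w = v ∧ z = x) := by
        intro w hw z hz
        constructor
        · intro h
          have hwv : w = v := by
            by_contra hwv
            exact (hcl z hz w hw hwv).2 h
          subst hwv
          exact ⟨rfl, hu1 z hz x hx h hvx⟩
        · rintro ⟨rfl, rfl⟩; exact hvx
      by_cases hB : ∃ y ∈ T, G.Adj y v
      · obtain ⟨y, hy, hyv⟩ := hB
        have e2 : ∀ w ∈ Tᶜ, ∀ z ∈ T, (G.Adj z w ↔ z = y ∧ w = v) := by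
          intro w hw z hz
          constructor
          · intro h
            have hwv : w = v := by
              by_contra hwv
              exact (hcl z hz w hw hwv).1 h
            subst hwv
            exact ⟨hu2 z hz y hy h hyv, rfl⟩
          · rintro ⟨rfl, rfl⟩; exact hyv
        have hch := lemC hk hdeg Hmin subset_rfl hT hvT hvT hx hy hH
          (fun z hz w hw => e1 w hw z hz) (fun z hz w hw => e2 w hw z hz)
        have := hKH.cyc hvT hch hdisj (fun w hw z hz => ⟨e1 w hw z hz, e2 w hw z hz⟩)
        rwa [compl_union_self] at this
      · push Not at hB
        have := hKH.direct hT hdisj hvT hx (fun w hw z hz => ⟨e1 w hw z hz, fun h => by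
          by_cases hwv : w = v
          · subst hwv; exact hB z hz h
          · exact (hcl z hz w hw hwv).1 h⟩)
        rwa [compl_union_self] at this
    · push Not at hA
      obtain ⟨y, hy, hyv⟩ := hnb
      have hyv : G.Adj y v := hyv.resolve_left (hA y hy)
      have := hT.direct hKH hdisj.symm hy hvT (fun z hz w hw => by
          by_cases hwv : w = v
          · subst hwv
            refine ⟨⟨fun h => ⟨hu2 z hz y hy h hyv, rfl⟩, ?_⟩, hA z hz⟩
            rintro ⟨rfl, -⟩; exact hyv
          · have := hcl z hz w hw hwv
            tauto)
      rwa [union_compl_self] at this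

theorem zval {n : ℕ} (hn : 3 ≤ n) (a : ZMod n) :
    (a.val + 1 < n ∧ (a + 1).val = a.val + 1) ∨ (a.val + 1 = n ∧ a + 1 = 0) := by
  have : NeZero n := ⟨by omega⟩
  have : Fact (1 < n) := ⟨by omega⟩
  have h1 := ZMod.val_lt a
  by_cases h : a.val + 1 < n
  · left
    refine ⟨h, ?_⟩
    have := ZMod.val_add_of_lt (a := a) (b := 1) (by rw [ZMod.val_one]; exact h)
    rw [this, ZMod.val_one]
  · right
    have e : a.val + 1 = n := by omega
    refine ⟨e, ?_⟩
    have h2 : ((a.val + 1 : ℕ) : ZMod n) = 0 := by rw [e]; exact ZMod.natCast_self n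
    simpa using h2

theorem two_nbrs [Finite V] {G : Digraph' V} {x a b c : V} (h2 : od G univ x = 2) (hab : a ≠ b)
    (ha : G.Adj x a) (hb : G.Adj x b) (hc : G.Adj x c) : c = a ∨ c = b := by
  have : ({a, b} : Set V) = {y | y ∈ univ ∧ G.Adj x y} := by
    apply eq_of_subset_of_ncard_le _ _ (toFinite _)
    · rintro y (rfl | rfl)
      · exact ⟨mem_univ _, ha⟩
      · exact ⟨mem_univ _, hb⟩
    · unfold od at h2
      rw [h2, ncard_pair hab]
  have h3 : c ∈ ({a, b} : Set V) := by rw [this]; exact ⟨mem_univ _, hc⟩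
  exact h3

theorem sym_cycle [Finite V] [Nonempty V] {G : Digraph' V} (hsym : ∀ x y, G.Adj x y → G.Adj y x)
    (h2 : ∀ x, od G univ x = 2) (hconn : Conn G univ) :
    ∃ n : ℕ, 3 ≤ n ∧ ∃ e : V ≃ ZMod n,
      ∀ x y : V, G.Adj x y ↔ (e y = e x + 1 ∨ e x = e y + 1) := by
  have ho : ∀ x y, ∃ z, G.Adj y z ∧ z ≠ x := by
    intro x y
    by_contra hno
    push Not at hno
    have : {z | z ∈ univ ∧ G.Adj y z} ⊆ {x} := fun z hz => hno z hz.2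
    have := ncard_le_ncard this (toFinite _)
    rw [ncard_singleton] at this
    have h3 := h2 y
    unfold od at h3
    omega
  choose o ho1 ho2 using ho
  obtain ⟨v0⟩ := ‹Nonempty V›
  let p : ℕ → V × V := fun n => Nat.rec (v0, o v0 v0) (fun _ q => (q.2, o q.1 q.2)) n
  let s : ℕ → V := fun n => (p n).1
  have hp : ∀ n, p (n + 1) = ((p n).2, o (p n).1 (p n).2) := fun n => rfl
  have hs1 : ∀ n, G.Adj (s n) (s (n + 1)) := by
    intro n
    cases n with
    | zero => exact ho1 v0 v0
    | succ n => exact ho1 _ _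
  have hs2 : ∀ n, s (n + 2) ≠ s n := fun n => ho2 _ _
  have hs3 : ∀ n, s (n + 1) ≠ s n := fun n e => G.irrefl (s n) (by
    have := hs1 n
    rwa [e] at this)
  clear_value s
  have hrep : ∃ j, ∃ i < j, s i = s j := by
    obtain ⟨a, b, hab, hne⟩ := Finite.exists_ne_map_eq_of_infinite s
    rcases lt_or_gt_of_ne hab with h | h
    · exact ⟨b, a, h, hne⟩
    · exact ⟨a, b, h, hne.symm⟩
  classical
  obtain ⟨n, ⟨i, hin, hi⟩, hmin⟩ : ∃ n, (∃ i < n, s i = s n) ∧ ∀ m < n, ¬ ∃ i < m, s i = s m :=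
    ⟨Nat.find hrep, Nat.find_spec hrep, fun m hm => Nat.find_min hrep hm⟩
  have hinj : ∀ a < n, ∀ b < n, s a = s b → a = b := by
    intro a ha b hb hab
    rcases lt_trichotomy a b with h | h | h
    · exact absurd ⟨a, h, hab⟩ (hmin b hb)
    · exact h
    · exact absurd ⟨b, h, hab.symm⟩ (hmin a ha)
  have hi1 : n ≠ i + 1 := by
    rintro rfl; exact hs3 i hi.symm
  have hi2 : n ≠ i + 2 := by
    rintro rfl; exact hs2 i hi.symm
  have hi0 : i = 0 := by
    by_contra h0
    obtain ⟨j, rfl⟩ : ∃ j, i = j + 1 := ⟨i - 1, by omega⟩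
    obtain ⟨m, rfl⟩ : ∃ m, n = m + 1 := ⟨n - 1, by omega⟩
    have h3 : G.Adj (s (j + 1)) (s m) := by
      rw [hi]; exact hsym _ _ (hs1 m)
    rcases two_nbrs (h2 _) (hs2 j).symm (hsym _ _ (hs1 j)) (hs1 (j + 1)) h3 with h | h
    · have := hinj _ (by omega) _ (by omega) h
      omega
    · have := hinj _ (by omega) _ (by omega) h
      omega
  subst hi0
  have hn : 3 ≤ n := by omega
  have : NeZero n := ⟨by omega⟩
  let g : ZMod n → V := fun a => s a.val
  have hg : Function.Injective g := fun a b hab =>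
    ZMod.val_injective n (hinj _ (ZMod.val_lt a) _ (ZMod.val_lt b) hab)
  have hg1 : ∀ a, G.Adj (g a) (g (a + 1)) := by
    intro a
    rcases zval hn a with ⟨h, e⟩ | ⟨h, e⟩
    · change G.Adj (s a.val) (s (a + 1).val)
      rw [e]; exact hs1 _
    · change G.Adj (s a.val) (s (a + 1).val)
      rw [e, ZMod.val_zero, hi]
      have h9 := hs1 a.val
      rwa [h] at h9
  have hg2 : ∀ a, G.Adj (g a) (g (a - 1)) := by
    intro a
    have := hsym _ _ (hg1 (a - 1))
    rwa [sub_add_cancel] at this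
  have hg3 : ∀ a, g (a + 1) ≠ g (a - 1) := by
    intro a h
    have h1 := hg h
    have h3 : ((2 : ℕ) : ZMod n) = 0 := by
      have : a + 1 - (a - 1) = 0 := by rw [h1, sub_self]
      have e : a + 1 - (a - 1) = ((2 : ℕ) : ZMod n) := by push_cast; ring
      rw [← e, this]
    rw [ZMod.natCast_eq_zero_iff] at h3
    have := Nat.le_of_dvd (by omega) h3
    omega
  have hg4 : ∀ a x, G.Adj (g a) x → x = g (a + 1) ∨ x = g (a - 1) := fun a x h =>
    two_nbrs (h2 _) (hg3 a) (hg1 a) (hg2 a) h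
  have hsurj : Function.Surjective g := by
    have := hconn (range g) (subset_univ _) ⟨g 0, 0, rfl⟩ (by
      rintro _ ⟨a, rfl⟩ y - hxy
      have hxy : G.Adj (g a) y := by
        rcases hxy with h | h
        · exact h
        · exact hsym _ _ h
      rcases hg4 a y hxy with h | h
      · exact ⟨_, h.symm⟩
      · exact ⟨_, h.symm⟩)
    intro x
    exact this (mem_univ x)
  refine ⟨n, hn, (Equiv.ofBijective g ⟨hg, hsurj⟩).symm, ?_⟩
  intro x y
  obtain ⟨a, rfl⟩ := hsurj x
  obtain ⟨b, rfl⟩ := hsurj y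
  have e : ∀ a, (Equiv.ofBijective g ⟨hg, hsurj⟩).symm (g a) = a := fun a =>
    Equiv.ofBijective_symm_apply_apply g ⟨hg, hsurj⟩ a
  rw [e, e]
  constructor
  · intro h
    rcases hg4 a _ h with h | h
    · exact Or.inl (hg h)
    · right
      rw [hg h]; ring
  · rintro (rfl | rfl)
    · exact hg1 _
    · exact hsym _ _ (hg1 _)

theorem full_case [Finite V] [Nontrivial V] {G : Digraph' V} {k : ℕ} (hk : 2 ≤ k)
    (hdeg : ∀ x, od G univ x ≤ k ∧ ind G univ x ≤ k) (hconn : Conn G univ)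
    (hall : ∀ u, KT G k {u}ᶜ) : G.IsException k := by
  have hod : ∀ x, od G univ x = k := by
    intro x
    obtain ⟨u, hu⟩ := exists_ne x
    obtain ⟨y, hy, hxy⟩ := od_pos (by
      have := ((hall u).deg hk (x := x) hu.symm).1
      omega : 1 ≤ od G {u}ᶜ x)
    have hne : x ≠ y := fun e => G.irrefl x (by rw [← e] at hxy; exact hxy)
    have h1 := ((hall y).deg hk (x := x) hne).1
    have h2 := od_lt (subset_univ ({y}ᶜ)) (mem_univ y) (fun h => h rfl) hxy
    have := (hdeg x).1
    omega
  have hid : ∀ x, ind G univ x = k := by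
    intro x
    obtain ⟨u, hu⟩ := exists_ne x
    obtain ⟨y, hy, hxy⟩ := ind_pos (by
      have := ((hall u).deg hk (x := x) hu.symm).2
      omega : 1 ≤ ind G {u}ᶜ x)
    have hne : x ≠ y := fun e => G.irrefl x (by rw [← e] at hxy; exact hxy)
    have h1 := ((hall y).deg hk (x := x) hne).2
    have h2 := ind_lt (subset_univ ({y}ᶜ)) (mem_univ y) (fun h => h rfl) hxy
    have := (hdeg x).2
    omega
  have hZ : ∀ v, ∀ x ∈ Z G k {v}ᶜ, G.Adj v x ∧ G.Adj x v := by
    rintro v x ⟨hx, h1, h2⟩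
    constructor
    · by_contra hno
      have := ind_eq (G := G) (subset_univ ({v}ᶜ)) (x := x) (by
        intro y _ hy
        have e : y = v := by simpa using hy
        rw [e]; exact hno)
      have := hid x
      omega
    · by_contra hno
      have := od_eq (G := G) (subset_univ ({v}ᶜ)) (x := x) (by
        intro y _ hy
        have e : y = v := by simpa using hy
        rw [e]; exact hno)
      have := hod x
      omega
  have hZc : ∀ v, Z G k {v}ᶜ ⊆ {y | y ∈ univ ∧ G.Adj v y} := fun v x hx => ⟨mem_univ _, (hZ v x hx).1⟩
  have hZk : ∀ v, (Z G k {v}ᶜ).ncard ≤ k := by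
    intro v
    have := ncard_le_ncard (hZc v) (toFinite _)
    have h1 := hod v
    unfold od at h1
    omega
  by_cases hA : ∃ v, (G.induce {v}ᶜ).IsException (k - 1)
  · obtain ⟨v, hv⟩ := hA
    obtain ⟨u, hu⟩ := exists_ne v
    obtain ⟨h1, h2⟩ := exc_card hk (x := u) hu hv
    have h3 := hZk v
    rw [h1] at h3
    have hcard : Nat.card V = k + 1 := by
      have h4 := ncard_add_ncard_compl ({v} : Set V)
      rw [ncard_singleton] at h4
      omega
    have hcomp : G.IsSymmetricComplete := by
      intro x y
      have : {y | y ∈ univ ∧ G.Adj x y} = {x}ᶜ := by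
        apply eq_of_subset_of_ncard_le _ _ (toFinite _)
        · rintro z ⟨-, hz⟩ e
          have e : z = x := e
          exact G.irrefl x (e ▸ hz)
        · have h4 := ncard_add_ncard_compl ({x} : Set V)
          rw [ncard_singleton] at h4
          have h5 := hod x
          unfold od at h5
          omega
      have h6 := Set.ext_iff.1 this y
      constructor
      · intro h e
        exact (h6.1 ⟨mem_univ _, h⟩) e.symm
      · intro h
        exact (h6.2 (fun e => h (by
          have e : y = x := e
          exact e.symm))).2
    by_cases hk3 : 3 ≤ k
    · exact Or.inr (Or.inr ⟨hk3, hcomp, hcard⟩)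
    · have hk2 : k = 2 := by omega
      subst hk2
      refine Or.inr (Or.inl ⟨rfl, 3, le_rfl, by decide, ?_⟩)
      let e : V ≃ ZMod 3 := Finite.equivFinOfCardEq hcard
      refine ⟨e, fun x y => ?_⟩
      rw [hcomp x y, ← e.injective.ne_iff]
      generalize e x = a
      generalize e y = b
      revert a b
      decide
  · push Not at hA
    have hZl : ∀ v, 2 * (k - 1) ≤ (Z G k {v}ᶜ).ncard := by
      intro v
      obtain ⟨u, hu⟩ := exists_ne v
      exact ((hall v).Zlem hk (c := u) hu).resolve_left (hA v)
    have hk2 : k = 2 := by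
      obtain ⟨v⟩ : Nonempty V := inferInstance
      have h1 := hZl v
      have h2 := hZk v
      omega
    subst hk2
    have hsym : ∀ x y, G.Adj x y → G.Adj y x := by
      intro x y hxy
      have : Z G 2 {x}ᶜ = {y | y ∈ univ ∧ G.Adj x y} := by
        apply eq_of_subset_of_ncard_le (hZc x) _ (toFinite _)
        have h1 := hZl x
        have h5 := hod x
        unfold od at h5
        omega
      have h6 : y ∈ Z G 2 {x}ᶜ := by rw [this]; exact ⟨mem_univ _, hxy⟩
      exact (hZ x y h6).2
    obtain ⟨n, hn, e, he⟩ := sym_cycle hsym hod hconn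
    have : NeZero n := ⟨by omega⟩
    refine Or.inr (Or.inl ⟨rfl, n, hn, ?_, e, he⟩)
    have hone : (1 : ZMod 2) + 1 = 0 := by decide
    have hpar := (hall (e.symm 0)).parity (fun x => ((e x).val : ZMod 2)) (by
      intro x hx y hy hxy
      have hx0 : e x ≠ 0 := fun h => hx (by
        show x = e.symm 0
        rw [← h, e.symm_apply_apply])
      have hy0 : e y ≠ 0 := fun h => hy (by
        show y = e.symm 0
        rw [← h, e.symm_apply_apply])
      show ((e y).val : ZMod 2) = ((e x).val : ZMod 2) + 1
      rcases (he x y).1 hxy with h | h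
      · rcases zval hn (e x) with h1 | h1
        · rw [h, h1.2]; push_cast; rfl
        · exact absurd (h.trans h1.2) hy0
      · rcases zval hn (e y) with h1 | h1
        · rw [h, h1.2]; push_cast; rw [add_assoc, hone, add_zero]
        · exact absurd (h.trans h1.2) hx0)
    have hcard : Nat.card V = n := by
      rw [Nat.card_congr e, Nat.card_zmod]
    have h4 := ncard_add_ncard_compl ({e.symm 0} : Set V)
    rw [ncard_singleton, hcard] at h4
    rw [ZMod.natCast_eq_zero_iff_even] at hpar
    rw [← h4]
    exact Even.one_add hpar

theorem outDeg_eq {G : Digraph' V} (x : V) : G.outDeg x = od G univ x := by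
  unfold Digraph'.outDeg od
  rw [← Nat.card_coe_set_eq]
  exact Nat.card_congr (Equiv.subtypeEquivRight (fun y => by simp))

theorem inDeg_eq {G : Digraph' V} (x : V) : G.inDeg x = ind G univ x := by
  unfold Digraph'.inDeg ind
  rw [← Nat.card_coe_set_eq]
  exact Nat.card_congr (Equiv.subtypeEquivRight (fun y => by simp))

theorem final [Finite V] (G : Digraph' V) (k : ℕ) (hk : 2 ≤ k) (hc : G.Connected)
    (hd : G.DeltaMax = k) :
    G.IsException k ∨ G.IsKTree k ∨
      ∃ v : V, G.dmax v = k ∧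
        ∀ w : {u : V // u ≠ v},
          ¬ ((G.induce {u : V | u ≠ v}).induce
              ((G.induce {u : V | u ≠ v}).component w)).IsKTree k := by
  by_cases hgood : ∃ v : V, G.dmax v = k ∧
        ∀ w : {u : V // u ≠ v},
          ¬ ((G.induce {u : V | u ≠ v}).induce
              ((G.induce {u : V | u ≠ v}).component w)).IsKTree k
  · exact Or.inr (Or.inr hgood)
  push Not at hgood
  obtain ⟨hne, hcc⟩ := hc
  have hbdd : BddAbove (range G.dmax) := (finite_range _).bddAbove
  have hdm : ∀ x, G.dmax x ≤ k := fun x => hd ▸ le_csSup hbdd ⟨x, rfl⟩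
  have hdeg : ∀ x, od G univ x ≤ k ∧ ind G univ x ≤ k := by
    intro x
    have := hdm x
    unfold Digraph'.dmax at this
    rw [outDeg_eq, inDeg_eq] at this
    exact ⟨(le_max_left _ _).trans this, (le_max_right _ _).trans this⟩
  have hdmk : ∀ x, G.dmax x = k ↔ (k ≤ od G univ x ∨ k ≤ ind G univ x) := by
    intro x
    have := hdeg x
    unfold Digraph'.dmax
    rw [outDeg_eq, inDeg_eq]
    rw [← le_max_iff]
    have h2 := max_le this.1 this.2
    omega
  obtain ⟨v0, hv0⟩ : ∃ v, G.dmax v = k := by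
    have := Nat.sSup_mem (range_nonempty G.dmax) hbdd
    obtain ⟨v, hv⟩ := this
    exact ⟨v, hv.trans hd⟩
  have hconn : Conn G univ := by
    rintro X - ⟨x, hx⟩ hcl y -
    have := hcc x y
    induction this with
    | refl => exact hx
    | tail _ h ih => exact hcl _ ih _ (mem_univ _) h
  have hnt : Nontrivial V := by
    rcases (hdmk v0).1 hv0 with h | h
    · obtain ⟨y, -, hy⟩ := od_pos (by omega : 1 ≤ od G univ v0)
      exact ⟨v0, y, fun e => G.irrefl y (by rw [e] at hy; exact hy)⟩
    · obtain ⟨y, -, hy⟩ := ind_pos (by omega : 1 ≤ ind G univ v0)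
      exact ⟨v0, y, fun e => G.irrefl y (by rw [e] at hy; exact hy)⟩
  have hbad : ∀ v, (k ≤ od G univ v ∨ k ≤ ind G univ v) → ∃ T : Set V, KT G k T ∧ v ∉ T ∧ T.Nonempty ∧
      ∀ x ∈ T, ∀ y, y ∉ T → y ≠ v → ¬ G.Adj x y ∧ ¬ G.Adj y x := by
    intro v hv
    obtain ⟨w, hw⟩ := hgood v ((hdmk v).2 hv)
    let f : ↥((G.induce {u : V | u ≠ v}).component w) → V := fun x => x.1.1
    refine ⟨range f, KT.of_embed f (fun x y h => Subtype.ext (Subtype.ext h)) (fun x y => Iff.rfl) hw.2, ?_,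
      ⟨w.1, ⟨⟨w, Relation.ReflTransGen.refl⟩, rfl⟩⟩, ?_⟩
    · rintro ⟨x, hx⟩
      exact x.1.2 hx
    · rintro _ ⟨x, rfl⟩ y hy hyv
      have : ¬ (G.Adj (f x) y ∨ G.Adj y (f x)) := by
        intro h
        apply hy
        refine ⟨⟨⟨y, hyv⟩, ?_⟩, rfl⟩
        exact Relation.ReflTransGen.tail x.2 h
      tauto
  rcases main_dich hk hdeg hconn hbad ⟨v0, (hdmk v0).1 hv0⟩ with h | h
  · right; left
    exact ⟨hd.le, Buildable.iso (Equiv.Set.univ V) _ _ (fun x y => Iff.rfl) h⟩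
  · left
    exact full_case hk hdeg hconn h

end KTP

/-- Key lemma for the `k`-tree proof: a connected digraph with `Δ_max(G) = k ≥ 2`
is a member of `𝓑_k`, or a `k`-tree, or has a vertex `v` of maxdegree `k` such that
no connected component of `G − v` is a `k`-tree. -/
theorem exception_or_ktree_or_good_vertex {V : Type} [Fintype V] (G : Digraph' V)
    (k : ℕ) (hk : 2 ≤ k) (hc : G.Connected) (hd : G.DeltaMax = k) :
    G.IsException k ∨ G.IsKTree k ∨
      ∃ v : V, G.dmax v = k ∧
        ∀ w : {u : V // u ≠ v},
          ¬ ((G.induce {u : V | u ≠ v}).induce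
              ((G.induce {u : V | u ≠ v}).component w)).IsKTree k := by
  exact KTP.final G k hk hc hd
end

section
/- Let k ≥ 2 and let G be a k-regular connected digraph that is not a member of 𝓑_k, and let r₁, r₂ ≥ 1 with r₁ + r₂ = k. Then there exists an (r₁, r₂)-normal partition (V₁, V₂) of V(G) such that for i = 1, 2, G[Vᵢ] is rᵢ-special and contains no connected component that is a member of 𝓑_{rᵢ}. -/
namespace Digraph'

/-- `G` is `r`-special: every vertex has `min(d⁺, d⁻) < r` or `d⁺ = d⁻ = r`. -/
def IsSpecial {V : Type} (G : Digraph' V) (r : ℕ) : Prop :=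
  ∀ v : V, G.dmin v < r ∨ (G.outDeg v = r ∧ G.inDeg v = r)

/-- The number of arcs of `G`. -/
noncomputable def numArcs {V : Type} (G : Digraph' V) : ℕ :=
  Nat.card {p : V × V // G.Adj p.1 p.2}

end Digraph'

namespace NPO

set_option linter.unusedSectionVars false

open Classical in
/-- flip the colour of `x` -/
noncomputable def flip {V : Type} (c : V → Bool) (x : V) : V → Bool :=
  fun v => if v = x then !(c x) else c v

variable {V : Type}

theorem flip_same (c : V → Bool) (x : V) : flip c x x = !(c x) := by simp [flip]
theorem flip_ne (c : V → Bool) {x v : V} (h : v ≠ x) : flip c x v = c v := by simp [flip, h]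
theorem flip_flip (c : V → Bool) (x : V) : flip (flip c x) x = c := by
  funext v
  by_cases h : v = x
  · subst h; simp [flip]
  · simp [flip, h]

/-- symmetric adjacency -/
def sA (G : Digraph' V) (u w : V) : Prop := G.Adj u w ∨ G.Adj w u

theorem sA_symm {G : Digraph' V} {u w : V} (h : sA G u w) : sA G w u := Or.symm h
theorem sA_ne {G : Digraph' V} {u w : V} (h : sA G u w) : u ≠ w := by
  rintro rfl
  rcases h with h | h <;> exact G.irrefl _ h

noncomputable def dO (G : Digraph' V) (S : Set V) (v : V) : ℕ := {w | w ∈ S ∧ G.Adj v w}.ncard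
noncomputable def dI (G : Digraph' V) (S : Set V) (v : V) : ℕ := {w | w ∈ S ∧ G.Adj w v}.ncard
noncomputable def eA (G : Digraph' V) (S : Set V) : ℕ :=
  {p : V × V | p.1 ∈ S ∧ p.2 ∈ S ∧ G.Adj p.1 p.2}.ncard

def Conn (G : Digraph' V) (S : Set V) : Prop :=
  ∀ T : Set V, (∃ u ∈ S, u ∈ T) → (∀ u ∈ S, u ∈ T → ∀ w ∈ S, sA G u w → w ∈ T) → S ⊆ T

structure IsComp (G : Digraph' V) (c : V → Bool) (S : Set V) : Prop where
  ne : S.Nonempty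
  mono : ∀ u ∈ S, ∀ w ∈ S, c u = c w
  closed : ∀ u ∈ S, ∀ w, sA G u w → c u = c w → w ∈ S
  conn : Conn G S

structure Bad (G : Digraph' V) (r : Bool → ℕ) (c : V → Bool) (C : Set V) : Prop where
  comp : IsComp G c C
  regO : ∀ v ∈ C, dO G C v = r (c v)
  regI : ∀ v ∈ C, dI G C v = r (c v)
  conn' : ∀ v ∈ C, Conn G (C \ {v})

noncomputable def wt (G : Digraph' V) (r : Bool → ℕ) (c : V → Bool) : ℕ :=
  r false * eA G {v | c v = true} + r true * eA G {v | c v = false}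

def Normal (G : Digraph' V) (r : Bool → ℕ) (c : V → Bool) : Prop := ∀ cc, wt G r c ≤ wt G r cc

/-- normal colouring with the minimum number of bad components -/
def M (G : Digraph' V) (r : Bool → ℕ) (c : V → Bool) : Prop :=
  Normal G r c ∧ ∀ c', Normal G r c' → {S | Bad G r c S}.ncard ≤ {S | Bad G r c' S}.ncard

theorem IsComp.sub {G : Digraph' V} {c : V → Bool} {S T : Set V} (hS : IsComp G c S)
    (hT : IsComp G c T) {x : V} (h1 : x ∈ S) (h2 : x ∈ T) : S ⊆ T :=
  hS.conn T ⟨x, h1, h2⟩ fun u hu huT w hw h => hT.closed u huT w h (hS.mono u hu w hw)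

theorem IsComp.eq {G : Digraph' V} {c : V → Bool} {S T : Set V} (hS : IsComp G c S)
    (hT : IsComp G c T) {x : V} (h1 : x ∈ S) (h2 : x ∈ T) : S = T :=
  (hS.sub hT h1 h2).antisymm (hT.sub hS h2 h1)

/-- the component of `x` -/
def cp (G : Digraph' V) (c : V → Bool) (x : V) : Set V :=
  {u | Relation.ReflTransGen (fun a b => sA G a b ∧ c a = c b) x u}

theorem mem_cp (G : Digraph' V) (c : V → Bool) (x : V) : x ∈ cp G c x := Relation.ReflTransGen.refl

theorem cp_col {G : Digraph' V} {c : V → Bool} {x u : V} (h : u ∈ cp G c x) : c u = c x := by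
  induction h with
  | refl => rfl
  | tail _ h ih => rw [← h.2, ih]

theorem cp_isComp (G : Digraph' V) (c : V → Bool) (x : V) : IsComp G c (cp G c x) where
  ne := ⟨x, mem_cp G c x⟩
  mono := fun u hu w hw => by rw [cp_col hu, cp_col hw]
  closed := fun u hu w h hc => Relation.ReflTransGen.tail hu ⟨h, hc⟩
  conn := by
    rintro T ⟨u, hu, huT⟩ hcl
    have hx : x ∈ T := by
      have key : ∀ v, v ∈ cp G c x → v ∈ T → x ∈ T := by
        intro v hv
        induction hv with
        | refl => exact id
        | @tail a b hab h ih =>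
          intro hb
          exact ih (hcl b (Relation.ReflTransGen.tail hab h) hb a hab (sA_symm h.1))
      exact key u hu huT
    intro v hv
    induction hv with
    | refl => exact hx
    | @tail a b hab h ih => exact hcl a hab ih b (Relation.ReflTransGen.tail hab h) h.1

theorem cp_eq {G : Digraph' V} {c : V → Bool} {S : Set V} (hS : IsComp G c S) {x : V}
    (h : x ∈ S) : cp G c x = S := (cp_isComp G c x).eq hS (mem_cp G c x) h

/-- a component not touched by a flip remains a component -/
theorem IsComp.flip {G : Digraph' V} {c : V → Bool} {S : Set V} (hS : IsComp G c S) {x : V}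
    (hx : x ∉ S) (h : ∀ u ∈ S, sA G u x → c u = c x) : IsComp G (flip c x) S where
  ne := hS.ne
  mono := fun u hu w hw => by
    rw [flip_ne c (by rintro rfl; exact hx hu), flip_ne c (by rintro rfl; exact hx hw)]
    exact hS.mono u hu w hw
  closed := fun u hu w huw hc => by
    rw [flip_ne c (by rintro rfl; exact hx hu)] at hc
    by_cases hw : w = x
    · subst hw
      rw [flip_same, h u hu huw] at hc
      simp at hc
    · rw [flip_ne c hw] at hc
      exact hS.closed u hu w huw hc
  conn := hS.conn

section fin
variable [Finite V]

theorem dO_mono (G : Digraph' V) {S T : Set V} (h : S ⊆ T) (v : V) : dO G S v ≤ dO G T v :=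
  Set.ncard_le_ncard (fun _ hw => ⟨h hw.1, hw.2⟩) (Set.toFinite _)
theorem dI_mono (G : Digraph' V) {S T : Set V} (h : S ⊆ T) (v : V) : dI G S v ≤ dI G T v :=
  Set.ncard_le_ncard (fun _ hw => ⟨h hw.1, hw.2⟩) (Set.toFinite _)

theorem dO_insert_adj {G : Digraph' V} {S : Set V} {x v : V} (hx : x ∉ S) (h : G.Adj v x) :
    dO G (insert x S) v = dO G S v + 1 := by
  unfold dO
  rw [← Set.ncard_insert_of_notMem (a := x) (by simp [hx]) (Set.toFinite _)]
  congr 1; ext w; simp only [Set.mem_insert_iff, Set.mem_ofPred_eq]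
  constructor
  · rintro ⟨rfl | h1, h2⟩ <;> simp_all
  · rintro (rfl | h1) <;> simp_all
theorem dI_insert_adj {G : Digraph' V} {S : Set V} {x v : V} (hx : x ∉ S) (h : G.Adj x v) :
    dI G (insert x S) v = dI G S v + 1 := by
  unfold dI
  rw [← Set.ncard_insert_of_notMem (a := x) (by simp [hx]) (Set.toFinite _)]
  congr 1; ext w; simp only [Set.mem_insert_iff, Set.mem_ofPred_eq]
  constructor
  · rintro ⟨rfl | h1, h2⟩ <;> simp_all
  · rintro (rfl | h1) <;> simp_all
theorem dO_insert_not {G : Digraph' V} {S : Set V} {x v : V} (h : ¬ G.Adj v x) :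
    dO G (insert x S) v = dO G S v := by
  unfold dO
  congr 1; ext w; simp only [Set.mem_insert_iff, Set.mem_ofPred_eq]
  constructor
  · rintro ⟨rfl | h1, h2⟩ <;> simp_all
  · rintro h1; simp_all
theorem dI_insert_not {G : Digraph' V} {S : Set V} {x v : V} (h : ¬ G.Adj x v) :
    dI G (insert x S) v = dI G S v := by
  unfold dI
  congr 1; ext w; simp only [Set.mem_insert_iff, Set.mem_ofPred_eq]
  constructor
  · rintro ⟨rfl | h1, h2⟩ <;> simp_all
  · rintro h1; simp_all

theorem dO_union {G : Digraph' V} {S T : Set V} (h : Disjoint S T) (v : V) :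
    dO G (S ∪ T) v = dO G S v + dO G T v := by
  unfold dO
  rw [← Set.ncard_union_eq _ (Set.toFinite _) (Set.toFinite _)]
  · congr 1; ext w; simp only [Set.mem_union, Set.mem_ofPred_eq]; tauto
  · rw [Set.disjoint_left] at h ⊢
    exact fun w h1 h2 => h h1.1 h2.1
theorem dI_union {G : Digraph' V} {S T : Set V} (h : Disjoint S T) (v : V) :
    dI G (S ∪ T) v = dI G S v + dI G T v := by
  unfold dI
  rw [← Set.ncard_union_eq _ (Set.toFinite _) (Set.toFinite _)]
  · congr 1; ext w; simp only [Set.mem_union, Set.mem_ofPred_eq]; tauto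
  · rw [Set.disjoint_left] at h ⊢
    exact fun w h1 h2 => h h1.1 h2.1

theorem eA_insert {G : Digraph' V} {S : Set V} {x : V} (hx : x ∉ S) :
    eA G (insert x S) = eA G S + dO G S x + dI G S x := by
  unfold eA dO dI
  rw [← Set.ncard_image_of_injective {w | w ∈ S ∧ G.Adj x w} (f := fun w => (x, w))
      (fun a b h => by simpa using h),
    ← Set.ncard_image_of_injective {w | w ∈ S ∧ G.Adj w x} (f := fun w => (w, x))
      (fun a b h => by simpa using h),
    ← Set.ncard_union_eq _ (Set.toFinite _) (Set.toFinite _),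
    ← Set.ncard_union_eq _ (Set.toFinite _) (Set.toFinite _)]
  · congr 1; ext ⟨a, b⟩
    simp only [Set.mem_insert_iff, Set.mem_ofPred_eq, Set.mem_union, Set.mem_image, Prod.mk.injEq]
    constructor
    · rintro ⟨rfl | h1, rfl | h2, h3⟩
      · exact absurd h3 (G.irrefl _)
      · exact Or.inl (Or.inr ⟨b, ⟨h2, h3⟩, rfl, rfl⟩)
      · exact Or.inr ⟨a, ⟨h1, h3⟩, rfl, rfl⟩
      · exact Or.inl (Or.inl ⟨h1, h2, h3⟩)
    · rintro ((⟨h1, h2, h3⟩ | ⟨w, ⟨h1, h2⟩, rfl, rfl⟩) | ⟨w, ⟨h1, h2⟩, rfl, rfl⟩) <;> simp_all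
  · rw [Set.disjoint_left]
    rintro ⟨a, b⟩ (⟨h1, h2, h3⟩ | ⟨w, ⟨h1, h2⟩, h3⟩) ⟨w', ⟨h4, h5⟩, h6⟩
    · simp only [Prod.mk.injEq] at h6; exact hx (h6.2 ▸ h2)
    · simp only [Prod.mk.injEq] at h3 h6
      exact hx (by rw [h3.1, ← h6.1]; exact h4)
  · rw [Set.disjoint_left]
    rintro ⟨a, b⟩ ⟨h1, h2, h3⟩ ⟨w', ⟨h4, h5⟩, h6⟩
    simp only [Prod.mk.injEq] at h6; exact hx (h6.1 ▸ h1)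

variable {G : Digraph' V} {r : Bool → ℕ} {k : ℕ}

theorem wt_flip (hr : r true + r false = k) 
    (hO : ∀ v, dO G Set.univ v = k) (hI : ∀ v, dI G Set.univ v = k) (c : V → Bool) (x : V) :
    wt G r (flip c x) + k * (dO G {v | c v = c x} x + dI G {v | c v = c x} x)
      = wt G r c + 2 * k * r (c x) := by
  have a1 : {v | flip c x v = c x} = {v | c v = c x} \ {x} := by
    ext v
    by_cases h : v = x
    · subst h; simp [flip_same]
    · simp [flip_ne c h, h]
  have a2 : {v | flip c x v = !(c x)} = insert x {v | c v = !(c x)} := by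
    ext v
    by_cases h : v = x
    · subst h; simp [flip_same]
    · simp [flip_ne c h, h]
  have a3 : {v | c v = c x} = insert x ({v | c v = c x} \ {x}) := by simp
  have b1 := eA_insert (G := G) (S := {v | c v = c x} \ {x}) (x := x) (by simp)
  have b2 := eA_insert (G := G) (S := {v | c v = !(c x)}) (x := x) (by simp)
  have b3 : dO G {v | c v = c x} x = dO G ({v | c v = c x} \ {x}) x := by
    conv_lhs => rw [a3]
    exact dO_insert_not (G.irrefl x)
  have b4 : dI G {v | c v = c x} x = dI G ({v | c v = c x} \ {x}) x := by
    conv_lhs => rw [a3]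
    exact dI_insert_not (G.irrefl x)
  rw [← a3, ← b3, ← b4] at b1
  rw [← a2] at b2
  have hd : Disjoint {v | c v = c x} {v | c v = !(c x)} := by
    rw [Set.disjoint_left]; intro v h1 h2
    have h3 : c x = !(c x) := (show c v = c x from h1).symm.trans h2
    simp at h3
  have hu : {v | c v = c x} ∪ {v | c v = !(c x)} = Set.univ := by
    ext v; cases h1 : c v <;> cases h2 : c x <;> simp [h1]
  have b5 := dO_union (G := G) hd x
  have b6 := dI_union (G := G) hd x
  rw [hu, hO] at b5
  rw [hu, hI] at b6
  rw [← a1] at b1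
  unfold wt
  generalize dO G {v | c v = c x} x = p at *
  generalize dI G {v | c v = c x} x = q at *
  generalize dO G {v | c v = !(c x)} x = p' at *
  generalize dI G {v | c v = !(c x)} x = q' at *
  cases hcx : c x <;> simp only [hcx, Bool.not_true, Bool.not_false] at * <;> rw [b1, b2, ← hr] <;>
    (rw [← hr] at b5 b6; zify at *)
  · have e1 : (p':ℤ) = r true + r false - p := by linarith
    have e2 : (q':ℤ) = r true + r false - q := by linarith
    rw [e1, e2]; ring
  · have e1 : (p':ℤ) = r true + r false - p := by linarith
    have e2 : (q':ℤ) = r true + r false - q := by linarith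
    rw [e1, e2]; ring

structure Hyp (G : Digraph' V) (r : Bool → ℕ) (k : ℕ) : Prop where
  hO : ∀ v, dO G Set.univ v = k
  hI : ∀ v, dI G Set.univ v = k
  hr : r true + r false = k
  pos : ∀ i, 1 ≤ r i
  conn : Conn G Set.univ
  exc : ¬ G.IsException k

theorem Hyp.hr' (H : Hyp G r k) (i : Bool) : r i + r (!i) = k := by
  have := H.hr
  cases i <;> simp <;> omega

theorem Bad.cls {c : V → Bool} {C : Set V} (hC : Bad G r c C) {x : V} (hx : x ∈ C) :
    dO G {v | c v = c x} x = r (c x) ∧ dI G {v | c v = c x} x = r (c x) := by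
  rw [← hC.regO x hx]
  constructor
  · unfold dO; congr 1; ext w
    exact ⟨fun h => ⟨hC.comp.closed x hx w (Or.inl h.2) h.1.symm, h.2⟩,
      fun h => ⟨hC.comp.mono w h.1 x hx, h.2⟩⟩
  · rw [hC.regO x hx, ← hC.regI x hx]
    unfold dI; congr 1; ext w
    exact ⟨fun h => ⟨hC.comp.closed x hx w (Or.inr h.2) h.1.symm, h.2⟩,
      fun h => ⟨hC.comp.mono w h.1 x hx, h.2⟩⟩

theorem Bad.exists_out (H : Hyp G r k) {c : V → Bool} {C : Set V} (hC : Bad G r c C) {x : V}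
    (hx : x ∈ C) : ∃ y ∈ C, y ≠ x ∧ G.Adj x y := by
  have h1 := hC.regO x hx
  have h2 := H.pos (c x)
  rw [← h1] at h2
  obtain ⟨y, hy⟩ := (Set.ncard_pos (Set.toFinite _)).1 h2
  refine ⟨y, hy.1, ?_, hy.2⟩
  rintro rfl
  exact G.irrefl _ hy.2

theorem Bad.comp_diff (H : Hyp G r k) {c : V → Bool} {C : Set V} (hC : Bad G r c C) {x : V}
    (hx : x ∈ C) : IsComp G (NPO.flip c x) (C \ {x}) where
  ne := by
    obtain ⟨y, hy, hne, -⟩ := hC.exists_out H hx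
    exact ⟨y, hy, hne⟩
  mono := fun u hu w hw => by
    rw [flip_ne c hu.2, flip_ne c hw.2]
    exact hC.comp.mono u hu.1 w hw.1
  closed := fun u hu w huw hc => by
    rw [flip_ne c hu.2] at hc
    by_cases hw : w = x
    · subst hw
      rw [flip_same, hC.comp.mono u hu.1 w hx] at hc
      simp at hc
    · rw [flip_ne c hw] at hc
      exact ⟨hC.comp.closed u hu.1 w huw hc, hw⟩
  conn := hC.conn' x hx

theorem normal_flip (H : Hyp G r k) {c : V → Bool} (hN : Normal G r c) {C : Set V}
    (hC : Bad G r c C) {x : V} (hx : x ∈ C) : Normal G r (NPO.flip c x) := by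
  have h := wt_flip H.hr H.hO H.hI c x
  rw [(hC.cls hx).1, (hC.cls hx).2] at h
  have : wt G r (NPO.flip c x) = wt G r c := by nlinarith
  intro c'
  rw [this]; exact hN _

/-- a component of the flipped colouring, not containing `x`, and bad, was bad before -/
theorem bad_back (H : Hyp G r k) {c : V → Bool} {C : Set V}
    (hC : Bad G r c C) {x : V} (hx : x ∈ C) {S : Set V} (hS : Bad G r (NPO.flip c x) S)
    (hxS : x ∉ S) : Bad G r c S ∧ S ≠ C := by
  have hne : ∀ u ∈ S, u ≠ x := by rintro u hu rfl; exact hxS hu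
  have hne' : S ≠ C \ {x} := by
    rintro rfl
    obtain ⟨y, hy, hyx, hadj⟩ := hC.exists_out H hx
    have h1 := hS.regI y ⟨hy, hyx⟩
    have h2 := hC.regI y hy
    have h3 := dI_insert_adj (S := C \ {x}) (by simp) hadj
    rw [Set.insert_sdiff_singleton, Set.insert_eq_of_mem hx] at h3
    rw [flip_ne c hyx] at h1
    omega
  refine ⟨⟨?_, ?_, ?_, hS.conn'⟩, by rintro rfl; exact hxS hx⟩
  · have := hS.comp.flip hxS (by
      intro u hu hux
      rw [flip_same, flip_ne c (hne u hu)]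
      by_contra hcon
      have hcu : c u = c x := by
        cases h1 : c u <;> cases h2 : c x <;> simp_all
      have huC : u ∈ C := hC.comp.closed x hx u (sA_symm hux) hcu.symm
      exact hne' (hS.comp.eq (hC.comp_diff H hx) hu ⟨huC, hne u hu⟩))
    rwa [flip_flip] at this
  · intro v hv
    rw [hS.regO v hv, flip_ne c (hne v hv)]
  · intro v hv
    rw [hS.regI v hv, flip_ne c (hne v hv)]

theorem move (H : Hyp G r k) {c : V → Bool} (hM : M G r c) {C : Set V}
    (hC : Bad G r c C) {x : V} (hx : x ∈ C) :
    M G r (NPO.flip c x) ∧ ∃ D, IsComp G c D ∧ x ∉ D ∧ (∀ d ∈ D, c d = !(c x)) ∧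
      Bad G r (NPO.flip c x) (insert x D) ∧ (∀ w, sA G x w → c w = !(c x) → w ∈ D) := by
  set C' := cp G (NPO.flip c x) x with hC'
  have hN := normal_flip H hM.1 hC hx
  have key : ∀ S, Bad G r (NPO.flip c x) S → S ≠ C' → Bad G r c S ∧ S ≠ C := by
    intro S hS hne
    refine bad_back H hC hx hS ?_
    intro h
    exact hne (cp_eq hS.comp h).symm
  have hbad : Bad G r (NPO.flip c x) C' := by
    by_contra hcon
    have h1 := hM.2 _ hN
    have h2 : {S | Bad G r (NPO.flip c x) S}.ncard < {S | Bad G r c S}.ncard := by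
      refine Set.ncard_lt_ncard ⟨?_, ?_⟩ (Set.toFinite _)
      · intro S hS
        exact (key S hS (by rintro rfl; exact hcon hS)).1
      · intro hsub
        have h3 : Bad G r (NPO.flip c x) C := hsub hC
        exact (key C h3 (by rintro h; rw [h] at h3; exact hcon h3)).2 rfl
    omega
  have hM' : M G r (NPO.flip c x) := by
    refine ⟨hN, fun c' hc' => le_trans ?_ (hM.2 c' hc')⟩
    have h1 : ({S | Bad G r (NPO.flip c x) S} \ {C'}).ncard ≤ ({S | Bad G r c S} \ {C}).ncard :=
      Set.ncard_le_ncard (fun S hS => key S hS.1 hS.2) (Set.toFinite _)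
    have h2 := Set.ncard_sdiff_singleton_add_one (s := {S | Bad G r (NPO.flip c x) S}) (a := C') hbad
      (Set.toFinite _)
    have h3 := Set.ncard_sdiff_singleton_add_one (s := {S | Bad G r c S}) (a := C) hC
      (Set.toFinite _)
    omega
  have hxC' : x ∈ C' := mem_cp _ _ _
  refine ⟨hM', C' \ {x}, ?_, by simp, ?_, ?_, ?_⟩
  · have := hbad.comp_diff H hxC'
    rwa [flip_flip] at this
  · intro d hd
    have := hbad.comp.mono d hd.1 x hxC'
    rwa [flip_same, flip_ne c hd.2] at this
  · rw [Set.insert_sdiff_singleton, Set.insert_eq_of_mem hxC']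
    exact hbad
  · intro w hw hcw
    have hne := (sA_ne hw).symm
    refine ⟨hbad.comp.closed x hxC' w hw ?_, hne⟩
    rw [flip_same, flip_ne c hne, hcw]

/-- `x` attached to component `D` of the other colour -/
theorem move' (H : Hyp G r k) {c : V → Bool} (hM : M G r c) {C : Set V}
    (hC : Bad G r c C) {x : V} (hx : x ∈ C) {D : Set V} (hD : IsComp G c D) {d : V} (hd : d ∈ D)
    (hcd : c d = !(c x)) (hxd : sA G x d) :
    M G r (NPO.flip c x) ∧ x ∉ D ∧ Bad G r (NPO.flip c x) (insert x D) ∧ 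
      (∀ w, sA G x w → c w = !(c x) → w ∈ D) := by
  obtain ⟨h1, E, h2, h3, h4, h5, h6⟩ := move H hM hC hx
  have : E = D := h2.eq hD (h6 d hxd hcd) hd
  subst this
  exact ⟨h1, h3, h5, h6⟩

theorem twin1 (H : Hyp G r k) {c : V → Bool} (hM : M G r c) {C : Set V}
    (hC : Bad G r c C) {x : V} (hx : x ∈ C) {D : Set V} (hD : IsComp G c D) {d : V} (hd : d ∈ D)
    (hcd : c d = !(c x)) (hxd : sA G x d) : ∀ d ∈ D,
    (G.Adj x d ↔ dI G D d ≠ r (!(c x))) ∧ (G.Adj d x ↔ dO G D d ≠ r (!(c x))) := by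
  obtain ⟨h1, h2, h3, h4⟩ := move' H hM hC hx hD hd hcd hxd
  intro e he
  have hex : e ≠ x := by rintro rfl; exact h2 he
  have h5 := h3.regO e (Or.inr he)
  have h6 := h3.regI e (Or.inr he)
  have hce : c e = !(c x) := by rw [hD.mono e he d hd, hcd]
  rw [flip_ne c hex, hce] at h5 h6
  constructor
  · by_cases h : G.Adj x e
    · rw [dI_insert_adj h2 h] at h6
      simp only [h, true_iff]; omega
    · rw [dI_insert_not h] at h6
      simp only [h, false_iff]; omega
  · by_cases h : G.Adj e x
    · rw [dO_insert_adj h2 h] at h5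
      simp only [h, true_iff]; omega
    · rw [dO_insert_not h] at h5
      simp only [h, false_iff]; omega

theorem twin (H : Hyp G r k) {c : V → Bool} (hM : M G r c) {C : Set V}
    (hC : Bad G r c C) {x y : V} (hx : x ∈ C) (hy : y ∈ C) {D : Set V} (hD : IsComp G c D)
    {d e : V} (hd : d ∈ D) (he : e ∈ D)
    (hcd : c d = !(c x)) (hxd : sA G x d) (hye : sA G y e) : ∀ d ∈ D,
    (G.Adj x d ↔ G.Adj y d) ∧ (G.Adj d x ↔ G.Adj d y) := by
  have hxy := hC.comp.mono x hx y hy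
  intro f hf
  have h1 := twin1 H hM hC hx hD hd hcd hxd f hf
  have h2 := twin1 H hM hC hy hD he (by rw [hD.mono e he d hd, hcd, hxy]) hye f hf
  rw [← hxy] at h2
  rw [h1.1, h1.2, h2.1, h2.2]
  exact ⟨Iff.rfl, Iff.rfl⟩

/-- sharing configuration: everything attached and `C` complete -/
theorem share1 (H : Hyp G r k) {c : V → Bool} (hM : M G r c) {C : Set V}
    (hC : Bad G r c C) {x y : V} (hx : x ∈ C) (hy : y ∈ C) (hxy : x ≠ y) {D : Set V}
    (hD : IsComp G c D) {d e : V} (hd : d ∈ D) (he : e ∈ D)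
    (hcd : c d = !(c x)) (hxd : sA G x d) (hye : sA G y e) :
    (∀ w ∈ C, ∃ f ∈ D, sA G w f) ∧ C.ncard = r (c x) + 1 ∧
      (∀ u ∈ C, ∀ w ∈ C, u ≠ w → G.Adj u w) := by
  have hcol : ∀ u ∈ C, ∀ f ∈ D, c f = !(c u) := by
    intro u hu f hf
    rw [hD.mono f hf d hd, hcd, hC.comp.mono x hx u hu]
  have hatt : ∀ w ∈ C, ∃ f ∈ D, sA G w f := by
    have := hC.comp.conn {w | ∃ f ∈ D, sA G w f} ⟨x, hx, d, hd, hxd⟩ ?_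
    · exact this
    · rintro w hw ⟨z, hz, hwz⟩ u hu hwu
      -- another attached vertex
      have : ∃ w' ∈ C, w' ≠ w ∧ ∃ f ∈ D, sA G w' f := by
        by_cases h : x = w
        · exact ⟨y, hy, by rw [← h]; exact hxy.symm, e, he, hye⟩
        · exact ⟨x, hx, h, d, hd, hxd⟩
      obtain ⟨w', hw', hne, f, hf, hwf⟩ := this
      have t1 := twin H hM hC hw hw' hD hz hf (hcol w hw z hz) hwz hwf z hz
      have hw'z : sA G w' z := by
        rcases hwz with h | h
        · exact Or.inl (t1.1.1 h)
        · exact Or.inr (t1.2.1 h)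
      obtain ⟨m1, m2, m3, m4⟩ := move' H hM hC hw hD hz (hcol w hw z hz) hwz
      have huw := (sA_ne hwu).symm
      have t2 := twin H m1 m3 (x := w) (y := z) (Or.inl rfl) (Or.inr hz)
        (hC.comp_diff H hw) (d := u) (e := w') ⟨hu, huw⟩ ⟨hw', hne⟩
        (by rw [flip_same, flip_ne c huw, hC.comp.mono u hu w hw]; simp) hwu (sA_symm hw'z)
        u ⟨hu, huw⟩
      refine ⟨z, hz, ?_⟩
      rcases hwu with h | h
      · exact Or.inr (t2.1.1 h)
      · exact Or.inl (t2.2.1 h)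
  obtain ⟨m1, m2, m3, m4⟩ := move' H hM hC hx hD hd hcd hxd
  have hcard : C.ncard ≤ r (c x) + 1 := by
    -- an out-neighbour z of x in D
    obtain ⟨z, hz, hzx, hxz⟩ := m3.exists_out H (Or.inl rfl : x ∈ insert x D)
    have hzD : z ∈ D := by
      rcases hz with h | h
      · exact absurd h hzx
      · exact h
    have hin : ∀ w ∈ C, G.Adj w z := by
      intro w hw
      obtain ⟨f, hf, hwf⟩ := hatt w hw
      exact (twin H hM hC hx hw hD hd hf hcd hxd hwf z hzD).1.1 hxz
    have h1 := m3.regI z (Or.inr hzD)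
    rw [flip_ne c hzx, hcol x hx z hzD] at h1
    have hdis : Disjoint (insert x D) (C \ {x}) := by
      rw [Set.disjoint_left]
      rintro u (rfl | hu) ⟨hu1, hu2⟩
      · exact hu2 rfl
      · have := hcol u hu1 u hu; simp at this
    have h2 := dI_union (G := G) hdis z
    have h3 := dI_mono G (Set.subset_univ (insert x D ∪ C \ {x})) z
    rw [H.hI, h2, h1] at h3
    have h4 : dI G (C \ {x}) z = (C \ {x}).ncard := by
      unfold dI; congr 1; ext w
      exact ⟨fun h => h.1, fun h => ⟨h, hin w h.1⟩⟩
    have h5 := Set.ncard_sdiff_singleton_add_one hx (Set.toFinite _)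
    have := H.hr' (c x)
    omega
  have hful : ∀ u ∈ C, {w | w ∈ C ∧ G.Adj u w} = C \ {u} := by
    intro u hu
    refine Set.eq_of_subset_of_ncard_le ?_ ?_ (Set.toFinite _)
    · rintro w ⟨h1, h2⟩
      exact ⟨h1, by rintro rfl; exact G.irrefl _ h2⟩
    · have h1 := hC.regO u hu
      unfold dO at h1
      rw [h1, hC.comp.mono u hu x hx]
      have h5 := Set.ncard_sdiff_singleton_add_one hu (Set.toFinite _)
      omega
  refine ⟨hatt, ?_, ?_⟩
  · have h1 := hC.regO x hx
    unfold dO at h1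
    rw [hful x hx] at h1
    have h5 := Set.ncard_sdiff_singleton_add_one hx (Set.toFinite _)
    omega
  · intro u hu w hw hne
    have : w ∈ {w | w ∈ C ∧ G.Adj u w} := by rw [hful u hu]; exact ⟨hw, hne.symm⟩
    exact this.2

theorem complete_false (H : Hyp G r k) (h2k : 2 ≤ k) {K : Set V} (hcard : K.ncard = k + 1)
    (hK : ∀ u ∈ K, ∀ w ∈ K, u ≠ w → G.Adj u w) : False := by
  have hful : ∀ u ∈ K, K \ {u} = {w | w ∈ Set.univ ∧ G.Adj u w} := by
    intro u hu
    refine Set.eq_of_subset_of_ncard_le ?_ ?_ (Set.toFinite _)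
    · rintro w ⟨h1, h2⟩
      exact ⟨trivial, hK u hu w h1 (Ne.symm h2)⟩
    · have h1 := H.hO u
      unfold dO at h1
      rw [h1]
      have h5 := Set.ncard_sdiff_singleton_add_one hu (Set.toFinite _)
      omega
  have hful' : ∀ u ∈ K, K \ {u} = {w | w ∈ Set.univ ∧ G.Adj w u} := by
    intro u hu
    refine Set.eq_of_subset_of_ncard_le ?_ ?_ (Set.toFinite _)
    · rintro w ⟨h1, h2⟩
      exact ⟨trivial, hK w h1 u hu h2⟩
    · have h1 := H.hI u
      unfold dI at h1
      rw [h1]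
      have h5 := Set.ncard_sdiff_singleton_add_one hu (Set.toFinite _)
      omega
  have hne : K.Nonempty := by
    rw [← Set.ncard_pos (Set.toFinite _)]; omega
  obtain ⟨x, hx⟩ := hne
  have hall : Set.univ ⊆ K := by
    refine H.conn K ⟨x, trivial, hx⟩ ?_
    intro u _ hu w _ huw
    rcases huw with h | h
    · have : w ∈ K \ {u} := by rw [hful u hu]; exact ⟨trivial, h⟩
      exact this.1
    · have : w ∈ K \ {u} := by rw [hful' u hu]; exact ⟨trivial, h⟩
      exact this.1
  have hcomp : G.IsSymmetricComplete := by
    intro u w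
    constructor
    · rintro h rfl; exact G.irrefl _ h
    · exact fun h => hK u (hall trivial) w (hall trivial) h
  have hKu : K = Set.univ := Set.eq_univ_of_univ_subset hall
  rw [hKu, Set.ncard_univ] at hcard
  apply H.exc
  by_cases h3 : 3 ≤ k
  · exact Or.inr (Or.inr ⟨h3, hcomp, hcard⟩)
  · have hk : k = 2 := by omega
    refine Or.inr (Or.inl ⟨hk, 3, le_refl _, by decide, ?_⟩)
    have e : V ≃ ZMod 3 := by
      refine (Finite.equivFinOfCardEq (n := 3) (by omega)).trans ?_
      exact Equiv.refl (Fin 3)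
    refine ⟨e, fun u w => ?_⟩
    rw [hcomp u w, ← e.injective.ne_iff]
    generalize e u = a
    generalize e w = b
    revert a b
    decide

theorem share_false (H : Hyp G r k) (h2k : 2 ≤ k) {c : V → Bool} (hM : M G r c) {C : Set V}
    (hC : Bad G r c C) {x y : V} (hx : x ∈ C) (hy : y ∈ C) (hxy : x ≠ y) {D : Set V}
    (hD : IsComp G c D) {d e : V} (hd : d ∈ D) (he : e ∈ D)
    (hcd : c d = !(c x)) (hxd : sA G x d) (hye : sA G y e) : False := by
  obtain ⟨s1, s2, s3⟩ := share1 H hM hC hx hy hxy hD hd he hcd hxd hye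
  obtain ⟨m1, m2, m3, m4⟩ := move' H hM hC hx hD hd hcd hxd
  have hcol : ∀ u ∈ C, ∀ f ∈ D, c f = !(c u) := by
    intro u hu f hf
    rw [hD.mono f hf d hd, hcd, hC.comp.mono x hx u hu]
  obtain ⟨t1, t2, t3⟩ := share1 H m1 m3 (x := x) (y := e) (Or.inl rfl) (Or.inr he)
    (by rintro rfl; exact m2 he) (hC.comp_diff H hx) (d := y) (e := y) ⟨hy, hxy.symm⟩
    ⟨hy, hxy.symm⟩ (by rw [flip_same, flip_ne c hxy.symm, hC.comp.mono y hy x hx]; simp)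
    (Or.inl (s3 x hx y hy hxy)) (sA_symm hye)
  rw [flip_same, Set.ncard_insert_of_notMem m2 (Set.toFinite _)] at t2
  have hdis : Disjoint C D := by
    rw [Set.disjoint_left]
    intro u h1 h2
    have := hcol u h1 u h2; simp at this
  have hCD : ∀ u ∈ C, ∀ f ∈ D, G.Adj u f ∧ G.Adj f u := by
    intro u hu f hf
    obtain ⟨g, hg, hug⟩ := s1 u hu
    have t := twin H hM hC hx hu hD hd hg hcd hxd hug f hf
    have hxf : x ≠ f := by rintro rfl; exact m2 hf
    exact ⟨t.1.1 (t3 x (Or.inl rfl) f (Or.inr hf) hxf),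
      t.2.1 (t3 f (Or.inr hf) x (Or.inl rfl) hxf.symm)⟩
  refine complete_false H h2k (K := C ∪ D) ?_ ?_
  · rw [Set.ncard_union_eq hdis (Set.toFinite _) (Set.toFinite _)]
    have := H.hr' (c x)
    omega
  · rintro u (hu | hu) w (hw | hw) hne
    · exact s3 u hu w hw hne
    · exact (hCD u hu w hw).1
    · exact (hCD w hw u hu).2
    · exact t3 u (Or.inr hu) w (Or.inr hw) hne

theorem cycle_false (H : Hyp G r 2) {n : ℕ} (hn : 3 ≤ n) (hodd : Odd n) (z : ℕ → V)
    (hinj : ∀ i j, i < j → j < n → z i ≠ z j)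
    (hadj : ∀ i, i + 1 < n → G.Adj (z i) (z (i + 1)) ∧ G.Adj (z (i + 1)) (z i))
    (hlast : G.Adj (z (n - 1)) (z 0) ∧ G.Adj (z 0) (z (n - 1))) : False := by
  have : NeZero n := ⟨by omega⟩
  set g : ZMod n → V := fun i => z i.val with hg
  have ginj : Function.Injective g := by
    intro i j hij
    apply ZMod.val_injective n
    rcases lt_trichotomy i.val j.val with h | h | h
    · exact absurd hij (hinj _ _ h (ZMod.val_lt j))
    · exact h
    · exact absurd hij.symm (hinj _ _ h (ZMod.val_lt i))
  have gadj : ∀ i, G.Adj (g i) (g (i + 1)) ∧ G.Adj (g (i + 1)) (g i) := by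
    intro i
    have hi := ZMod.val_lt i
    have e1 : i + 1 = ((i.val + 1 : ℕ) : ZMod n) := by
      push_cast; rw [ZMod.natCast_zmod_val]
    by_cases h : i.val + 1 < n
    · have e2 : (i + 1).val = i.val + 1 := by rw [e1, ZMod.val_natCast_of_lt h]
      simp only [hg, e2]
      exact hadj _ h
    · have e3 : i.val + 1 = n := by omega
      have e2 : (i + 1).val = 0 := by rw [e1, e3]; simp
      have e4 : i.val = n - 1 := by omega
      simp only [hg, e2, e4]
      exact hlast
  have hne : ∀ i : ZMod n, i + 1 ≠ i - 1 := by
    intro i h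
    have h2 : ((2 : ℕ) : ZMod n) = 0 := by
      push_cast
      have : (2 : ZMod n) = (i + 1) - (i - 1) := by ring
      rw [this, h, sub_self]
    have := congrArg ZMod.val h2
    rw [ZMod.val_natCast_of_lt (by omega)] at this
    simp at this
  have hout : ∀ i, {g (i + 1), g (i - 1)} = {w | w ∈ Set.univ ∧ G.Adj (g i) w} := by
    intro i
    refine Set.eq_of_subset_of_ncard_le ?_ ?_ (Set.toFinite _)
    · rintro w (rfl | rfl)
      · exact ⟨trivial, (gadj i).1⟩
      · have := (gadj (i - 1)).2
        rw [sub_add_cancel] at this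
        exact ⟨trivial, this⟩
    · rw [Set.ncard_pair (fun h => hne i (ginj h))]
      exact (H.hO (g i)).le
  have hin : ∀ i, {g (i + 1), g (i - 1)} = {w | w ∈ Set.univ ∧ G.Adj w (g i)} := by
    intro i
    refine Set.eq_of_subset_of_ncard_le ?_ ?_ (Set.toFinite _)
    · rintro w (rfl | rfl)
      · exact ⟨trivial, (gadj i).2⟩
      · have := (gadj (i - 1)).1
        rw [sub_add_cancel] at this
        exact ⟨trivial, this⟩
    · rw [Set.ncard_pair (fun h => hne i (ginj h))]
      exact (H.hI (g i)).le
  have hsurj : Function.Surjective g := by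
    have : Set.univ ⊆ Set.range g := by
      refine H.conn _ ⟨g 0, trivial, 0, rfl⟩ ?_
      rintro _ - ⟨i, rfl⟩ w - hw
      have hw' : w ∈ ({g (i + 1), g (i - 1)} : Set V) := by
        rcases hw with h | h
        · rw [hout]; exact ⟨trivial, h⟩
        · rw [hin]; exact ⟨trivial, h⟩
      rcases hw' with rfl | rfl
      · exact ⟨_, rfl⟩
      · exact ⟨_, rfl⟩
    exact fun w => this trivial
  apply H.exc
  refine Or.inr (Or.inl ⟨rfl, n, hn, hodd, (Equiv.ofBijective g ⟨ginj, hsurj⟩).symm, ?_⟩)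
  intro u w
  obtain ⟨i, rfl⟩ := hsurj u
  obtain ⟨j, rfl⟩ := hsurj w
  have e : ∀ i, (Equiv.ofBijective g ⟨ginj, hsurj⟩).symm (g i) = i := fun i =>
    (Equiv.ofBijective g ⟨ginj, hsurj⟩).symm_apply_apply i
  rw [e, e]
  have : G.Adj (g i) (g j) ↔ g j ∈ ({g (i + 1), g (i - 1)} : Set V) := by
    rw [hout]; exact ⟨fun h => ⟨trivial, h⟩, fun h => h.2⟩
  rw [this, Set.mem_insert_iff, Set.mem_singleton_iff, ginj.eq_iff, ginj.eq_iff]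
  constructor
  · rintro (h | h)
    · exact Or.inl h
    · right; rw [h]; ring
  · rintro (h | h)
    · exact Or.inl h
    · right; rw [h]; ring

theorem digon_eq {c : V → Bool} {C : Set V} (hC : Bad G r c C) {a b : V} (ha : a ∈ C) (hb : b ∈ C)
    (hr1 : ∀ i, r i = 1) (hab : G.Adj a b) (hba : G.Adj b a) : C = {a, b} := by
  have huO : ∀ u ∈ C, ∀ v ∈ C, ∀ w ∈ C, G.Adj u v → G.Adj u w → w = v := by
    intro u hu v hv w hw h1 h2
    have h := hC.regO u hu
    rw [hr1] at h
    obtain ⟨q, hq⟩ := Set.ncard_eq_one.1 h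
    have e1 : v ∈ ({q} : Set V) := by rw [← hq]; exact ⟨hv, h1⟩
    have e2 : w ∈ ({q} : Set V) := by rw [← hq]; exact ⟨hw, h2⟩
    rw [e1, e2]
  have huI : ∀ u ∈ C, ∀ v ∈ C, ∀ w ∈ C, G.Adj v u → G.Adj w u → w = v := by
    intro u hu v hv w hw h1 h2
    have h := hC.regI u hu
    rw [hr1] at h
    obtain ⟨q, hq⟩ := Set.ncard_eq_one.1 h
    have e1 : v ∈ ({q} : Set V) := by rw [← hq]; exact ⟨hv, h1⟩
    have e2 : w ∈ ({q} : Set V) := by rw [← hq]; exact ⟨hw, h2⟩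
    rw [e1, e2]
  apply Set.Subset.antisymm
  · refine hC.comp.conn _ ⟨a, ha, Or.inl rfl⟩ ?_
    rintro u hu (rfl | rfl) w hw (h | h)
    · exact Or.inr (huO u hu b hb w hw hab h)
    · exact Or.inr (huI u hu b hb w hw hba h)
    · exact Or.inl (huO u hu a ha w hw hba h)
    · exact Or.inl (huI u hu a ha w hw hab h)
  · rintro u (rfl | rfl) <;> assumption

theorem pair_adj (H : Hyp G r k) {c : V → Bool} {a b : V} (hC : Bad G r c {a, b}) :
    G.Adj a b ∧ G.Adj b a := by
  constructor
  · obtain ⟨y, hy, hne, h⟩ := hC.exists_out H (Or.inl rfl : a ∈ ({a, b} : Set V))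
    rcases hy with rfl | rfl
    · exact absurd rfl hne
    · exact h
  · obtain ⟨y, hy, hne, h⟩ := hC.exists_out H (Or.inr rfl : b ∈ ({a, b} : Set V))
    rcases hy with rfl | rfl
    · exact h
    · exact absurd rfl hne

theorem step_inv {c : V → Bool} {S K : Set V} {x : V} (hS : IsComp G c S) (hx : x ∉ S)
    (hK : IsComp G (NPO.flip c x) K) (hxK : x ∈ K) (hd : ∀ u ∈ S, u ∉ K) :
    IsComp G (NPO.flip c x) S ∧ ∀ u ∈ S, NPO.flip c x u = c u := by
  have hne : ∀ u ∈ S, u ≠ x := by rintro u hu rfl; exact hx hu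
  refine ⟨hS.flip hx ?_, fun u hu => flip_ne c (hne u hu)⟩
  intro u hu hux
  by_contra hcon
  apply hd u hu
  refine hK.closed x hxK u (sA_symm hux) ?_
  rw [flip_same, flip_ne c (hne u hu)]
  cases h1 : c u <;> cases h2 : c x <;> simp_all

structure Walk (G : Digraph' V) (r : Bool → ℕ) (c : ℕ → V → Bool) (x : ℕ → V) : Prop where
  hM : ∀ n, M G r (c n)
  hB : ∀ n, Bad G r (c n) (cp G (c n) (x n))
  hc : ∀ n, c (n + 1) = NPO.flip (c n) (x n)
  hx : ∀ n, x (n + 1) ∈ cp G (c (n + 1)) (x n)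
  hne : ∀ n, x (n + 1) ≠ x n

theorem exists_walk (H : Hyp G r k) {c : V → Bool} (hM : M G r c) {C : Set V}
    (hC : Bad G r c C) : ∃ c x, Walk G r c x := by
  obtain ⟨x, hx⟩ := hC.comp.ne
  let T := {p : (V → Bool) × V // M G r p.1 ∧ Bad G r p.1 (cp G p.1 p.2)}
  have next : ∀ p : T, ∃ q : T, q.1.1 = NPO.flip p.1.1 p.1.2 ∧ q.1.2 ∈ cp G q.1.1 p.1.2 ∧
      q.1.2 ≠ p.1.2 := by
    rintro ⟨⟨c, x⟩, hM, hB⟩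
    dsimp only at hM hB ⊢
    obtain ⟨m1, D, m2, m3, m4, m5, m6⟩ := move H hM hB (mem_cp G c x)
    obtain ⟨y, hy⟩ := m2.ne
    refine ⟨⟨⟨NPO.flip c x, y⟩, m1, ?_⟩, rfl, ?_, ?_⟩
    · dsimp only
      rw [cp_eq m5.comp (Or.inr hy)]; exact m5
    · dsimp only
      rw [cp_eq m5.comp (Or.inl rfl)]; exact Or.inr hy
    · intro h; exact m3 ((show y = x from h) ▸ hy)
  choose f hf using next
  let s : ℕ → T := fun n => f^[n] ⟨⟨c, x⟩, hM, by rw [cp_eq hC.comp hx]; exact hC⟩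
  have hs : ∀ n, s (n + 1) = f (s n) := fun n => Function.iterate_succ_apply' f n _
  refine ⟨fun n => (s n).1.1, fun n => (s n).1.2, ⟨fun n => (s n).2.1, fun n => (s n).2.2, ?_, ?_, ?_⟩⟩
  · intro n; rw [hs]; exact (hf _).1
  · intro n; rw [hs]; exact (hf _).2.1
  · intro n; rw [hs]; exact (hf _).2.2

section walk
variable {c : ℕ → V → Bool} {x : ℕ → V}

/-- leftover -/
def F (G : Digraph' V) (c : ℕ → V → Bool) (x : ℕ → V) (n : ℕ) : Set V := cp G (c n) (x n) \ {x n}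
/-- new bad component -/
def E (G : Digraph' V) (c : ℕ → V → Bool) (x : ℕ → V) (n : ℕ) : Set V := cp G (c (n + 1)) (x n)

theorem Walk.E_eq (W : Walk G r c x) (n : ℕ) : cp G (c (n + 1)) (x (n + 1)) = E G c x n :=
  cp_eq (cp_isComp _ _ _) (W.hx n)

theorem Walk.E_bad (W : Walk G r c x) (n : ℕ) : Bad G r (c (n + 1)) (E G c x n) := by
  rw [← W.E_eq]; exact W.hB _

theorem Walk.mem_E (W : Walk G r c x) (n : ℕ) : x n ∈ E G c x n := mem_cp _ _ _

theorem Walk.F_succ (W : Walk G r c x) (n : ℕ) : F G c x (n + 1) = E G c x n \ {x (n + 1)} := by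
  unfold F; rw [W.E_eq]

theorem Walk.mem_F_succ (W : Walk G r c x) (n : ℕ) : x n ∈ F G c x (n + 1) := by
  rw [W.F_succ]; exact ⟨W.mem_E n, (W.hne n).symm⟩

theorem Walk.comp_E (H : Hyp G r k) (W : Walk G r c x) (n : ℕ) :
    IsComp G (c n) (E G c x n \ {x n}) := by
  have := (W.E_bad n).comp_diff H (W.mem_E n)
  rwa [W.hc, flip_flip] at this

theorem Walk.comp_F (H : Hyp G r k) (W : Walk G r c x) (n : ℕ) :
    IsComp G (c (n + 1)) (F G c x n) := by
  have := (W.hB n).comp_diff H (mem_cp _ _ _)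
  rwa [← W.hc] at this

theorem Walk.c_same (W : Walk G r c x) (n : ℕ) : c (n + 1) (x n) = !(c n (x n)) := by
  rw [W.hc, flip_same]
theorem Walk.c_ne (W : Walk G r c x) (n : ℕ) {u : V} (h : u ≠ x n) : c (n + 1) u = c n u := by
  rw [W.hc, flip_ne _ h]

theorem Walk.col_E (W : Walk G r c x) (n : ℕ) {u : V} (h : u ∈ E G c x n) :
    c (n + 1) u = !(c n (x n)) := by rw [← W.c_same]; exact cp_col h

theorem Walk.col_succ (W : Walk G r c x) (n : ℕ) : c (n + 1) (x (n + 1)) = !(c n (x n)) :=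
  W.col_E n (W.hx n)

theorem Walk.col_F (W : Walk G r c x) (n : ℕ) {u : V} (h : u ∈ F G c x n) :
    c (n + 1) u = c n (x n) := by rw [W.c_ne n h.2]; exact cp_col h.1

theorem Walk.inv (H : Hyp G r k) (W : Walk G r c x) {t : ℕ}
    (hno : ∀ n, n < t → ∀ s, s ≤ n → ∀ u ∈ F G c x s, u ∉ E G c x n) :
    ∀ n s, s < n → n ≤ t → x n ∉ F G c x s ∧ IsComp G (c n) (F G c x s) ∧
      ∀ u ∈ F G c x s, c n u = c s (x s) := by
  intro n
  induction n with
  | zero => intro s hs; omega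
  | succ n ih =>
    intro s hs hn
    refine ⟨fun h => hno n (by omega) s (by omega) _ h (W.hx n), ?_⟩
    rcases Nat.lt_or_ge s n with h | h
    · obtain ⟨i1, i2, i3⟩ := ih s h (by omega)
      have hE := (W.E_bad n).comp
      rw [W.hc] at hE
      obtain ⟨j1, j2⟩ := step_inv i2 i1 hE (W.mem_E n) (hno n (by omega) s (by omega))
      rw [← W.hc] at j1 j2
      exact ⟨j1, fun u hu => by rw [j2 u hu, i3 u hu]⟩
    · have : s = n := by omega
      subst this
      exact ⟨W.comp_F H s, fun u hu => W.col_F s hu⟩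

theorem Walk.exists_hit (H : Hyp G r k) (W : Walk G r c x) :
    ∃ n, ∃ s, s ≤ n ∧ ∃ u ∈ F G c x s, u ∈ E G c x n := by
  by_contra hcon
  push Not at hcon
  have hinj : Function.Injective x := by
    have key : ∀ i j, i < j → x i ≠ x j := by
      intro i j hij h
      rcases Nat.lt_or_ge (i + 1) j with h1 | h1
      · have := (W.inv H (t := j) (fun n _ s hs u hu => hcon n s hs u hu) j (i + 1) h1 le_rfl).1
        rw [← h] at this
        exact this (W.mem_F_succ i)
      · have : j = i + 1 := by omega
        subst this
        exact W.hne i h.symm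
    intro i j hij
    rcases lt_trichotomy i j with h | h | h
    · exact absurd hij (key i j h)
    · exact h
    · exact absurd hij.symm (key j i h)
  exact not_injective_infinite_finite x hinj

theorem Walk.ns (H : Hyp G r k) (h2k : 2 ≤ k) (W : Walk G r c x) (s : ℕ) {y f : V}
    (hy : y ∈ F G c x s) (hf : f ∈ E G c x s) (hfx : f ≠ x s) : ¬ sA G y f := by
  intro hyf
  obtain ⟨d, hd, hdx, hxd⟩ := (W.E_bad s).exists_out H (W.mem_E s)
  refine share_false H h2k (W.hM s) (W.hB s) (mem_cp _ _ _) hy.1 (Ne.symm hy.2) (W.comp_E H s)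
    (d := d) (e := f) ⟨hd, hdx⟩ ⟨hf, hfx⟩ ?_ (Or.inl hxd) hyf
  rw [← W.c_ne s hdx, W.col_E s hd]

theorem Walk.col_parity (W : Walk G r c x) (s m : ℕ) :
    c (s + m) (x (s + m)) = if Even m then c s (x s) else !(c s (x s)) := by
  induction m with
  | zero => simp
  | succ m ih =>
    rw [← Nat.add_assoc, W.col_succ, ih]
    by_cases h : Even m <;> simp [h, Nat.even_add_one]

theorem Walk.hit_false (H : Hyp G r k) (h2k : 2 ≤ k) (W : Walk G r c x) {s t : ℕ}
    (hno : ∀ n, n < t → ∀ s, s ≤ n → ∀ u ∈ F G c x s, u ∉ E G c x n)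
    (hst : s ≤ t) {u : V} (hu : u ∈ F G c x s) (huE : u ∈ E G c x t) : False := by
  have inv := W.inv H hno
  -- s < t
  have hst1 : s < t := by
    rcases Nat.lt_or_ge s t with h | h
    · exact h
    · have : s = t := by omega
      subst this
      have h1 := W.col_E s huE
      rw [W.col_F s hu] at h1
      simp at h1
  have hxt : ∀ l, l ≤ t → x t ∉ F G c x l := by
    intro l hl
    rcases Nat.lt_or_ge l t with h | h
    · exact (inv t l h le_rfl).1
    · have : l = t := by omega
      subst this
      exact fun h => h.2 rfl
  obtain ⟨-, iF, iFc⟩ := inv t s hst1 le_rfl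
  have hut : u ≠ x t := by rintro rfl; exact hxt s hst hu
  have hEF : E G c x t \ {x t} = F G c x s := (W.comp_E H t).eq iF ⟨huE, hut⟩ hu
  have hEF' : E G c x t = insert (x t) (F G c x s) := by
    rw [← hEF, Set.insert_sdiff_singleton, Set.insert_eq_of_mem (W.mem_E t)]
  have hcolt : c t (x t) = !(c s (x s)) := by
    have h1 := W.col_E t huE
    rw [W.c_ne t hut, iFc u hu] at h1
    rw [h1]; simp
  -- s + 1 < t
  have hst2 : s + 1 < t := by
    rcases Nat.lt_or_ge (s + 1) t with h | h
    · exact h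
    · exfalso
      have : t = s + 1 := by omega
      subst this
      obtain ⟨y, hy, hyx, hxy⟩ := (W.E_bad (s + 1)).exists_out H (W.mem_E (s + 1))
      have hyF : y ∈ F G c x s := by rw [← hEF]; exact ⟨hy, hyx⟩
      exact W.ns H h2k s hyF (W.hx s) (W.hne s) (Or.inr hxy)
  -- disjointness of leftovers
  have hnotin : ∀ l l', l < l' → l' ≤ t → x (l' - 1) ∉ F G c x l := by
    intro l l' h1 h2
    rcases Nat.lt_or_ge l (l' - 1) with h | h
    · exact (inv (l' - 1) l h (by omega)).1
    · have : l' - 1 = l := by omega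
      rw [this]
      exact fun h => h.2 rfl
  have hmem : ∀ l', 0 < l' → x (l' - 1) ∈ F G c x l' := by
    intro l' h
    obtain ⟨m, rfl⟩ : ∃ m, l' = m + 1 := ⟨l' - 1, by omega⟩
    exact W.mem_F_succ m
  have hdisj : ∀ l l', l < l' → l' ≤ t → ∀ v ∈ F G c x l, v ∉ F G c x l' := by
    intro l l' h1 h2 v hv hv'
    -- both are components of c l'
    rcases Nat.lt_or_ge l' t with h | h
    · have := (inv t l (by omega) le_rfl).2.1.eq (inv t l' h le_rfl).2.1 hv hv'
      apply hnotin l l' h1 h2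
      rw [this]
      exact hmem l' (by omega)
    · have hlt : l' = t := by omega
      subst hlt
      have h3 := (inv l' l h1 le_rfl).2.1
      obtain ⟨m, rfl⟩ : ∃ m, l' = m + 1 := ⟨l' - 1, by omega⟩
      have h4 := (W.hB (m + 1)).comp
      have h5 := h3.eq h4 hv hv'.1
      exact hnotin l (m + 1) h1 h2 (by rw [h5]; exact (hmem (m + 1) (by omega)).1)
  -- all leftovers other than F s are components of c (t+1)
  have hfam : ∀ l, s < l → l ≤ t → IsComp G (c (t + 1)) (F G c x l) ∧
      ∀ v ∈ F G c x l, c (t + 1) v = c l (x l) := by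
    intro l h1 h2
    rcases Nat.lt_or_ge l t with h | h
    · obtain ⟨i1, i2, i3⟩ := inv t l h le_rfl
      have hE := (W.E_bad t).comp
      rw [W.hc] at hE
      obtain ⟨j1, j2⟩ := step_inv i2 i1 hE (W.mem_E t) (by
        intro v hv hvE
        rw [hEF'] at hvE
        rcases hvE with rfl | hvE
        · exact i1 hv
        · exact hdisj s l h1 h2 v hvE hv)
      rw [← W.hc] at j1 j2
      exact ⟨j1, fun v hv => by rw [j2 v hv, i3 v hv]⟩
    · have : l = t := by omega
      subst this
      exact ⟨W.comp_F H l, fun v hv => W.col_F l hv⟩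
  have hcolE : ∀ v ∈ E G c x t, c (t + 1) v = c s (x s) := by
    intro v hv
    rw [W.col_E t hv, hcolt]; simp
  obtain ⟨fam1, fam1c⟩ := hfam (s + 1) (by omega) (by omega)
  have hxs : x s ∈ F G c x (s + 1) := W.mem_F_succ s
  have hFE : ∀ v ∈ F G c x s, v ∈ E G c x t := by
    intro v hv; rw [hEF']; exact Or.inr hv
  have hopp : ∀ v ∈ F G c x s, c (t + 1) (x s) = !(c (t + 1) v) := by
    intro v hv
    rw [fam1c _ hxs, W.col_succ, hcolE v (hFE v hv)]
  -- the vertex y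
  obtain ⟨y, hyC, hyx, hxy⟩ := (W.hB s).exists_out H (mem_cp _ _ _)
  have hy : y ∈ F G c x s := ⟨hyC, hyx⟩
  obtain ⟨m1, m2, m3, m4⟩ := move' H (W.hM (t + 1)) (W.E_bad t) (hFE y hy) fam1 hxs (hopp y hy)
    (Or.inr hxy)
  have honly : ∀ w ∈ insert y (F G c x (s + 1)), sA G y w → w = x s := by
    rintro w (rfl | hw) hyw
    · exact absurd rfl (sA_ne hyw)
    · by_contra hne
      rw [W.F_succ] at hw
      exact W.ns H h2k s hy hw.1 hne hyw
  obtain ⟨z, hz, -, hyz⟩ := m3.exists_out H (Or.inl rfl)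
  have hzx := honly z hz (Or.inl hyz)
  subst hzx
  -- r j = 1
  have hrj : r (!(c s (x s))) = 1 := by
    have h1 := m3.regO y (Or.inl rfl)
    rw [flip_same, hcolE y (hFE y hy)] at h1
    rw [← h1]
    refine Set.ncard_eq_one.2 ⟨x s, ?_⟩
    ext w
    constructor
    · rintro ⟨hw1, hw2⟩; exact honly w hw1 (Or.inl hw2)
    · rintro rfl; exact ⟨hz, hyz⟩
  -- r i = 1
  have hri : r (c s (x s)) = 1 := by
    by_contra hcon
    have h1 := (W.hB s).regO (x s) (mem_cp _ _ _)
    have h2 := H.pos (c s (x s))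
    have h3 : 1 < {w | w ∈ cp G (c s) (x s) ∧ G.Adj (x s) w}.ncard := by
      unfold dO at h1; omega
    obtain ⟨y', hy', hne⟩ := Set.exists_ne_of_one_lt_ncard h3 y
    have hy'F : y' ∈ F G c x s := ⟨hy'.1, by rintro rfl; exact G.irrefl _ hy'.2⟩
    exact share_false H h2k (W.hM (t + 1)) (W.E_bad t) (hFE y hy) (hFE y' hy'F) hne.symm fam1
      hxs hxs (hopp y hy) (Or.inr hxy) (Or.inr hy'.2)
  have hr1 : ∀ i, r i = 1 := by
    intro i
    cases hi : c s (x s) <;> rw [hi] at hri hrj <;> cases i <;> simp_all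
  have hk : k = 2 := by have := H.hr; rw [hr1, hr1] at this; omega
  subst hk
  have hCs : cp G (c s) (x s) = {x s, y} := digon_eq (W.hB s) (mem_cp _ _ _) hyC hr1 hxy hyz
  have hFs : F G c x s = {y} := by
    unfold F; rw [hCs]; ext v
    constructor
    · rintro ⟨rfl | h, h2⟩
      · exact absurd rfl h2
      · exact h
    · rintro rfl; exact ⟨Or.inr rfl, hyx⟩
  have hF1 : F G c x (s + 1) = {x s} := by
    have h1 := digon_eq m3 (Or.inl rfl) (Or.inr hxs) hr1 hyz hxy
    ext v
    constructor
    · intro hv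
      have : v ∈ ({y, x s} : Set V) := by rw [← h1]; exact Or.inr hv
      rcases this with rfl | h
      · exact absurd hv m2
      · exact h
    · rintro rfl; exact hxs
  have hE1 : ∀ j, F G c x (j + 1) = {x j} → E G c x j = {x (j + 1), x j} := by
    intro j hj
    rw [← hj, W.F_succ, Set.insert_sdiff_singleton]
    exact (Set.insert_eq_of_mem (W.hx j)).symm
  -- unwinding
  have unw : ∀ j, s ≤ j → j < t → F G c x (j + 1) = {x j} ∧ ∃ e B, M G r e ∧ Bad G r e B ∧
      x j ∈ B ∧ e (x j) = c (j + 1) (x (j + 1)) ∧ ∀ l, j + 2 ≤ l → l ≤ t →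
        IsComp G e (F G c x l) ∧ ∀ v ∈ F G c x l, e v = c l (x l) := by
    intro j hj
    induction j, hj using Nat.le_induction with
    | base =>
      intro _
      refine ⟨hF1, NPO.flip (c (t + 1)) y, insert y (F G c x (s + 1)), m1, m3, Or.inr hxs, ?_, ?_⟩
      · rw [flip_ne _ hyx.symm, fam1c _ hxs]
      · intro l h1 h2
        obtain ⟨i1, i2⟩ := hfam l (by omega) h2
        have hyl : y ∉ F G c x l := hdisj s l (by omega) h2 y hy
        obtain ⟨j1, j2⟩ := step_inv i1 hyl m3.comp (Or.inl rfl) (by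
          rintro v hv (rfl | hv')
          · exact hyl hv
          · exact hdisj (s + 1) l (by omega) h2 v hv' hv)
        exact ⟨j1, fun v hv => by rw [j2 v hv, i2 v hv]⟩
    | succ j hj ih =>
      intro hjt
      obtain ⟨f1, e, B, e1, e2, e3, e4, e5⟩ := ih (by omega)
      have hp := pair_adj H (by rw [← hE1 j f1]; exact W.E_bad j)
      obtain ⟨g1, g2⟩ := e5 (j + 2) le_rfl (by omega)
      have hxj : x (j + 1) ∈ F G c x (j + 2) := W.mem_F_succ (j + 1)
      obtain ⟨q1, q2, q3, q4⟩ := move' H e1 e2 e3 g1 hxj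
        (by rw [g2 _ hxj, e4, W.col_succ (j + 1)]) (Or.inl hp.2)
      have h1 := digon_eq q3 (Or.inl rfl) (Or.inr hxj) hr1 hp.2 hp.1
      refine ⟨?_, NPO.flip e (x j), _, q1, q3, Or.inr hxj, ?_, ?_⟩
      · ext v
        constructor
        · intro hv
          have : v ∈ ({x j, x (j + 1)} : Set V) := by rw [← h1]; exact Or.inr hv
          rcases this with rfl | h
          · exact absurd hv q2
          · exact h
        · rintro rfl; exact hxj
      · rw [flip_ne _ (W.hne j), g2 _ hxj]
      · intro l hl1 hl2
        obtain ⟨i1, i2⟩ := e5 l (by omega) hl2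
        have hyl : x j ∉ F G c x l := hdisj (j + 1) l (by omega) hl2 _ (W.mem_F_succ j)
        obtain ⟨j1, j2⟩ := step_inv i1 hyl q3.comp (Or.inl rfl) (by
          rintro v hv (rfl | hv')
          · exact hyl hv
          · exact hdisj (j + 2) l (by omega) hl2 v hv' hv)
        exact ⟨j1, fun v hv => by rw [j2 v hv, i2 v hv]⟩
  have hadj : ∀ j, s ≤ j → j < t → G.Adj (x (j + 1)) (x j) ∧ G.Adj (x j) (x (j + 1)) := by
    intro j h1 h2
    exact pair_adj H (by rw [← hE1 j (unw j h1 h2).1]; exact W.E_bad j)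
  have hlast : G.Adj (x t) y ∧ G.Adj y (x t) := 
    pair_adj H (c := c (t + 1)) (by rw [← hFs, ← hEF']; exact W.E_bad t)
  have hxne : ∀ i j, i < j → j ≤ t → x i ≠ x j := by
    intro i j hij hjt h
    rcases Nat.lt_or_ge (i + 1) j with h1 | h1
    · have := (inv j (i + 1) h1 hjt).1
      rw [← h] at this
      exact this (W.mem_F_succ i)
    · have : j = i + 1 := by omega
      subst this
      exact W.hne i h.symm
  have hyne : ∀ j, s ≤ j → j ≤ t → y ≠ x j := by
    rintro j h1 h2 rfl
    rcases Nat.lt_or_ge s j with h | h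
    · exact (inv j s h h2).1 hy
    · have : j = s := by omega
      subst this
      exact hyx rfl
  have hpar : ¬ Even (t - s) := by
    intro h
    have h1 := W.col_parity s (t - s)
    rw [if_pos h, Nat.add_sub_cancel' hst, hcolt] at h1
    simp at h1
  refine cycle_false H (n := t - s + 2) (by omega) ?_ (fun i => if i = 0 then y else x (s + i - 1))
    ?_ ?_ ?_
  · rw [Nat.not_even_iff_odd] at hpar
    exact hpar.add_even (by decide)
  · intro i j hij hj
    have hj0 : j ≠ 0 := by omega
    by_cases hi : i = 0
    · simp only [hi, hj0, if_true, if_false]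
      exact hyne _ (by omega) (by omega)
    · simp only [hi, hj0, if_false]
      exact hxne _ _ (by omega) (by omega)
  · intro i hi
    by_cases h0 : i = 0
    · subst h0
      simpa using ⟨hyz, hxy⟩
    · have e : s + (i + 1) - 1 = (s + i - 1) + 1 := by omega
      simp only [h0, if_false, Nat.succ_ne_zero, e]
      exact (hadj (s + i - 1) (by omega) (by omega)).symm
  · have e : s + (t - s + 2 - 1) - 1 = t := by omega
    have e0 : t - s + 2 - 1 ≠ 0 := by omega
    simp only [e0, if_false, if_true, e]
    exact hlast

end walk

theorem no_bad (H : Hyp G r k) (h2k : 2 ≤ k) {c : V → Bool} (hM : M G r c) {C : Set V}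
    (hC : Bad G r c C) : False := by
  obtain ⟨c, x, W⟩ := exists_walk H hM hC
  classical
  have hex := W.exists_hit H
  obtain ⟨s, hs, u, hu, huE⟩ := Nat.find_spec hex
  refine W.hit_false H h2k (t := Nat.find hex) ?_ hs hu huE
  intro n hn s hs u hu huE
  exact Nat.find_min hex hn ⟨s, hs, u, hu, huE⟩

theorem exists_M (G : Digraph' V) (r : Bool → ℕ) : ∃ c, M G r c := by
  obtain ⟨c0, h0⟩ := Finite.exists_min (wt G r)
  obtain ⟨c, hc, hmin⟩ := Set.exists_min_image {c | Normal G r c}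
    (fun c => {S | Bad G r c S}.ncard) (Set.toFinite _) ⟨c0, h0⟩
  exact ⟨c, hc, hmin⟩

theorem deg_le (H : Hyp G r k) (h2k : 2 ≤ k) {c : V → Bool} (hN : Normal G r c) (x : V) :
    dO G {v | c v = c x} x + dI G {v | c v = c x} x ≤ 2 * r (c x) := by
  have h1 := wt_flip H.hr H.hO H.hI c x
  have h2 := hN (NPO.flip c x)
  have h3 : k * (dO G {v | c v = c x} x + dI G {v | c v = c x} x) ≤ k * (2 * r (c x)) := by
    nlinarith
  exact Nat.le_of_mul_le_mul_left h3 (by omega)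

end fin

/-! ### Transfer -/

theorem outDeg_eq (G : Digraph' V) (v : V) : G.outDeg v = dO G Set.univ v := by
  unfold Digraph'.outDeg dO
  rw [← Nat.card_coe_set_eq]
  exact Nat.card_congr (Equiv.subtypeEquivRight (by simp))

theorem inDeg_eq (G : Digraph' V) (v : V) : G.inDeg v = dI G Set.univ v := by
  unfold Digraph'.inDeg dI
  rw [← Nat.card_coe_set_eq]
  exact Nat.card_congr (Equiv.subtypeEquivRight (by simp))

theorem dO_map {W : Type} (K : Digraph' W) (G : Digraph' V) (f : W → V)
    (hf : Function.Injective f) (hadj : ∀ a b, K.Adj a b ↔ G.Adj (f a) (f b)) (a : W) :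
    dO G (Set.range f) (f a) = dO K Set.univ a := by
  unfold dO
  rw [← Set.ncard_image_of_injective _ hf]
  congr 1; ext w
  constructor
  · rintro ⟨⟨b, rfl⟩, h⟩; exact ⟨b, ⟨trivial, (hadj a b).2 h⟩, rfl⟩
  · rintro ⟨b, ⟨-, h⟩, rfl⟩; exact ⟨⟨b, rfl⟩, (hadj a b).1 h⟩

theorem dI_map {W : Type} (K : Digraph' W) (G : Digraph' V) (f : W → V)
    (hf : Function.Injective f) (hadj : ∀ a b, K.Adj a b ↔ G.Adj (f a) (f b)) (a : W) :
    dI G (Set.range f) (f a) = dI K Set.univ a := by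
  unfold dI
  rw [← Set.ncard_image_of_injective _ hf]
  congr 1; ext w
  constructor
  · rintro ⟨⟨b, rfl⟩, h⟩; exact ⟨b, ⟨trivial, (hadj b a).2 h⟩, rfl⟩
  · rintro ⟨b, ⟨-, h⟩, rfl⟩; exact ⟨⟨b, rfl⟩, (hadj b a).1 h⟩

theorem conn_map {W : Type} (K : Digraph' W) (G : Digraph' V) (f : W → V)
    (hf : Function.Injective f) (hadj : ∀ a b, K.Adj a b ↔ G.Adj (f a) (f b)) (a : W)
    (h : Conn K (Set.univ \ {a})) : Conn G (Set.range f \ {f a}) := by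
  rintro T ⟨_, ⟨⟨b, rfl⟩, hb⟩, hbT⟩ hcl
  have := h (f ⁻¹' T) ⟨b, ⟨trivial, by rintro rfl; exact hb rfl⟩, hbT⟩ ?_
  · rintro _ ⟨⟨w, rfl⟩, hw⟩
    exact this ⟨trivial, by rintro rfl; exact hw rfl⟩
  · rintro u ⟨-, hu⟩ huT w ⟨-, hw⟩ huw
    refine hcl (f u) ⟨⟨u, rfl⟩, fun h => hu (hf h)⟩ huT (f w) ⟨⟨w, rfl⟩, fun h => hw (hf h)⟩ ?_
    rcases huw with h | h
    · exact Or.inl ((hadj _ _).1 h)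
    · exact Or.inr ((hadj _ _).1 h)

theorem conn_cycle {W : Type} (K : Digraph' W) {n : ℕ} (hn : 2 ≤ n) (e : W ≃ ZMod n)
    (h : ∀ x y, e y = e x + 1 → K.Adj x y) (a : W) : Conn K (Set.univ \ {a}) := by
  have : NeZero n := ⟨by omega⟩
  rintro T ⟨u, ⟨-, hu⟩, huT⟩ hcl
  let p : ℕ → W := fun m => e.symm (e a + (m : ZMod n))
  have hp : ∀ m, e (p m) = e a + (m : ZMod n) := fun m => e.apply_symm_apply _
  have hpa : ∀ m, 1 ≤ m → m < n → p m ∈ Set.univ \ {a} := by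
    intro m h1 h2
    refine ⟨trivial, fun h3 => ?_⟩
    have h4 : e (p m) = e a := congrArg e h3
    rw [hp] at h4
    have h5 : (m : ZMod n) = 0 := by simpa using h4
    have h6 := congrArg ZMod.val h5
    rw [ZMod.val_natCast_of_lt h2] at h6
    simp at h6; omega
  have hw : ∀ w, w ∉ ({a} : Set W) → ∃ m, 1 ≤ m ∧ m < n ∧ w = p m := by
    intro w hw
    refine ⟨(e w - e a).val, ?_, ZMod.val_lt _, ?_⟩
    · rcases Nat.eq_zero_or_pos (e w - e a).val with h0 | h0
      · rw [ZMod.val_eq_zero, sub_eq_zero] at h0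
        exact absurd (e.injective h0) hw
      · exact h0
    · apply e.injective
      rw [hp, ZMod.natCast_zmod_val]; ring
  have hstep : ∀ m, 1 ≤ m → m + 1 < n → (p (m + 1) ∈ T ↔ p m ∈ T) := by
    intro m h1 h2
    have hA : K.Adj (p m) (p (m + 1)) := by
      apply h; rw [hp, hp]; push_cast; ring
    exact ⟨fun h3 => hcl _ (hpa _ (by omega) h2) h3 _ (hpa m h1 (by omega)) (Or.inr hA),
      fun h3 => hcl _ (hpa _ h1 (by omega)) h3 _ (hpa (m + 1) (by omega) h2) (Or.inl hA)⟩
  have hall : ∀ m, 1 ≤ m → m < n → (p m ∈ T ↔ p 1 ∈ T) := by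
    intro m h1
    induction m, h1 using Nat.le_induction with
    | base => intro _; exact Iff.rfl
    | succ m hm ih => intro h2; rw [hstep m hm h2, ih (by omega)]
  obtain ⟨m, h1, h2, rfl⟩ := hw u hu
  rintro w ⟨-, hwa⟩
  obtain ⟨m', h1', h2', rfl⟩ := hw w hwa
  rw [hall m' h1' h2', ← hall m h1 h2]
  exact huT

theorem exc_props {W : Type} [Finite W] (K : Digraph' W) {ρ : ℕ} (h : K.IsException ρ) (a : W) :
    dO K Set.univ a = ρ ∧ dI K Set.univ a = ρ ∧ Conn K (Set.univ \ {a}) := by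
  rcases h with ⟨rfl, n, hn, e, he⟩ | ⟨rfl, n, hn, -, e, he⟩ | ⟨hρ, hK, hcard⟩
  · refine ⟨?_, ?_, conn_cycle K hn e (fun x y h => (he x y).2 h) a⟩
    · refine Set.ncard_eq_one.2 ⟨e.symm (e a + 1), ?_⟩
      ext w
      simp [he, Equiv.eq_symm_apply]
    · refine Set.ncard_eq_one.2 ⟨e.symm (e a - 1), ?_⟩
      ext w
      simp [he, Equiv.eq_symm_apply, eq_sub_iff_add_eq, eq_comm]
  · have : NeZero n := ⟨by omega⟩
    have hne : e.symm (e a + 1) ≠ e.symm (e a - 1) := by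
      intro h
      have h := e.symm.injective h
      have h2 : ((2 : ℕ) : ZMod n) = 0 := by
        push_cast
        have : (2 : ZMod n) = (e a + 1) - (e a - 1) := by ring
        rw [this, h, sub_self]
      have := congrArg ZMod.val h2
      rw [ZMod.val_natCast_of_lt (by omega)] at this
      simp at this
    refine ⟨?_, ?_, conn_cycle K (by omega) e (fun x y h => (he x y).2 (Or.inl h)) a⟩
    · unfold dO
      rw [← Set.ncard_pair hne]
      congr 1; ext w
      simp [he, Equiv.eq_symm_apply, eq_sub_iff_add_eq, eq_comm]
    · unfold dI
      rw [← Set.ncard_pair hne]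
      congr 1; ext w
      simp [he, Equiv.eq_symm_apply, eq_sub_iff_add_eq, eq_comm, or_comm]
  · have h1 := Set.ncard_sdiff_singleton_add_one (Set.mem_univ a) (Set.toFinite _)
    rw [Set.ncard_univ, hcard] at h1
    refine ⟨?_, ?_, ?_⟩
    · have : {w | w ∈ Set.univ ∧ K.Adj a w} = Set.univ \ {a} := by
        ext w; simp [hK a w, eq_comm]
      unfold dO; rw [this]; omega
    · have : {w | w ∈ Set.univ ∧ K.Adj w a} = Set.univ \ {a} := by
        ext w; simp [hK w a]
      unfold dI; rw [this]; omega
    · rintro T ⟨u, hu, huT⟩ hcl w hw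
      by_cases h : u = w
      · rw [← h]; exact huT
      · exact hcl u hu huT w hw (Or.inl ((hK u w).2 h))

theorem numArcs_eq (G : Digraph' V) (A : Set V) : (G.induce A).numArcs = eA G A := by
  have hinj : Function.Injective (Prod.map (Subtype.val : A → V) (Subtype.val : A → V)) :=
    Subtype.val_injective.prodMap Subtype.val_injective
  have : {p : V × V | p.1 ∈ A ∧ p.2 ∈ A ∧ G.Adj p.1 p.2} =
      Prod.map (Subtype.val : A → V) (Subtype.val : A → V) ''
        {p : A × A | (G.induce A).Adj p.1 p.2} := by
    ext ⟨a, b⟩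
    constructor
    · rintro ⟨h1, h2, h3⟩; exact ⟨(⟨a, h1⟩, ⟨b, h2⟩), h3, rfl⟩
    · rintro ⟨⟨⟨a', h1⟩, ⟨b', h2⟩⟩, h3, h4⟩
      simp only [Prod.map_apply, Prod.mk.injEq] at h4
      obtain ⟨rfl, rfl⟩ := h4
      exact ⟨h1, h2, h3⟩
  unfold eA
  rw [this, Set.ncard_image_of_injective _ hinj]
  rfl

theorem induce_deg (G : Digraph' V) (A : Set V) (v : A) :
    (G.induce A).outDeg v = dO G A v ∧ (G.induce A).inDeg v = dI G A v := by
  rw [outDeg_eq, inDeg_eq, ← dO_map (G.induce A) G Subtype.val Subtype.val_injective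
    (fun _ _ => Iff.rfl), ← dI_map (G.induce A) G Subtype.val Subtype.val_injective
    (fun _ _ => Iff.rfl), Subtype.range_coe]
  exact ⟨rfl, rfl⟩

theorem wt_eq (G : Digraph' V) (r : Bool → ℕ) (c : V → Bool) (A : Set V)
    (hA : ∀ v, v ∈ A ↔ c v = true) :
    wt G r c = r false * (G.induce A).numArcs + r true * (G.induce Aᶜ).numArcs := by
  rw [numArcs_eq, numArcs_eq]
  have h1 : A = {v | c v = true} := by ext v; exact hA v
  have h2 : Aᶜ = {v | c v = false} := by ext v; simp [hA v]
  rw [h2, h1]; rfl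

theorem special_of [Finite V] {G : Digraph' V} {r : Bool → ℕ} {k : ℕ} (H : Hyp G r k)
    (h2k : 2 ≤ k) {c : V → Bool} (hN : Normal G r c) (A : Set V) (i : Bool)
    (hA : ∀ v, v ∈ A ↔ c v = i) : (G.induce A).IsSpecial (r i) := by
  intro v
  have hv := (hA v).1 v.2
  have h := deg_le H h2k hN v.1
  rw [hv] at h
  have h1 : A = {v | c v = i} := by ext v; exact hA v
  rw [← h1] at h
  obtain ⟨e1, e2⟩ := induce_deg G A v
  unfold Digraph'.dmin
  rw [e1, e2]
  omega

theorem bad_of [Finite V] {G : Digraph' V} {r : Bool → ℕ} {c : V → Bool} (A : Set V) (i : Bool)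
    (hA : ∀ v, v ∈ A ↔ c v = i) (v : A)
    (h : ((G.induce A).induce ((G.induce A).component v)).IsException (r i)) :
    Bad G r c (cp G c v) := by
  set K := (G.induce A).induce ((G.induce A).component v) with hK
  let f : ↥((G.induce A).component v) → V := fun z => z.1.1
  have hf : Function.Injective f := Subtype.val_injective.comp Subtype.val_injective
  have hadj : ∀ a b, K.Adj a b ↔ G.Adj (f a) (f b) := fun _ _ => Iff.rfl
  have hrange : Set.range f = cp G c v := by
    ext u
    constructor
    · rintro ⟨⟨z, hz⟩, rfl⟩
      refine Relation.ReflTransGen.lift (Subtype.val : A → V) ?_ _ _ hz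
      intro a b hab
      exact ⟨hab, by rw [(hA a).1 a.2, (hA b).1 b.2]⟩
    · intro hu
      have : ∃ h : u ∈ A, (⟨u, h⟩ : A) ∈ (G.induce A).component v := by
        induction hu with
        | refl => exact ⟨v.2, Relation.ReflTransGen.refl⟩
        | @tail a b _ hab ih =>
          obtain ⟨h1, h2⟩ := ih
          have hb : b ∈ A := by rw [hA, ← hab.2]; exact (hA a).1 h1
          exact ⟨hb, Relation.ReflTransGen.tail h2 hab.1⟩
      obtain ⟨h1, h2⟩ := this
      exact ⟨⟨⟨u, h1⟩, h2⟩, rfl⟩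
  have hcol : ∀ z, c (f z) = i := fun z => (hA _).1 z.1.2
  refine ⟨cp_isComp G c v, ?_, ?_, ?_⟩
  · rw [← hrange]
    rintro _ ⟨z, rfl⟩
    rw [dO_map K G f hf hadj, hcol]
    exact (exc_props K h z).1
  · rw [← hrange]
    rintro _ ⟨z, rfl⟩
    rw [dI_map K G f hf hadj, hcol]
    exact (exc_props K h z).2.1
  · rw [← hrange]
    rintro _ ⟨z, rfl⟩
    exact conn_map K G f hf hadj z (exc_props K h z).2.2

end NPO

/-- For a `k`-regular connected digraph not in `𝓑_k` (`k ≥ 2`) and `r₁ + r₂ = k`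
with `r₁, r₂ ≥ 1`, there is an `(r₁, r₂)`-normal partition `(A, Aᶜ)` such that
`G[A]` is `r₁`-special with no component in `𝓑_{r₁}` and `G[Aᶜ]` is `r₂`-special
with no component in `𝓑_{r₂}`. -/
theorem normal_partition_no_obstruction {V : Type} [Fintype V] (G : Digraph' V)
    (k r₁ r₂ : ℕ) (hk : 2 ≤ k)
    (hreg : ∀ v : V, G.outDeg v = k ∧ G.inDeg v = k) (hc : G.Connected)
    (hexc : ¬ G.IsException k) (h1 : 1 ≤ r₁) (h2 : 1 ≤ r₂) (hsum : r₁ + r₂ = k) :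
    ∃ A : Set V,
      (∀ B : Set V,
        r₂ * (G.induce A).numArcs + r₁ * (G.induce Aᶜ).numArcs ≤
          r₂ * (G.induce B).numArcs + r₁ * (G.induce Bᶜ).numArcs) ∧
      (G.induce A).IsSpecial r₁ ∧ (G.induce Aᶜ).IsSpecial r₂ ∧
      (∀ v : A, ¬ ((G.induce A).induce ((G.induce A).component v)).IsException r₁) ∧
      (∀ v : ↥Aᶜ,
        ¬ ((G.induce Aᶜ).induce ((G.induce Aᶜ).component v)).IsException r₂) := by
  classical
  let r : Bool → ℕ := fun b => if b then r₁ else r₂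
  have H : NPO.Hyp G r k := by
    refine ⟨fun v => ?_, fun v => ?_, hsum, ?_, ?_, hexc⟩
    · rw [← NPO.outDeg_eq]; exact (hreg v).1
    · rw [← NPO.inDeg_eq]; exact (hreg v).2
    · intro i; cases i
      · exact h2
      · exact h1
    · rintro T ⟨u, -, hu⟩ hcl w -
      have := hc.2 u w
      induction this with
      | refl => exact hu
      | @tail a b _ hab ih => exact hcl a trivial ih b trivial hab
  obtain ⟨c, hM⟩ := NPO.exists_M G r
  have hA : ∀ v, v ∈ {v | c v = true} ↔ c v = true := fun v => Iff.rfl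
  have hA' : ∀ v, v ∈ {v | c v = true}ᶜ ↔ c v = false := fun v => by simp
  refine ⟨{v | c v = true}, ?_, NPO.special_of H hk hM.1 _ true hA,
    NPO.special_of H hk hM.1 _ false hA', ?_, ?_⟩
  · intro B
    have h3 := hM.1 (fun v => decide (v ∈ B))
    rw [NPO.wt_eq G r c _ hA, NPO.wt_eq G r _ B (by simp)] at h3
    exact h3
  · intro v hv
    exact NPO.no_bad H hk hM (NPO.bad_of _ true hA v hv)
  · intro v hv
    exact NPO.no_bad H hk hM (NPO.bad_of _ false hA' v hv)
end
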